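/- Let D1, D2 be good drawings of K_n in the sphere with the same rotation scheme, and let R be a Reidemeister triangle for D1 and D2 constituted by edges e, f, g. Then the closed triangular disc D1[R] contains no vertex of K_n in its interior. -/

import Mathlib

open Set unitInterval

noncomputable section

/-- The 2-sphere, realized as the unit sphere in `ℝ³`. -/
abbrev Sph : Type := ↥(Metric.sphere (0 : EuclideanSpace ℝ (Fin 3)) 1)

/-- A drawing of the complete graph `K_n` in the sphere: an injective placement of the
vertices together with, for each ordered pair of distinct vertices, a simple arc joining
them (the same arc in both directions), meeting the vertex set only at its endpoints. -/
structure SphereDrawing (n : ℕ) where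
  vert : Fin n → Sph
  vert_inj : Function.Injective vert
  edge : ∀ i j : Fin n, i ≠ j → Path (vert i) (vert j)
  edge_symm : ∀ (i j : Fin n) (h : i ≠ j), edge j i h.symm = (edge i j h).symm
  edge_inj : ∀ (i j : Fin n) (h : i ≠ j), Function.Injective ⇑(edge i j h)
  edge_vert : ∀ (i j : Fin n) (h : i ≠ j),
    Set.range ⇑(edge i j h) ∩ Set.range vert = {vert i, vert j}

namespace SphereDrawing

variable {n : ℕ}

/-- The point set of the edge between `i` and `j` (empty if `i = j`). -/
def arc (D : SphereDrawing n) (i j : Fin n) : Set Sph :=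
  ⋃ h : i ≠ j, Set.range ⇑(D.edge i j h)

/-- The open interior of an edge: its point set minus all vertices. -/
def inner (D : SphereDrawing n) (i j : Fin n) : Set Sph :=
  D.arc i j \ Set.range D.vert

/-- A good drawing: no two edges with a common end cross; no two (independent) edges
cross more than once; and no three edges pass through a common non-vertex point. -/
structure IsGood (D : SphereDrawing n) : Prop where
  adj : ∀ i j k : Fin n, j ≠ k → D.inner i j ∩ D.inner i k = ∅
  indep : ∀ i j k l : Fin n, ([i, j, k, l] : List (Fin n)).Nodup →
    (D.inner i j ∩ D.inner k l).Subsingleton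
  no_triple : ∀ p : Sph, p ∉ Set.range D.vert →
    {s : Fin n × Fin n | s.1 < s.2 ∧ p ∈ D.arc s.1 s.2}.encard ≤ 2

/-- Independent edges `ij` and `kl` cross: their interiors meet. -/
def Cross (D : SphereDrawing n) (i j k l : Fin n) : Prop :=
  (D.inner i j ∩ D.inner k l).Nonempty

end SphereDrawing

/-- A self-homeomorphism of the sphere is orientation preserving iff it is homotopic to
the identity (i.e. has degree `1`). -/
def OrientPres (h : Sph ≃ₜ Sph) : Prop :=
  ContinuousMap.Homotopic ⟨⇑h, h.continuous⟩ (ContinuousMap.id Sph)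

/-- Two drawings of `K_n` have the same rotation at `v` if some orientation-preserving
homeomorphism of the sphere carries the first drawing's germ at `v` (the vertex together
with initial pieces of all incident edges) into the second drawing's edges at `v`. -/
def SameRotationAt (D1 D2 : SphereDrawing n) (v : Fin n) : Prop :=
  ∃ h : Sph ≃ₜ Sph, OrientPres h ∧ h (D1.vert v) = D2.vert v ∧
    ∃ U ∈ nhds (D1.vert v), ∀ u : Fin n, u ≠ v →
      h '' (D1.arc v u ∩ U) ⊆ D2.arc v u

/-- Same rotation scheme: the same rotation at every vertex. -/
def SameRotation {n : ℕ} (D1 D2 : SphereDrawing n) : Prop :=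
  ∀ v : Fin n, SameRotationAt D1 D2 v

/-- Two continuous logarithms of the same function on a preconnected set differ by a constant. -/
theorem sub_eq_sub_of_exp_eqOn {X : Type*} [TopologicalSpace X] {s : Set X} (hs : IsPreconnected s)
    {g g' : X → ℂ} (hg : ContinuousOn g s) (hg' : ContinuousOn g' s)
    (h : ∀ t ∈ s, Complex.exp (g t) = Complex.exp (g' t)) {x y : X} (hx : x ∈ s) (hy : y ∈ s) :
    g y - g x = g' y - g' x := by
  have key : ∀ t ∈ s, ∃ n : ℤ, g t - g' t = n * (2 * Real.pi * Complex.I) := by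
    intro t ht
    obtain ⟨n, hn⟩ := Complex.exp_eq_exp_iff_exists_int.1 (h t ht)
    exact ⟨n, by rw [hn]; ring⟩
  have hc : ContinuousOn (fun t => ((g t - g' t) / (2 * Real.pi * Complex.I)).re) s := by
    apply Complex.continuous_re.comp_continuousOn
    exact (hg.sub hg').div_const _
  have h2 : (2 * Real.pi * Complex.I : ℂ) ≠ 0 := by simp [Real.pi_ne_zero]
  have hr : ∀ t ∈ s, ∃ n : ℤ, ((g t - g' t) / (2 * Real.pi * Complex.I)).re = n := by
    intro t ht
    obtain ⟨n, hn⟩ := key t ht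
    refine ⟨n, ?_⟩
    rw [hn, mul_div_cancel_right₀ _ h2]; simp
  choose! n hn using key
  have hre : ∀ t ∈ s, ((g t - g' t) / (2 * Real.pi * Complex.I)).re = n t := by
    intro t ht
    rw [hn t ht, mul_div_cancel_right₀ _ h2]; simp
  have hni : ContinuousOn n s := by
    have : ContinuousOn (fun t => (n t : ℝ)) s := hc.congr fun t ht => (hre t ht).symm
    exact Int.isClosedEmbedding_coe_real.isInducing.continuousOn_iff.2 this
  have := hs.constant hni hx hy
  have e1 := hn x hx
  have e2 := hn y hy
  rw [this] at e1
  linear_combination e2 - e1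

/-- A continuous nonvanishing function on a real normed space has a continuous logarithm on
any open convex set. -/
theorem exists_log_of_convex {E : Type*} [NormedAddCommGroup E] [NormedSpace ℝ E]
    {U : Set E} (hU : Convex ℝ U) (hUo : IsOpen U) {f : E → ℂ}
    (hf : ContinuousOn f U) (h0 : ∀ x ∈ U, f x ≠ 0) :
    ∃ g : E → ℂ, ContinuousOn g U ∧ ∀ x ∈ U, Complex.exp (g x) = f x := by
  rcases U.eq_empty_or_nonempty with rfl | hne
  · exact ⟨0, by simp, by simp⟩
  have hsc : IsSimplyConnected U := by
    have := hU.contractibleSpace hne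
    exact (inferInstance : SimplyConnectedSpace U)
  obtain ⟨g, hg, he⟩ := Complex.exists_continuousOn_eqOn_exp_comp hsc hUo hf
    (by rintro ⟨x, hx, h⟩; exact h0 x hx h)
  exact ⟨g, hg, he⟩

/-- The change of the logarithm of `f` between `a` and `b`. -/
def logChange (f : ℝ → ℂ) (a b : ℝ) : ℂ :=
  open Classical in
  if h : ∃ g : ℝ → ℂ, ContinuousOn g (uIcc a b) ∧ ∀ t ∈ uIcc a b, Complex.exp (g t) = f t then
    h.choose b - h.choose a else 0

theorem logChange_eq {f g : ℝ → ℂ} {a b : ℝ} (hg : ContinuousOn g (uIcc a b))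
    (h : ∀ t ∈ uIcc a b, Complex.exp (g t) = f t) : logChange f a b = g b - g a := by
  have hex : ∃ g : ℝ → ℂ, ContinuousOn g (uIcc a b) ∧ ∀ t ∈ uIcc a b, Complex.exp (g t) = f t :=
    ⟨g, hg, h⟩
  rw [logChange, dif_pos hex]
  exact sub_eq_sub_of_exp_eqOn isPreconnected_uIcc hex.choose_spec.1 hg
    (fun t ht => (hex.choose_spec.2 t ht).trans (h t ht).symm) left_mem_uIcc right_mem_uIcc

theorem exists_log_uIcc {f : ℝ → ℂ} {a b : ℝ} (hf : ContinuousOn f (uIcc a b))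
    (h0 : ∀ t ∈ uIcc a b, f t ≠ 0) :
    ∃ g : ℝ → ℂ, Continuous g ∧ ∀ t ∈ uIcc a b, Complex.exp (g t) = f t := by
  let r : ℝ → ℝ := fun t => projIcc (min a b) (max a b) min_le_max t
  have hr : Continuous r := continuous_subtype_val.comp continuous_projIcc
  have hm : ∀ t, r t ∈ uIcc a b := fun t => (projIcc (min a b) (max a b) min_le_max t).2
  obtain ⟨g, hg, he⟩ := exists_log_of_convex (convex_univ (E := ℝ)) isOpen_univ
    (f := fun t => f (r t)) (hf.comp_continuous hr hm).continuousOn (fun t _ => h0 _ (hm t))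
  refine ⟨g, continuousOn_univ.1 hg, fun t ht => ?_⟩
  rw [he t trivial]
  congr 1
  exact congrArg Subtype.val (projIcc_of_mem min_le_max ht)

theorem exists_log_rect {F : ℝ × ℝ → ℂ} {a b c d : ℝ} (hF : ContinuousOn F (uIcc a b ×ˢ uIcc c d))
    (h0 : ∀ t ∈ uIcc a b ×ˢ uIcc c d, F t ≠ 0) :
    ∃ g : ℝ × ℝ → ℂ, Continuous g ∧ ∀ t ∈ uIcc a b ×ˢ uIcc c d, Complex.exp (g t) = F t := by
  let r : ℝ → ℝ → ℝ → ℝ := fun a b t => projIcc (min a b) (max a b) min_le_max t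
  have hr : ∀ a b, Continuous (r a b) := fun a b => continuous_subtype_val.comp continuous_projIcc
  have hm : ∀ a b t, r a b t ∈ uIcc a b :=
    fun a b t => (projIcc (min a b) (max a b) min_le_max t).2
  have hR : ∀ a b t, t ∈ uIcc a b → r a b t = t := fun a b t ht =>
    congrArg Subtype.val (projIcc_of_mem min_le_max ht)
  have hmm : ∀ t : ℝ × ℝ, (r a b t.1, r c d t.2) ∈ uIcc a b ×ˢ uIcc c d :=
    fun t => ⟨hm _ _ _, hm _ _ _⟩
  obtain ⟨g, hg, he⟩ := exists_log_of_convex (convex_univ (E := ℝ × ℝ)) isOpen_univ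
    (f := fun t => F (r a b t.1, r c d t.2))
    (hF.comp_continuous (((hr a b).comp continuous_fst).prodMk ((hr c d).comp continuous_snd))
      hmm).continuousOn (fun t _ => h0 _ (hmm t))
  refine ⟨g, continuousOn_univ.1 hg, fun t ht => ?_⟩
  rw [he t trivial, hR _ _ _ ht.1, hR _ _ _ ht.2]

theorem logChange_symm (f : ℝ → ℂ) (a b : ℝ) : logChange f b a = -logChange f a b := by
  by_cases hex : ∃ g : ℝ → ℂ, ContinuousOn g (uIcc a b) ∧ ∀ t ∈ uIcc a b, Complex.exp (g t) = f t
  · obtain ⟨g, hg, h⟩ := hex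
    rw [logChange_eq hg h, logChange_eq (g := g) (by rwa [uIcc_comm]) (by rwa [uIcc_comm])]
    ring
  · rw [logChange, logChange, dif_neg hex, dif_neg (by rwa [uIcc_comm])]
    simp

/-- The change of the logarithm of `γ - z` along the piece of `γ` from `a` to `b`. -/
def lc (γ : ℝ → ℂ) (a b : ℝ) (z : ℂ) : ℂ := logChange (fun t => γ t - z) a b

theorem lc_symm (γ : ℝ → ℂ) (a b : ℝ) (z : ℂ) : lc γ b a z = -lc γ a b z := logChange_symm _ _ _

theorem lc_eq {γ g : ℝ → ℂ} {a b : ℝ} {z : ℂ} (hg : ContinuousOn g (uIcc a b))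
    (h : ∀ t ∈ uIcc a b, Complex.exp (g t) = γ t - z) : lc γ a b z = g b - g a :=
  logChange_eq hg h

theorem exists_lc {γ : ℝ → ℂ} (hγ : Continuous γ) {a b : ℝ} {z : ℂ}
    (h : ∀ t ∈ uIcc a b, γ t ≠ z) :
    ∃ g : ℝ → ℂ, Continuous g ∧ ∀ t ∈ uIcc a b, Complex.exp (g t) = γ t - z :=
  exists_log_uIcc (by fun_prop) fun t ht => sub_ne_zero.2 (h t ht)

theorem lc_add {γ : ℝ → ℂ} (hγ : Continuous γ) {a b c : ℝ} {z : ℂ}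
    (h : ∀ t ∈ uIcc a b, γ t ≠ z) (h' : ∀ t ∈ uIcc b c, γ t ≠ z) :
    lc γ a b z + lc γ b c z = lc γ a c z := by
  let m := min a (min b c)
  let M := max a (max b c)
  have hsub : uIcc m M ⊆ uIcc a b ∪ uIcc b c := by
    intro t ht
    rw [uIcc_of_le (by simp [m, M])] at ht
    simp only [mem_union, mem_uIcc]
    simp only [m, M, mem_Icc, min_le_iff, le_max_iff] at ht
    grind
  have hz : ∀ t ∈ uIcc m M, γ t ≠ z := fun t ht => (hsub ht).elim (h t) (h' t)
  obtain ⟨g, hg, he⟩ := exists_lc hγ hz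
  have hmem : a ∈ uIcc m M ∧ b ∈ uIcc m M ∧ c ∈ uIcc m M := by
    rw [uIcc_of_le (by simp [m, M])]
    simp [m, M]
  have hs : ∀ {x y}, x ∈ uIcc m M → y ∈ uIcc m M → uIcc x y ⊆ uIcc m M :=
    fun hx hy => uIcc_subset_uIcc hx hy
  rw [lc_eq hg.continuousOn fun t ht => he t (hs hmem.1 hmem.2.1 ht),
    lc_eq hg.continuousOn fun t ht => he t (hs hmem.2.1 hmem.2.2 ht),
    lc_eq hg.continuousOn fun t ht => he t (hs hmem.1 hmem.2.2 ht)]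
  ring


theorem lc_comp {γ δ : ℝ → ℂ} {φ : ℝ → ℝ} {a b c d : ℝ} {z : ℂ} (hγ : Continuous γ)
    (hφ : ContinuousOn φ (uIcc c d)) (hm : MapsTo φ (uIcc c d) (uIcc a b)) (hc : φ c = a)
    (hd : φ d = b) (hδ : ∀ t ∈ uIcc c d, δ t = γ (φ t)) (h : ∀ t ∈ uIcc a b, γ t ≠ z) :
    lc δ c d z = lc γ a b z := by
  obtain ⟨g, hg, he⟩ := exists_lc hγ h
  rw [lc_eq hg.continuousOn he, lc_eq (g := g ∘ φ) (hg.comp_continuousOn hφ)]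
  · simp [hc, hd]
  · intro t ht
    rw [hδ t ht, Function.comp, he _ (hm ht)]

/-- The boundary log change of `γ s - δ t` over a rectangle. -/
def rect (γ : ℝ → ℂ) (a b : ℝ) (δ : ℝ → ℂ) (c d : ℝ) : ℂ :=
  lc γ a b (δ c) + lc δ c d (γ b) - lc γ a b (δ d) - lc δ c d (γ a)

theorem rect_eq_zero {γ δ : ℝ → ℂ} (hγ : Continuous γ) (hδ : Continuous δ) {a b c d : ℝ}
    (h : ∀ s ∈ uIcc a b, ∀ t ∈ uIcc c d, γ s ≠ δ t) : rect γ a b δ c d = 0 := by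
  obtain ⟨g, hg, he⟩ := exists_log_rect (F := fun p => γ p.1 - δ p.2) (a := a) (b := b)
    (c := c) (d := d) (by fun_prop) (fun p hp => sub_ne_zero.2 (h _ hp.1 _ hp.2))
  have h1 : ∀ t ∈ uIcc c d, lc γ a b (δ t) = g (b, t) - g (a, t) := fun t ht =>
    lc_eq (g := fun s => g (s, t)) (by fun_prop) fun s hs => he (s, t) ⟨hs, ht⟩
  have h2 : ∀ s ∈ uIcc a b, lc δ c d (γ s) = g (s, d) - g (s, c) := fun s hs => by
    rw [lc_eq (g := fun t => g (s, t) + Real.pi * Complex.I) (by fun_prop)]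
    · ring
    · intro t ht
      rw [Complex.exp_add, Complex.exp_pi_mul_I, he (s, t) ⟨hs, ht⟩]
      ring
  rw [rect, h1 _ left_mem_uIcc, h1 _ right_mem_uIcc, h2 _ left_mem_uIcc, h2 _ right_mem_uIcc]
  ring

theorem rect_add_left {γ δ : ℝ → ℂ} (hγ : Continuous γ) {a b e c d : ℝ}
    (h1 : ∀ s ∈ uIcc a b, γ s ≠ δ c ∧ γ s ≠ δ d) (h2 : ∀ s ∈ uIcc b e, γ s ≠ δ c ∧ γ s ≠ δ d) :
    rect γ a b δ c d + rect γ b e δ c d = rect γ a e δ c d := by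
  simp only [rect]
  rw [← lc_add hγ (fun s hs => (h1 s hs).1) (fun s hs => (h2 s hs).1),
    ← lc_add hγ (fun s hs => (h1 s hs).2) (fun s hs => (h2 s hs).2)]
  ring

theorem rect_swap (γ δ : ℝ → ℂ) (a b c d : ℝ) : rect γ a b δ c d = -rect δ c d γ a b := by
  simp only [rect]; ring

theorem rect_symm_left (γ δ : ℝ → ℂ) (a b c d : ℝ) : rect γ b a δ c d = -rect γ a b δ c d := by
  simp only [rect, lc_symm γ a b]; ring

theorem rect_symm_right (γ δ : ℝ → ℂ) (a b c d : ℝ) : rect γ a b δ d c = -rect γ a b δ c d := by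
  simp only [rect, lc_symm δ c d]; ring

theorem rect_add_right {γ δ : ℝ → ℂ} (hδ : Continuous δ) {a b c d e : ℝ}
    (h1 : ∀ s ∈ uIcc c d, δ s ≠ γ a ∧ δ s ≠ γ b) (h2 : ∀ s ∈ uIcc d e, δ s ≠ γ a ∧ δ s ≠ γ b) :
    rect γ a b δ c d + rect γ a b δ d e = rect γ a b δ c e := by
  simp only [rect_swap γ δ]
  rw [← rect_add_left hδ h1 h2]; ring

/-- Comparison of the log changes along two arcs with a common starting point. -/
def lam (γ : ℝ → ℂ) (a b : ℝ) (δ : ℝ → ℂ) (c d : ℝ) : ℂ :=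
  lc δ c d (γ b) - lc γ a b (δ d)

theorem lam_swap (γ : ℝ → ℂ) (a b : ℝ) (δ : ℝ → ℂ) (c d : ℝ) :
    lam γ a b δ c d = -lam δ c d γ a b := by simp only [lam]; ring

/-- The arc `γ` from `a` to `b` meets the arc `δ` from `c` to `d` only in their starting points. -/
def Germs (γ : ℝ → ℂ) (a b : ℝ) (δ : ℝ → ℂ) (c d : ℝ) : Prop :=
  γ a = δ c ∧ ∀ s ∈ uIcc a b, ∀ t ∈ uIcc c d, γ s = δ t → s = a ∧ t = c

theorem Germs.symm {γ δ : ℝ → ℂ} {a b c d : ℝ} (h : Germs γ a b δ c d) : Germs δ c d γ a b :=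
  ⟨h.1.symm, fun s hs t ht e => (h.2 t ht s hs e.symm).symm⟩

theorem Germs.mono {γ δ : ℝ → ℂ} {a b c d s t : ℝ} (h : Germs γ a b δ c d) (hs : s ∈ uIcc a b)
    (ht : t ∈ uIcc c d) : Germs γ a s δ c t :=
  ⟨h.1, fun _ hx _ hy e => h.2 _ (uIcc_subset_uIcc left_mem_uIcc hs hx) _
    (uIcc_subset_uIcc left_mem_uIcc ht hy) e⟩

theorem lam_trunc_left {γ δ : ℝ → ℂ} (hγ : Continuous γ) (hδ : Continuous δ) {a b c d s : ℝ}
    (h : Germs γ a b δ c d) (hs : s ∈ uIcc a b) (hsa : s ≠ a) (hdc : d ≠ c) :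
    lam γ a b δ c d = lam γ a s δ c d - lc γ s b (γ a) := by
  have hsub : uIcc s b ⊆ uIcc a b := uIcc_subset_uIcc hs right_mem_uIcc
  have hns : ∀ t ∈ uIcc s b, t ≠ a := by
    rintro t ht rfl
    apply hsa
    rw [mem_uIcc] at hs ht
    grind
  have hr : rect γ s b δ c d = 0 := rect_eq_zero hγ hδ fun x hx y hy e =>
    hns x hx (h.2 x (hsub hx) y hy e).1
  have hadd : lc γ a s (δ d) + lc γ s b (δ d) = lc γ a b (δ d) := by
    refine lc_add hγ (fun x hx e => hdc ?_) (fun x hx e => hdc ?_)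
    · exact (h.2 x (uIcc_subset_uIcc left_mem_uIcc hs hx) d right_mem_uIcc e).2
    · exact (h.2 x (hsub hx) d right_mem_uIcc e).2
  simp only [rect, ← h.1] at hr
  simp only [lam]
  linear_combination hr + hadd

theorem lam_trunc_right {γ δ : ℝ → ℂ} (hγ : Continuous γ) (hδ : Continuous δ) {a b c d t : ℝ}
    (h : Germs γ a b δ c d) (ht : t ∈ uIcc c d) (htc : t ≠ c) (hba : b ≠ a) :
    lam γ a b δ c d = lam γ a b δ c t + lc δ t d (γ a) := by
  rw [lam_swap, lam_trunc_left hδ hγ h.symm ht htc hba, lam_swap, h.1]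
  ring

theorem lam_trunc {γ δ : ℝ → ℂ} (hγ : Continuous γ) (hδ : Continuous δ) {a b c d s t : ℝ}
    (h : Germs γ a b δ c d) (hs : s ∈ uIcc a b) (hsa : s ≠ a) (ht : t ∈ uIcc c d) (htc : t ≠ c) :
    lam γ a b δ c d = lam γ a s δ c t + lc δ t d (γ a) - lc γ s b (γ a) := by
  have hdc : d ≠ c := by rintro rfl; simp at ht; exact htc ht
  rw [lam_trunc_left hγ hδ h hs hsa hdc,
    lam_trunc_right hγ hδ (h.mono hs right_mem_uIcc) ht htc hsa]

/-- An arc leaving the disc of radius `ρ` has an initial piece ending on the boundary circle. -/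
theorem exists_first_hit {f : ℝ → ℝ} (hf : Continuous f) {a b ρ : ℝ} (ha : f a < ρ)
    (hb : ρ < f b) : ∃ s ∈ uIcc a b, s ≠ a ∧ f s = ρ ∧ ∀ t ∈ uIcc a s, f t ≤ ρ := by
  let g : ℝ → ℝ := fun t => f (a + (b - a) * t)
  have hg : Continuous g := by fun_prop
  let S : Set ℝ := {t | 0 ≤ t ∧ ρ ≤ g t}
  have hS : IsClosed S := (isClosed_le continuous_const continuous_id).inter
    (isClosed_le continuous_const hg)
  have hne : (1 : ℝ) ∈ S := ⟨zero_le_one, by simp [g, hb.le]⟩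
  have hbdd : BddBelow S := ⟨0, fun t ht => ht.1⟩
  have hmem : sInf S ∈ S := hS.csInf_mem ⟨1, hne⟩ hbdd
  set t₀ := sInf S
  have h1 : t₀ ≤ 1 := csInf_le hbdd hne
  have hlt : ∀ t, 0 ≤ t → t < t₀ → g t < ρ := fun t h0 ht => by
    by_contra! hc
    exact absurd (csInf_le hbdd (⟨h0, hc⟩ : t ∈ S)) (not_le.2 ht)
  have hpos : 0 < t₀ := by
    rcases hmem.1.lt_or_eq with h | h
    · exact h
    · have := hmem.2
      rw [← h] at this
      simp [g] at this
      linarith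
  have heq : g t₀ = ρ := by
    refine le_antisymm ?_ hmem.2
    have hcl : t₀ ∈ closure (Ico 0 t₀) := by
      rw [closure_Ico hpos.ne]; exact ⟨hpos.le, le_rfl⟩
    exact closure_minimal (fun t ht => (hlt t ht.1 ht.2).le)
      (isClosed_le hg continuous_const) hcl
  have hab : a ≠ b := by rintro rfl; linarith
  refine ⟨a + (b - a) * t₀, ?_, ?_, heq, fun t ht => ?_⟩
  · rw [mem_uIcc]
    rcases le_total a b with h | h
    · left; constructor <;> nlinarith
    · right; constructor <;> nlinarith
  · have : (b - a) * t₀ ≠ 0 := mul_ne_zero (sub_ne_zero.2 hab.symm) hpos.ne'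
    simpa using this
  · have hba : b - a ≠ 0 := sub_ne_zero.2 hab.symm
    have ht' : t = a + (b - a) * ((t - a) / (b - a)) := by field_simp; ring
    have : f t = g ((t - a) / (b - a)) := by simp only [g]; rw [← ht']
    rw [this]
    set u := (t - a) / (b - a)
    have hu : 0 ≤ u ∧ u ≤ t₀ := by
      rw [ht', mem_uIcc] at ht
      rcases lt_or_gt_of_ne hab with h | h
      · constructor <;> rcases ht with ht | ht <;> nlinarith
      · constructor <;> rcases ht with ht | ht <;> nlinarith
    rcases hu.2.lt_or_eq with h | h
    · exact (hlt u hu.1 h).le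
    · rw [h, heq]

/-- The log change around a boundary point of a disc along an arc in the disc. -/
theorem lc_disc {δ : ℝ → ℂ} (hδ : Continuous δ) {c d : ℝ} {X p : ℂ} (hp : p ≠ X)
    (hc : δ c = X) (hle : ∀ t ∈ uIcc c d, ‖δ t - X‖ ≤ ‖p - X‖) (hne : ∀ t ∈ uIcc c d, δ t ≠ p) :
    lc δ c d p = Complex.log (1 - (δ d - X) / (p - X)) := by
  have hp' : p - X ≠ 0 := sub_ne_zero.2 hp
  have hslit : ∀ t ∈ uIcc c d, 1 - (δ t - X) / (p - X) ∈ Complex.slitPlane := by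
    intro t ht
    set u := (δ t - X) / (p - X) with hu
    have hu1 : ‖u‖ ≤ 1 := by
      rw [hu, norm_div]; exact div_le_one_of_le₀ (hle t ht) (norm_nonneg _)
    have hu2 : u ≠ 1 := by
      rw [hu, Ne, div_eq_one_iff_eq hp']
      intro h; exact hne t ht (sub_left_injective h)
    left
    have hre : u.re ≤ 1 := (Complex.re_le_norm u).trans hu1
    rcases hre.lt_or_eq with h | h
    · simpa using h
    · exfalso
      apply hu2
      have h2 : u.re ^ 2 + u.im ^ 2 ≤ 1 := by
        have := Complex.sq_norm u
        rw [Complex.normSq_apply] at this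
        nlinarith [norm_nonneg u]
      have : u.im = 0 := by rw [h] at h2; nlinarith
      exact Complex.ext (by simpa using h) (by simpa using this)
  rw [lc_eq (g := fun t => Complex.log (1 - (δ t - X) / (p - X)) + Complex.log (-(p - X)))]
  · simp [hc]
  · apply ContinuousOn.add _ continuousOn_const
    apply ContinuousOn.clog _ hslit
    fun_prop
  · intro t ht
    rw [Complex.exp_add, Complex.exp_log (Complex.slitPlane_ne_zero (hslit t ht)),
      Complex.exp_log (neg_ne_zero.2 hp')]
    field_simp
    ring

theorem log_one_sub_exp {ψ : ℝ} (h0 : 0 < ψ) (h1 : ψ < 2 * Real.pi) :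
    Complex.log (1 - Complex.exp (ψ * Complex.I)) =
      Real.log (2 * Real.sin (ψ / 2)) + ((ψ - Real.pi) / 2 : ℝ) * Complex.I := by
  have hs : 0 < Real.sin (ψ / 2) := Real.sin_pos_of_pos_of_lt_pi (by linarith) (by linarith)
  rw [← Complex.log_exp (x := Real.log (2 * Real.sin (ψ / 2)) +
    ((ψ - Real.pi) / 2 : ℝ) * Complex.I)]
  · congr 1
    rw [Complex.exp_add, ← Complex.ofReal_exp, Real.exp_log (by linarith)]
    have e1 : ((ψ - Real.pi) / 2 : ℝ) * Complex.I =
      (ψ / 2 : ℝ) * Complex.I - Real.pi / 2 * Complex.I := by push_cast; ring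
    have e2 : (ψ : ℂ) * Complex.I = (ψ / 2 : ℝ) * Complex.I + (ψ / 2 : ℝ) * Complex.I := by
      push_cast; ring
    rw [e1, e2, Complex.exp_sub, Complex.exp_pi_div_two_mul_I, Complex.exp_add,
      Complex.exp_mul_I, ← Complex.ofReal_sin, ← Complex.ofReal_cos]
    have h3 := Real.sin_sq_add_cos_sq (ψ / 2)
    rw [Complex.div_I]
    have h4 : (Real.sin (ψ / 2) : ℂ) ^ 2 + (Real.cos (ψ / 2) : ℂ) ^ 2 = 1 := by
      rw [← Complex.ofReal_pow, ← Complex.ofReal_pow, ← Complex.ofReal_add, h3]; simp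
    push_cast
    push_cast at h4
    have hI := Complex.I_sq
    linear_combination -h4 + Complex.sin (↑ψ / 2) ^ 2 * hI
  · simp
    linarith [Real.pi_pos]
  · simp
    linarith [Real.pi_pos]

theorem log_sub_log_circle {θ η : ℝ} (h0 : 0 < η - θ) (h1 : η - θ < 2 * Real.pi) :
    Complex.log (1 - Complex.exp (η * Complex.I) / Complex.exp (θ * Complex.I)) -
      Complex.log (1 - Complex.exp (θ * Complex.I) / Complex.exp (η * Complex.I)) =
      (η - θ - Real.pi) * Complex.I := by
  rw [← Complex.exp_sub, ← Complex.exp_sub]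
  have e1 : (η : ℂ) * Complex.I - θ * Complex.I = (η - θ : ℝ) * Complex.I := by push_cast; ring
  have e2 : (θ : ℂ) * Complex.I - η * Complex.I =
      (2 * Real.pi - (η - θ) : ℝ) * Complex.I - 2 * Real.pi * Complex.I := by push_cast; ring
  rw [e1, e2, Complex.exp_sub, Complex.exp_two_pi_mul_I, div_one, log_one_sub_exp h0 h1,
    log_one_sub_exp (by linarith) (by linarith)]
  have : Real.sin ((2 * Real.pi - (η - θ)) / 2) = Real.sin ((η - θ) / 2) := by
    rw [← Real.sin_pi_sub]; congr 1; ring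
  rw [this]
  push_cast
  ring

/-- The sign recording which of two angles is larger. -/
def sg (x y : ℝ) : ℂ := if y < x then 1 else -1

theorem sg_swap {x y : ℝ} (h : x ≠ y) : sg y x = -sg x y := by
  unfold sg
  rcases lt_or_gt_of_ne h with h | h <;> simp [h, h.not_gt]

/-- Local structure of a finite family of arcs meeting only at their common starting point. -/
theorem local_structure {ι : Type*} [Finite ι] {γ : ι → ℝ → ℂ} {a b : ι → ℝ} {X : ℂ}
    (hγ : ∀ i, Continuous (γ i)) (hX : ∀ i, γ i (a i) = X)
    (hinj : ∀ i, ∀ t ∈ uIcc (a i) (b i), γ i t = X → t = a i) (hab : ∀ i, a i ≠ b i)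
    (hg : ∀ i j, i ≠ j → Germs (γ i) (a i) (b i) (γ j) (a j) (b j)) :
    ∃ (l : ι → ℂ) (θ : ι → ℝ), Function.Injective θ ∧
      (∀ i, Complex.exp (l i) = γ i (b i) - X) ∧
      ∀ i j, i ≠ j → lam (γ i) (a i) (b i) (γ j) (a j) (b j) =
        l j - l i + Real.pi * Complex.I * sg (θ i) (θ j) := by
  have hpos : ∀ i, 0 < ‖γ i (b i) - X‖ := fun i => norm_pos_iff.2 <| sub_ne_zero.2 fun h =>
    hab i (hinj i _ right_mem_uIcc h).symm
  obtain ⟨ρ, hρ, hρi⟩ : ∃ ρ : ℝ, 0 < ρ ∧ ∀ i, ρ < ‖γ i (b i) - X‖ := by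
    rcases isEmpty_or_nonempty ι with h | h
    · exact ⟨1, one_pos, fun i => h.elim i⟩
    · obtain ⟨i₀, hi₀⟩ := Finite.exists_min (fun i => ‖γ i (b i) - X‖)
      exact ⟨‖γ i₀ (b i₀) - X‖ / 2, half_pos (hpos _),
        fun i => (half_lt_self (hpos i₀)).trans_le (hi₀ i)⟩
  have hex : ∀ i, ∃ s ∈ uIcc (a i) (b i), s ≠ a i ∧ ‖γ i s - X‖ = ρ ∧
      ∀ t ∈ uIcc (a i) s, ‖γ i t - X‖ ≤ ρ := fun i =>
    exists_first_hit (f := fun t => ‖γ i t - X‖) (by have := hγ i; fun_prop)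
      (by simpa [hX i] using hρ) (hρi i)
  choose s hs hsa hsρ hsle using hex
  have hθ : ∀ i, ∃ θ : ℝ, 0 ≤ θ ∧ θ < 2 * Real.pi ∧
      γ i (s i) - X = ρ * Complex.exp (θ * Complex.I) := by
    intro i
    refine ⟨toIcoMod Real.two_pi_pos 0 (Complex.arg (γ i (s i) - X)),
      (toIcoMod_mem_Ico _ _ _).1, by simpa using (toIcoMod_mem_Ico Real.two_pi_pos 0 _).2, ?_⟩
    conv_lhs => rw [← Complex.norm_mul_exp_arg_mul_I (γ i (s i) - X), hsρ i]
    congr 1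
    obtain ⟨k, hk⟩ := (⟨_, rfl⟩ : ∃ k, k = toIcoDiv Real.two_pi_pos 0
      (Complex.arg (γ i (s i) - X)))
    rw [toIcoMod, ← hk, Complex.exp_eq_exp_iff_exists_int]
    refine ⟨k, ?_⟩
    push_cast [zsmul_eq_mul]
    ring
  choose θ hθ0 hθ1 hθe using hθ
  have hρ' : (ρ : ℂ) ≠ 0 := by exact_mod_cast hρ.ne'
  have hinjθ : Function.Injective θ := by
    intro i j hij
    by_contra hne
    have : γ i (s i) = γ j (s j) := by
      have := (hθe i).trans ((congrArg (fun x : ℝ => (ρ : ℂ) * Complex.exp (x * Complex.I))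
        hij).trans (hθe j).symm)
      exact sub_left_injective this
    exact hsa i ((hg i j hne).2 _ (hs i) _ (hs j) this).1
  have hsX : ∀ i, γ i (s i) ≠ X := fun i h => hsa i (hinj i _ (hs i) h)
  have hdiv : ∀ i j, (γ j (s j) - X) / (γ i (s i) - X) =
      Complex.exp (θ j * Complex.I) / Complex.exp (θ i * Complex.I) := fun i j => by
    rw [hθe, hθe, mul_div_mul_left _ _ hρ']
  have hdisc : ∀ i j, i ≠ j → lc (γ j) (a j) (s j) (γ i (s i)) =
      Complex.log (1 - Complex.exp (θ j * Complex.I) / Complex.exp (θ i * Complex.I)) := by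
    intro i j hij
    rw [lc_disc (hγ j) (hsX i) (hX j), hdiv]
    · intro t ht; rw [hsρ i]; exact hsle j t ht
    · intro t ht h
      exact hsa i ((hg i j hij).2 _ (hs i) t (uIcc_subset_uIcc left_mem_uIcc (hs j) ht) h.symm).1
  have hloc : ∀ i j, i ≠ j → lam (γ i) (a i) (s i) (γ j) (a j) (s j) =
      θ j * Complex.I - θ i * Complex.I + Real.pi * Complex.I * sg (θ i) (θ j) := by
    intro i j hij
    rw [lam, hdisc i j hij, hdisc j i hij.symm]
    rcases lt_or_gt_of_ne (hinjθ.ne hij) with h | h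
    · rw [log_sub_log_circle (by linarith) (by linarith [hθ0 i, hθ1 j])]
      simp only [sg, h.not_gt, if_false]
      ring
    · rw [← neg_sub, log_sub_log_circle (by linarith) (by linarith [hθ0 j, hθ1 i])]
      simp only [sg, h, if_true]
      ring
  refine ⟨fun i => θ i * Complex.I + Real.log ρ + lc (γ i) (s i) (b i) X, θ, hinjθ, ?_, ?_⟩
  · intro i
    beta_reduce
    have hne : ∀ t ∈ uIcc (s i) (b i), γ i t ≠ X := by
      intro t ht h
      have h2 := hinj i t (uIcc_subset_uIcc (hs i) right_mem_uIcc ht) h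
      have h3 := hs i
      have h4 := hsa i
      rw [mem_uIcc] at ht h3
      grind
    obtain ⟨g, hg', he⟩ := exists_lc (hγ i) hne
    rw [lc_eq hg'.continuousOn he, Complex.exp_add, Complex.exp_add, Complex.exp_sub,
      he _ right_mem_uIcc, he _ left_mem_uIcc, ← Complex.ofReal_exp, Real.exp_log hρ, mul_comm
      (Complex.exp _), ← hθe]
    field_simp [sub_ne_zero.2 (hsX i)]
  · intro i j hij
    rw [lam_trunc (hγ i) (hγ j) (hg i j hij) (hs i) (hsa i) (hs j) (hsa j), hloc i j hij, hX i]
    ring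

/-- A family of simple arcs (parametrized by `[0,1]`) meeting only at their common start `X`. -/
structure ArcStar {ι : Type*} (γ : ι → ℝ → ℂ) (X : ℂ) : Prop where
  cont : ∀ i, Continuous (γ i)
  start : ∀ i, γ i 0 = X
  inj : ∀ i, InjOn (γ i) (Icc 0 1)
  germs : ∀ i j, i ≠ j → Germs (γ i) 0 1 (γ j) 0 1

/-- The cyclic sum of `lam` over three arcs of a star. -/
def cyc {ι : Type*} (γ : ι → ℝ → ℂ) (i j k : ι) : ℂ :=
  lam (γ i) 0 1 (γ j) 0 1 + lam (γ j) 0 1 (γ k) 0 1 + lam (γ k) 0 1 (γ i) 0 1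

theorem ArcStar.local_structure {ι : Type*} [Finite ι] {γ : ι → ℝ → ℂ} {X : ℂ} (h : ArcStar γ X)
    {ε : ι → ℝ} (hε : ∀ i, 0 < ε i) (hε1 : ∀ i, ε i ≤ 1) :
    ∃ (l : ι → ℂ) (θ : ι → ℝ), Function.Injective θ ∧
      (∀ i, Complex.exp (l i) = γ i (ε i) - X) ∧
      ∀ i j, i ≠ j → lam (γ i) 0 (ε i) (γ j) 0 (ε j) =
        l j - l i + Real.pi * Complex.I * sg (θ i) (θ j) := by
  have hmem : ∀ i, ε i ∈ uIcc (0 : ℝ) 1 := fun i => by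
    rw [uIcc_of_le zero_le_one]; exact ⟨(hε i).le, hε1 i⟩
  refine _root_.local_structure (a := fun _ => 0) h.cont h.start (fun i t ht e => ?_)
    (fun i => (hε i).ne) (fun i j hij => (h.germs i j hij).mono (hmem i) (hmem j))
  rw [uIcc_of_le (hε i).le] at ht
  exact h.inj i ⟨ht.1, ht.2.trans (hε1 i)⟩ ⟨le_rfl, zero_le_one⟩ (e.trans (h.start i).symm)

theorem ArcStar.cyc_eq {ι : Type*} {γ : ι → ℝ → ℂ} {X : ℂ} (h : ArcStar γ X)
    {ε : ι → ℝ} (hε : ∀ i, 0 < ε i) (hε1 : ∀ i, ε i ≤ 1) {i j k : ι} (hij : i ≠ j) (hjk : j ≠ k)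
    (hki : k ≠ i) :
    cyc γ i j k = lam (γ i) 0 (ε i) (γ j) 0 (ε j) + lam (γ j) 0 (ε j) (γ k) 0 (ε k) +
      lam (γ k) 0 (ε k) (γ i) 0 (ε i) := by
  have hmem : ∀ i, ε i ∈ uIcc (0 : ℝ) 1 := fun i => by
    rw [uIcc_of_le zero_le_one]; exact ⟨(hε i).le, hε1 i⟩
  have ht : ∀ i j, i ≠ j → _ := fun i j hij => lam_trunc (h.cont i) (h.cont j) (h.germs i j hij)
    (hmem i) (hε i).ne' (hmem j) (hε j).ne'
  simp only [h.start] at ht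
  rw [cyc, ht i j hij, ht j k hjk, ht k i hki]
  ring

/-- A continuous reparametrization of an initial piece of an arc contained in a simple arc. -/
theorem exists_reparam {δ η : ℝ → ℂ} (hδ : Continuous δ) (hinj : InjOn δ (Icc 0 1)) {ε : ℝ}
    (hε : 0 < ε) (hη : ContinuousOn η (Icc 0 ε)) (hηinj : InjOn η (Icc 0 ε)) (h0 : η 0 = δ 0)
    (hsub : ∀ t ∈ Icc 0 ε, η t ∈ δ '' Icc 0 1) :
    ∃ φ : ℝ → ℝ, ContinuousOn φ (Icc 0 ε) ∧ φ 0 = 0 ∧ 0 < φ ε ∧ φ ε ≤ 1 ∧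
      MapsTo φ (Icc 0 ε) (Icc 0 (φ ε)) ∧ ∀ t ∈ Icc 0 ε, η t = δ (φ t) := by
  choose! φ hφ using hsub
  have hemb : Topology.IsEmbedding ((Icc (0 : ℝ) 1).domRestrict δ) :=
    ((hδ.comp continuous_subtype_val).isClosedEmbedding
      (injOn_iff_injective.1 hinj)).isEmbedding
  have hcont : ContinuousOn φ (Icc 0 ε) := by
    rw [continuousOn_iff_continuous_domRestrict]
    have : Continuous fun t : Icc 0 ε => (⟨φ t, (hφ t t.2).1⟩ : Icc (0 : ℝ) 1) := by
      rw [hemb.continuous_iff]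
      have := continuousOn_iff_continuous_domRestrict.1 hη
      refine this.congr fun t => ?_
      exact (hφ t t.2).2.symm
    exact continuous_subtype_val.comp this
  have z : (0 : ℝ) ∈ Icc 0 ε := ⟨le_rfl, hε.le⟩
  have e : ε ∈ Icc 0 ε := ⟨hε.le, le_rfl⟩
  have hφ0 : φ 0 = 0 := hinj (hφ 0 z).1 ⟨le_rfl, zero_le_one⟩ ((hφ 0 z).2.trans h0)
  have hφinj : InjOn φ (Icc 0 ε) := fun s hs t ht h => hηinj hs ht <| by
    rw [← (hφ s hs).2, ← (hφ t ht).2, h]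
  have hmono := hcont.strictMonoOn_of_injOn_Icc hε.le (by rw [hφ0]; exact (hφ ε e).1.1) hφinj
  refine ⟨φ, hcont, hφ0, hφ0 ▸ hmono z e hε, (hφ ε e).1.2, fun t ht => ?_,
    fun t ht => (hφ t ht).2.symm⟩
  exact ⟨(hφ t ht).1.1, hmono.monotoneOn ht e ht.2⟩

/-- Continuous logarithms of the difference quotients of a local embedding. -/
theorem exists_log_difference {H : ℂ → ℂ} {X : ℂ} {r : ℝ} (hr : 0 < r)
    (hH : ContinuousOn H (Metric.ball X r)) (hHinj : InjOn H (Metric.ball X r)) :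
    ∃ (Λ : ℂ × ℂ → ℂ) (D : ℂ),
      ContinuousOn Λ {x | x.1 ∈ Metric.ball X (r / 2) ∧ x.2.re < Real.log (r / 2)} ∧
      (∀ m u, m ∈ Metric.ball X (r / 2) → u.re < Real.log (r / 2) →
        Complex.exp (Λ (m, u)) = H (m + Complex.exp u) - H (m - Complex.exp u)) ∧
      ∀ m u (k : ℤ), m ∈ Metric.ball X (r / 2) → u.re < Real.log (r / 2) →
        Λ (m, u + k * (Real.pi * Complex.I)) = Λ (m, u) + k * D := by
  set U : Set (ℂ × ℂ) := {x | x.1 ∈ Metric.ball X (r / 2) ∧ x.2.re < Real.log (r / 2)} with hUdef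
  have hUeq : U = Metric.ball X (r / 2) ×ˢ {u : ℂ | u.re < Real.log (r / 2)} := rfl
  have hUc : Convex ℝ U := by
    rw [hUeq]; exact (convex_ball _ _).prod (convex_halfSpace_re_lt _)
  have hUo : IsOpen U := by
    rw [hUeq]; exact Metric.isOpen_ball.prod (isOpen_lt Complex.continuous_re continuous_const)
  have hball : ∀ x ∈ U, ∀ c : ℂ, ‖c‖ = 1 → x.1 + c * Complex.exp x.2 ∈ Metric.ball X r := by
    intro x hx c hc
    have h1 : ‖c * Complex.exp x.2‖ < r / 2 := by
      rw [norm_mul, hc, one_mul, Complex.norm_exp, ← Real.lt_log_iff_exp_lt (half_pos hr)]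
      exact hx.2
    have h2 := hx.1
    rw [mem_ball_iff_norm] at h2 ⊢
    calc ‖x.1 + c * Complex.exp x.2 - X‖ = ‖(x.1 - X) + c * Complex.exp x.2‖ := by ring_nf
      _ ≤ _ := norm_add_le _ _
      _ < r := by linarith
  have hplus : ∀ x ∈ U, x.1 + Complex.exp x.2 ∈ Metric.ball X r := fun x hx => by
    simpa using hball x hx 1 (by simp)
  have hminus : ∀ x ∈ U, x.1 - Complex.exp x.2 ∈ Metric.ball X r := fun x hx => by
    simpa [sub_eq_add_neg] using hball x hx (-1) (by simp)
  obtain ⟨Λ, hΛ, hexp⟩ := exists_log_of_convex hUc hUo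
    (f := fun x => H (x.1 + Complex.exp x.2) - H (x.1 - Complex.exp x.2))
    ((hH.comp (by fun_prop) hplus).sub (hH.comp (by fun_prop) hminus)) (by
      intro x hx h
      have := hHinj (hplus x hx) (hminus x hx) (sub_eq_zero.1 h)
      have h2 : Complex.exp x.2 = 0 := by linear_combination this / 2
      exact Complex.exp_ne_zero _ h2)
  set x₀ : ℂ × ℂ := (X, ((Real.log (r / 2) - 1 : ℝ) : ℂ))
  have hx₀ : x₀ ∈ U := ⟨by simpa [x₀] using hr, by simp [x₀]⟩
  have hshift : MapsTo (fun x : ℂ × ℂ => (x.1, x.2 + Real.pi * Complex.I)) U U := by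
    intro x hx
    refine ⟨hx.1, ?_⟩
    simpa using hx.2
  set D := Λ (x₀.1, x₀.2 + Real.pi * Complex.I) - Λ x₀ with hD
  have hone : ∀ x ∈ U, Λ (x.1, x.2 + Real.pi * Complex.I) = Λ x + D := by
    intro x hx
    have := sub_eq_sub_of_exp_eqOn hUc.isPreconnected
      (g := fun x => Λ (x.1, x.2 + Real.pi * Complex.I)) (g' := fun x => Λ x + Real.pi * Complex.I)
      (hΛ.comp (by fun_prop) hshift) (by fun_prop) (by
        intro y hy
        rw [Complex.exp_add, Complex.exp_pi_mul_I, hexp y hy, hexp _ (hshift hy)]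
        simp only [Complex.exp_add, Complex.exp_pi_mul_I]
        ring_nf) hx₀ hx
    linear_combination this
  refine ⟨Λ, D, hΛ, fun m u hm hu => hexp (m, u) ⟨hm, hu⟩, fun m u k hm hu => ?_⟩
  induction k using Int.induction_on with
  | zero => simp
  | succ n ih =>
    have := hone (m, u + ((n : ℤ) : ℂ) * (Real.pi * Complex.I)) ⟨hm, by simpa using hu⟩
    simp only at this
    rw [ih] at this
    push_cast at this ⊢
    rw [add_mul, one_mul, ← add_assoc, this]
    ring
  | pred n ih =>
    have := hone (m, u + (-n - 1 : ℤ) * (Real.pi * Complex.I)) ⟨hm, by simpa using hu⟩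
    simp only at this
    have e : u + ((-n - 1 : ℤ) : ℂ) * (Real.pi * Complex.I) + Real.pi * Complex.I =
      u + ((-n : ℤ) : ℂ) * (Real.pi * Complex.I) := by push_cast; ring
    rw [e, ih] at this
    push_cast at this ⊢
    linear_combination -this

/-- Log changes along the image of an arc under a local embedding. -/
theorem lc_image {H : ℂ → ℂ} {X : ℂ} {r : ℝ} {Λ : ℂ × ℂ → ℂ}
    (hΛ : ContinuousOn Λ {x | x.1 ∈ Metric.ball X (r / 2) ∧ x.2.re < Real.log (r / 2)})
    (hexp : ∀ m u, m ∈ Metric.ball X (r / 2) → u.re < Real.log (r / 2) →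
        Complex.exp (Λ (m, u)) = H (m + Complex.exp u) - H (m - Complex.exp u))
    {γ g : ℝ → ℂ} (hγ : Continuous γ) (hg : Continuous g) {ε : ℝ} {p : ℂ}
    (hp : p ∈ Metric.ball X (r / 2))
    (hball : ∀ t ∈ uIcc 0 ε, γ t ∈ Metric.ball X (r / 2))
    (hge : ∀ t ∈ uIcc 0 ε, Complex.exp (g t) = γ t - p) :
    lc (fun t => H (γ t)) 0 ε (H p) = Λ ((γ ε + p) / 2, g ε - Complex.log 2) -
      Λ ((γ 0 + p) / 2, g 0 - Complex.log 2) ∧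
    (∀ t ∈ uIcc 0 ε, (γ t + p) / 2 ∈ Metric.ball X (r / 2) ∧
      (g t - Complex.log 2).re < Real.log (r / 2)) := by
  have hmem : ∀ t ∈ uIcc 0 ε, (γ t + p) / 2 ∈ Metric.ball X (r / 2) ∧
      (g t - Complex.log 2).re < Real.log (r / 2) := by
    intro t ht
    have h1 := hball t ht
    rw [mem_ball_iff_norm] at hp h1
    have hr : 0 < r / 2 := (norm_nonneg _).trans_lt hp
    constructor
    · rw [mem_ball_iff_norm]
      calc ‖(γ t + p) / 2 - X‖ = ‖(γ t - X) / 2 + (p - X) / 2‖ := by ring_nf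
        _ ≤ ‖(γ t - X) / 2‖ + ‖(p - X) / 2‖ := norm_add_le _ _
        _ < r / 2 := by simp only [norm_div, Complex.norm_ofNat]; linarith
    · rw [Real.lt_log_iff_exp_lt hr, ← Complex.norm_exp, Complex.exp_sub,
        Complex.exp_log two_ne_zero, hge t ht, norm_div, Complex.norm_ofNat]
      have : ‖γ t - p‖ ≤ ‖γ t - X‖ + ‖p - X‖ := by
        rw [norm_sub_rev p X]; exact norm_sub_le_norm_sub_add_norm_sub _ _ _
      linarith
  refine ⟨?_, hmem⟩
  rw [lc_eq (g := fun t => Λ ((γ t + p) / 2, g t - Complex.log 2))]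
  · exact hΛ.comp (by fun_prop) hmem
  · intro t ht
    rw [hexp _ _ (hmem t ht).1 (hmem t ht).2, Complex.exp_sub, Complex.exp_log two_ne_zero,
      hge t ht]
    congr 2 <;> ring

theorem ArcStar.rotation_invariance {ι : Type*} [Finite ι] {γ δ : ι → ℝ → ℂ} {X Y : ℂ}
    (hγ : ArcStar γ X) (hδ : ArcStar δ Y) {H : ℂ → ℂ} {r : ℝ} (hr : 0 < r)
    (hH : ContinuousOn H (Metric.ball X r)) (hHinj : InjOn H (Metric.ball X r)) (hXY : H X = Y)
    (hsub : ∀ i, ∀ t ∈ Icc (0 : ℝ) 1, γ i t ∈ Metric.ball X r → H (γ i t) ∈ δ i '' Icc 0 1) :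
    ∃ τ : ℂ, ∀ i j k, i ≠ j → j ≠ k → k ≠ i → cyc δ i j k = τ * cyc γ i j k := by
  obtain ⟨Λ, D, hΛ, hexp, hshift⟩ := exists_log_difference hr hH hHinj
  have hex : ∀ i, ∃ ε : ℝ, 0 < ε ∧ ε ≤ 1 ∧ ∀ t ∈ Icc 0 ε, γ i t ∈ Metric.ball X (r / 2) := by
    intro i
    have : ∀ᶠ t in nhds (0 : ℝ), γ i t ∈ Metric.ball X (r / 2) :=
      (hγ.cont i).continuousAt.eventually (by
        rw [hγ.start]; exact Metric.isOpen_ball.mem_nhds (Metric.mem_ball_self (half_pos hr)))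
    obtain ⟨e, he, h⟩ := Metric.eventually_nhds_iff.1 this
    refine ⟨min 1 (e / 2), by positivity, min_le_left _ _, fun t ht => h ?_⟩
    rw [Real.dist_eq, sub_zero, abs_of_nonneg ht.1]
    have := ht.2.trans (min_le_right _ _)
    linarith
  choose ε hε hε1 hεb using hex
  have hsubball : Metric.ball X (r / 2) ⊆ Metric.ball X r := Metric.ball_subset_ball (by linarith)
  have hI : ∀ i, Icc 0 (ε i) ⊆ Icc (0 : ℝ) 1 := fun i => Icc_subset_Icc_right (hε1 i)
  have hrep := fun i => exists_reparam (hδ.cont i) (hδ.inj i) (hε i) (η := fun t => H (γ i t))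
    (hH.comp (hγ.cont i).continuousOn fun t ht => hsubball (hεb i t ht))
    (hHinj.comp ((hγ.inj i).mono (hI i)) fun t ht => hsubball (hεb i t ht))
    (by rw [hγ.start, hδ.start, hXY])
    (fun t ht => hsub i t (hI i ht) (hsubball (hεb i t ht)))
  choose φ hφc hφ0 hφp hφ1 hφm hφe using hrep
  obtain ⟨l, θ, -, hl, hlam⟩ := hγ.local_structure hε hε1
  have hu : ∀ i, uIcc 0 (ε i) = Icc 0 (ε i) := fun i => uIcc_of_le (hε i).le
  have hp : ∀ i, γ i (ε i) ∈ Metric.ball X (r / 2) := fun i => hεb i _ ⟨(hε i).le, le_rfl⟩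
  have hne : ∀ i j, i ≠ j → ∀ t ∈ uIcc 0 (ε j), γ j t ≠ γ i (ε i) := by
    intro i j hij t ht h
    have := (hγ.germs j i hij.symm).2 t (by
      rw [uIcc_of_le zero_le_one]; rw [hu] at ht; exact hI j ht) (ε i) (by
      rw [uIcc_of_le zero_le_one]; exact ⟨(hε i).le, hε1 i⟩) h
    exact (hε i).ne' this.2
  have hlog : ∀ i j, ∃ g : ℝ → ℂ, i ≠ j → Continuous g ∧ ∀ t ∈ uIcc 0 (ε j),
      Complex.exp (g t) = γ j t - γ i (ε i) := by
    intro i j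
    by_cases hij : i = j
    · exact ⟨0, fun h => (h hij).elim⟩
    · obtain ⟨g, hg⟩ := exists_lc (hγ.cont j) (hne i j hij)
      exact ⟨g, fun _ => hg⟩
  choose g hg using hlog
  have hδlam : ∀ i j, i ≠ j → lam (δ i) 0 (φ i (ε i)) (δ j) 0 (φ j (ε j)) =
      Λ ((X + γ j (ε j)) / 2, l j - Complex.log 2) - Λ ((X + γ i (ε i)) / 2, l i - Complex.log 2)
      + D * sg (θ i) (θ j) := by
    have hpush : ∀ i j, i ≠ j → lc (δ j) 0 (φ j (ε j)) (δ i (φ i (ε i))) =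
        lc (fun t => H (γ j t)) 0 (ε j) (H (γ i (ε i))) := by
      intro i j hij
      rw [← hφe i _ ⟨(hε i).le, le_rfl⟩]
      refine (lc_comp (hδ.cont j) (φ := φ j) (by rw [hu]; exact hφc j) ?_ (hφ0 j) rfl ?_ ?_).symm
      · rw [hu, uIcc_of_le (hφp j).le]; exact hφm j
      · rw [hu]; exact hφe j
      · intro t ht h
        rw [hφe i _ ⟨(hε i).le, le_rfl⟩] at h
        rw [uIcc_of_le (hφp j).le] at ht
        have := (hδ.germs j i hij.symm).2 t (by
          rw [uIcc_of_le zero_le_one]; exact ⟨ht.1, ht.2.trans (hφ1 j)⟩) _ (by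
          rw [uIcc_of_le zero_le_one]; exact ⟨(hφp i).le, hφ1 i⟩) h
        exact (hφp i).ne' this.2
    have exp_shift : ∀ u v : ℂ, Complex.exp u = -Complex.exp v →
        ∃ k : ℤ, u = v + k * (Real.pi * Complex.I) := by
      intro u v h
      have : Complex.exp u = Complex.exp (v + Real.pi * Complex.I) := by
        rw [h, Complex.exp_add, Complex.exp_pi_mul_I]; ring
      obtain ⟨k, hk⟩ := Complex.exp_eq_exp_iff_exists_int.1 this
      exact ⟨2 * k + 1, by rw [hk]; push_cast; ring⟩
    intro i j hij
    obtain ⟨g1, he1⟩ := hg i j hij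
    obtain ⟨g2, he2⟩ := hg j i hij.symm
    obtain ⟨e1, m1⟩ := lc_image hΛ hexp (hγ.cont j) g1 (hp i)
      (fun t ht => hεb j t (by rwa [hu] at ht)) he1
    obtain ⟨e2, m2⟩ := lc_image hΛ hexp (hγ.cont i) g2 (hp j)
      (fun t ht => hεb i t (by rwa [hu] at ht)) he2
    obtain ⟨a, ha⟩ := exp_shift (g i j 0) (l i) (by
      rw [he1 0 left_mem_uIcc, hl, hγ.start]; ring)
    obtain ⟨b, hb⟩ := exp_shift (g j i 0) (l j) (by
      rw [he2 0 left_mem_uIcc, hl, hγ.start]; ring)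
    obtain ⟨c, hc⟩ := exp_shift (g j i (ε i)) (g i j (ε j)) (by
      rw [he1 _ right_mem_uIcc, he2 _ right_mem_uIcc]; ring)
    have hn := hlam i j hij
    rw [lam, lc_eq g1.continuousOn he1, lc_eq g2.continuousOn he2, hc, ha, hb] at hn
    have hpi : (Real.pi * Complex.I : ℂ) ≠ 0 := by simp [Real.pi_ne_zero]
    have hn' : sg (θ i) (θ j) = b - a - c := by
      apply mul_left_cancel₀ hpi
      linear_combination -hn
    rw [lam, hpush i j hij, hpush j i hij.symm, e1, e2, hn', hc, ha, hb, hγ.start, hγ.start,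
      add_comm (γ i (ε i)) (γ j (ε j))]
    have m10 := m1 0 left_mem_uIcc
    have m20 := m2 0 left_mem_uIcc
    have m1e := m1 _ right_mem_uIcc
    rw [hγ.start] at m10 m20
    have s1 := hshift ((γ j (ε j) + γ i (ε i)) / 2) (g i j (ε j) - Complex.log 2) c m1e.1 m1e.2
    have s2 := hshift ((X + γ i (ε i)) / 2) (l i - Complex.log 2) a m10.1 (by
      have := m10.2; rw [ha] at this; simpa using this)
    have s3 := hshift ((X + γ j (ε j)) / 2) (l j - Complex.log 2) b m20.1 (by
      have := m20.2; rw [hb] at this; simpa using this)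
    rw [← add_sub_right_comm] at s1 s2 s3
    rw [s1, s2, s3]
    ring
  have hpi : (Real.pi * Complex.I : ℂ) ≠ 0 := by simp [Real.pi_ne_zero]
  refine ⟨D / (Real.pi * Complex.I), fun i j k hij hjk hki => ?_⟩
  rw [hγ.cyc_eq hε hε1 hij hjk hki, hδ.cyc_eq hφp hφ1 hij hjk hki, hδlam i j hij, hδlam j k hjk,
    hδlam k i hki, hlam i j hij, hlam j k hjk, hlam k i hki]
  field_simp
  ring

/-- A closed curve made of three arcs, simple except for the common corners. -/
structure ClosedTriangle (γ : Fin 3 → ℝ → ℂ) : Prop where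
  cont : ∀ k, Continuous (γ k)
  corner : ∀ k, γ k 1 = γ (k + 1) 0
  simple : ∀ j k, ∀ s ∈ Icc (0 : ℝ) 1, ∀ t ∈ Icc (0 : ℝ) 1, γ j s = γ k t →
    (j = k ∧ s = t) ∨ (k = j + 1 ∧ s = 1 ∧ t = 0) ∨ (j = k + 1 ∧ s = 0 ∧ t = 1)

/-- If a closed triangle has the same winding around `w` and `x`, then `(z - w) / (z - x)` has a
continuous logarithm on it. -/
theorem ClosedTriangle.exists_log {γ : Fin 3 → ℝ → ℂ} (h : ClosedTriangle γ) {w x : ℂ}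
    (hw : ∀ k, ∀ t ∈ Icc (0 : ℝ) 1, γ k t ≠ w) (hx : ∀ k, ∀ t ∈ Icc (0 : ℝ) 1, γ k t ≠ x)
    (hsum : ∑ k, lc (γ k) 0 1 w = ∑ k, lc (γ k) 0 1 x) :
    ∃ φ : ℂ → ℂ, Continuous φ ∧ ∀ z ∈ ⋃ k, γ k '' Icc 0 1,
      Complex.exp (φ z) = (z - w) / (z - x) := by
  have hu : uIcc (0 : ℝ) 1 = Icc 0 1 := uIcc_of_le zero_le_one
  have h0 : (0 : ℝ) ∈ Icc (0 : ℝ) 1 := ⟨le_rfl, zero_le_one⟩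
  have h1 : (1 : ℝ) ∈ Icc (0 : ℝ) 1 := ⟨zero_le_one, le_rfl⟩
  have hlog : ∀ k, ∃ g : ℝ → ℂ, Continuous g ∧
      (∀ t ∈ Icc (0 : ℝ) 1, Complex.exp (g t) = (γ k t - w) / (γ k t - x)) ∧
      g 1 - g 0 = lc (γ k) 0 1 w - lc (γ k) 0 1 x := by
    intro k
    obtain ⟨g1, hg1, he1⟩ := exists_lc (h.cont k) (z := w) (by rw [hu]; exact hw k)
    obtain ⟨g2, hg2, he2⟩ := exists_lc (h.cont k) (z := x) (by rw [hu]; exact hx k)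
    refine ⟨g1 - g2, hg1.sub hg2, fun t ht => ?_, ?_⟩
    · rw [← hu] at ht
      rw [Pi.sub_apply, Complex.exp_sub, he1 t ht, he2 t ht]
    · rw [lc_eq hg1.continuousOn he1, lc_eq hg2.continuousOn he2]
      simp only [Pi.sub_apply]; ring
  choose g hg hge hgd using hlog
  let base : Fin 3 → ℂ := ![0, g 0 1 - g 1 0, (g 0 1 - g 1 0) + (g 1 1 - g 2 0)]
  have hexpc : ∀ k, Complex.exp (g k 1 - g (k + 1) 0) = 1 := by
    intro k
    rw [Complex.exp_sub, hge k 1 h1, hge _ 0 h0, h.corner]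
    apply div_self
    exact div_ne_zero (sub_ne_zero.2 (hw _ _ h0)) (sub_ne_zero.2 (hx _ _ h0))
  have hc0 := hexpc 0
  have hc1 := hexpc 1
  have hbase : ∀ k, Complex.exp (base k) = 1 := by
    intro k
    fin_cases k
    · simp [base]
    · exact hc0
    · change Complex.exp ((g 0 1 - g 1 0) + (g 1 1 - g 2 0)) = 1
      rw [Complex.exp_add]
      erw [hc0, hc1]
      simp
  have htot : g 0 1 - g 0 0 + (g 1 1 - g 1 0) + (g 2 1 - g 2 0) = 0 := by
    rw [hgd, hgd, hgd]
    simp only [Fin.sum_univ_three] at hsum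
    linear_combination hsum
  have hmatch : ∀ k, g k 1 + base k = g (k + 1) 0 + base (k + 1) := by
    intro k
    fin_cases k
    · change g 0 1 + 0 = g 1 0 + (g 0 1 - g 1 0); ring
    · change g 1 1 + (g 0 1 - g 1 0) = g 2 0 + ((g 0 1 - g 1 0) + (g 1 1 - g 2 0)); ring
    · change g 2 1 + ((g 0 1 - g 1 0) + (g 1 1 - g 2 0)) = g 0 0 + 0
      linear_combination htot
  set C : Set ℂ := ⋃ k, γ k '' Icc 0 1 with hC
  let π : Fin 3 × Icc (0 : ℝ) 1 → C := fun p => ⟨γ p.1 p.2, mem_iUnion.2 ⟨p.1, _, p.2.2, rfl⟩⟩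
  let G : Fin 3 × Icc (0 : ℝ) 1 → ℂ := fun p => g p.1 p.2 + base p.1
  have hcontF : ∀ f : Fin 3 → ℝ → ℂ, (∀ k, Continuous (f k)) →
      Continuous fun p : Fin 3 × Icc (0 : ℝ) 1 => f p.1 p.2 := fun f hf =>
    continuous_prod_of_discrete_left.2 fun k => (hf k).comp continuous_subtype_val
  have hπ : Continuous π := (hcontF γ h.cont).subtype_mk _
  have hG : Continuous G := hcontF (fun k t => g k t + base k) fun k => (hg k).add continuous_const
  have hπs : Function.Surjective π := by
    rintro ⟨z, hz⟩
    obtain ⟨k, t, ht, rfl⟩ := mem_iUnion.1 hz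
    exact ⟨(k, ⟨t, ht⟩), rfl⟩
  have hq : Topology.IsQuotientMap π := hπ.isClosedMap.isQuotientMap hπ hπs
  have hcompat : ∀ p q, π p = π q → G p = G q := by
    rintro ⟨j, s, hs⟩ ⟨k, t, ht⟩ he
    rcases h.simple j k s hs t ht (congrArg Subtype.val he) with ⟨rfl, rfl⟩ | ⟨rfl, rfl, rfl⟩ |
      ⟨rfl, rfl, rfl⟩
    · rfl
    · exact hmatch j
    · exact (hmatch k).symm
  obtain ⟨ψ, hψ⟩ : ∃ ψ : C → ℂ, ∀ p, ψ (π p) = G p := by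
    refine ⟨fun z => G (hπs z).choose, fun p => hcompat _ _ (hπs (π p)).choose_spec⟩
  have hψc : Continuous ψ := by
    rw [hq.continuous_iff]
    exact hG.congr fun p => (hψ p).symm
  have hCc : IsClosed C := by
    refine IsCompact.isClosed (isCompact_iUnion fun k => isCompact_Icc.image (h.cont k))
  obtain ⟨φ, hφ⟩ := ContinuousMap.exists_restrict_eq hCc ⟨ψ, hψc⟩
  refine ⟨φ, φ.continuous, fun z hz => ?_⟩
  obtain ⟨⟨k, t⟩, hp⟩ := hπs ⟨z, hz⟩
  have h2 : φ z = G (k, t) := by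
    rw [← hψ, hp]
    exact congrArg (fun f : C(C, ℂ) => f ⟨z, hz⟩) hφ
  have h3 : γ k t = z := congrArg Subtype.val hp
  rw [h2, Complex.exp_add, hbase, mul_one, hge k t t.2, h3]

/-- A nonvanishing continuous function on the plane does not agree with `z - w` near infinity. -/
theorem not_eq_sub_at_infinity {F : ℂ → ℂ} (hF : Continuous F) (h0 : ∀ z, F z ≠ 0) {w : ℂ} {R : ℝ}
    (hR : ∀ z, R ≤ ‖z‖ → F z = z - w) : False := by
  obtain ⟨l, hl, he⟩ := exists_log_of_convex (convex_univ (E := ℂ)) isOpen_univ hF.continuousOn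
    (fun z _ => h0 z)
  set r : ℝ := max R (‖w‖ + 1)
  have hr : 0 < r := (by positivity : 0 < ‖w‖ + 1).trans_le (le_max_right _ _)
  have hr' : (r : ℂ) ≠ 0 := by exact_mod_cast hr.ne'
  have hnorm : ∀ t : ℝ, ‖(r : ℂ) * Complex.exp (t * Complex.I)‖ = r := fun t => by
    rw [norm_mul, Complex.norm_exp_ofReal_mul_I, mul_one, Complex.norm_of_nonneg hr.le]
  have hFc : ∀ t : ℝ, F (r * Complex.exp (t * Complex.I)) = r * Complex.exp (t * Complex.I) - w :=
    fun t => hR _ (by rw [hnorm]; exact le_max_left _ _)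
  have e1 : lc (fun t => r * Complex.exp (t * Complex.I)) 0 (2 * Real.pi) w = 0 := by
    rw [lc_eq (g := fun t => l (r * Complex.exp (t * Complex.I)))]
    · simp
    · have := continuousOn_univ.1 hl
      fun_prop
    · intro t _
      rw [he _ trivial, hFc]
  have hslit : ∀ t : ℝ, 1 - w / (r * Complex.exp (t * Complex.I)) ∈ Complex.slitPlane := by
    intro t
    left
    have : ‖w / (r * Complex.exp (t * Complex.I))‖ < 1 := by
      rw [norm_div, hnorm, div_lt_one hr]
      exact (lt_add_one _).trans_le (le_max_right _ _)
    have h2 := Complex.re_le_norm (w / (r * Complex.exp (t * Complex.I)))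
    rw [Complex.sub_re, Complex.one_re]
    linarith
  have hne : ∀ t : ℝ, (r : ℂ) * Complex.exp (t * Complex.I) ≠ 0 := fun t =>
    mul_ne_zero hr' (Complex.exp_ne_zero _)
  have e2 : lc (fun t => r * Complex.exp (t * Complex.I)) 0 (2 * Real.pi) w =
      2 * Real.pi * Complex.I := by
    rw [lc_eq (g := fun t => Complex.log (1 - w / (r * Complex.exp (t * Complex.I))) +
      (Real.log r + t * Complex.I))]
    · simp
    · apply ContinuousOn.add
      · apply ContinuousOn.clog
        · apply ContinuousOn.sub continuousOn_const
          exact continuousOn_const.div (by fun_prop) fun t _ => hne t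
        · exact fun t _ => hslit t
      · fun_prop
    · intro t _
      rw [Complex.exp_add, Complex.exp_log (Complex.slitPlane_ne_zero (hslit t)), Complex.exp_add,
        ← Complex.ofReal_exp, Real.exp_log hr]
      field_simp [hne t]
  rw [e1] at e2
  simp [Real.pi_ne_zero] at e2

theorem ClosedTriangle.winding_ne_of_bounded {γ : Fin 3 → ℝ → ℂ} (h : ClosedTriangle γ) {w x : ℂ}
    (hw : ∀ k, ∀ t ∈ Icc (0 : ℝ) 1, γ k t ≠ w) (hx : ∀ k, ∀ t ∈ Icc (0 : ℝ) 1, γ k t ≠ x)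
    {U : Set ℂ} (hU : frontier U ⊆ ⋃ k, γ k '' Icc 0 1) (hb : Bornology.IsBounded U)
    (hwU : w ∈ U) (hxU : x ∉ closure U) :
    ∑ k, lc (γ k) 0 1 w ≠ ∑ k, lc (γ k) 0 1 x := by
  intro hsum
  obtain ⟨φ, hφ, he⟩ := h.exists_log hw hx hsum
  classical
  obtain ⟨R, hR⟩ := hb.closure.subset_ball 0
  refine not_eq_sub_at_infinity (F := fun z => if z ∈ closure U then Complex.exp (φ z) * (z - x)
    else z - w) (w := w) (R := R) ?_ ?_ ?_
  · refine Continuous.if ?_ (by fun_prop) (by fun_prop)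
    intro z hz
    have hzC := hU (frontier_closure_subset hz)
    rw [he z hzC, div_mul_cancel₀]
    obtain ⟨k, t, ht, rfl⟩ := mem_iUnion.1 hzC
    exact sub_ne_zero.2 (hx k t ht)
  · intro z
    split_ifs with hz
    · exact mul_ne_zero (Complex.exp_ne_zero _) (sub_ne_zero.2 (by rintro rfl; exact hxU hz))
    · exact sub_ne_zero.2 (by rintro rfl; exact hz (subset_closure hwU))
  · intro z hz
    rw [if_neg]
    intro hzU
    have := hR hzU
    rw [mem_ball_zero_iff] at this
    linarith

theorem ClosedTriangle.winding_ne {γ : Fin 3 → ℝ → ℂ} (h : ClosedTriangle γ) {w x : ℂ}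
    (hw : ∀ k, ∀ t ∈ Icc (0 : ℝ) 1, γ k t ≠ w) (hx : ∀ k, ∀ t ∈ Icc (0 : ℝ) 1, γ k t ≠ x)
    {U : Set ℂ} (hUo : IsOpen U) (hU : frontier U ⊆ ⋃ k, γ k '' Icc 0 1)
    (hb : Bornology.IsBounded U ∨ Bornology.IsBounded Uᶜ) (hwU : w ∈ U) (hxU : x ∉ closure U) :
    ∑ k, lc (γ k) 0 1 w ≠ ∑ k, lc (γ k) 0 1 x := by
  rcases hb with hb | hb
  · exact h.winding_ne_of_bounded hw hx hU hb hwU hxU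
  · refine (h.winding_ne_of_bounded hx hw (U := (closure U)ᶜ) ?_ (hb.subset ?_) hxU ?_).symm
    · rw [frontier_compl]
      exact frontier_closure_subset.trans hU
    · exact compl_subset_compl.2 subset_closure
    · intro hc
      obtain ⟨z, hz, hz'⟩ := mem_closure_iff.1 hc U hUo hwU
      exact hz' (subset_closure hz)

/-- A drawing of `K_n` in the plane by simple arcs in which adjacent edges meet only at the common
end, independent edges meet at most once, and no three independent edges are concurrent. -/
structure PlanarDrawing (n : ℕ) where
  v : Fin n → ℂ
  E : Fin n → Fin n → ℝ → ℂ
  cont : ∀ i j, Continuous (E i j)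
  zero : ∀ {i j}, i ≠ j → E i j 0 = v i
  rev : ∀ {i j}, i ≠ j → ∀ t, E j i t = E i j (1 - t)
  inj : ∀ {i j}, i ≠ j → InjOn (E i j) (Icc 0 1)
  vert : ∀ {i j k}, i ≠ j → ∀ {t}, t ∈ Icc (0 : ℝ) 1 → E i j t = v k →
    (t = 0 ∧ k = i) ∨ (t = 1 ∧ k = j)
  adj : ∀ {i j k}, i ≠ j → i ≠ k → j ≠ k → ∀ {s t}, s ∈ Icc (0 : ℝ) 1 → t ∈ Icc (0 : ℝ) 1 →
    E i j s = E i k t → s = 0 ∧ t = 0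
  indep : ∀ {i j k l}, [i, j, k, l].Nodup → ∀ {s t s' t'}, s ∈ Icc (0 : ℝ) 1 →
    t ∈ Icc (0 : ℝ) 1 → s' ∈ Icc (0 : ℝ) 1 → t' ∈ Icc (0 : ℝ) 1 →
    E i j s = E k l t → E i j s' = E k l t' → s = s' ∧ t = t'
  triple : ∀ {i j k l p q}, [i, j, k, l, p, q].Nodup → ∀ {s t r}, s ∈ Icc (0 : ℝ) 1 →
    t ∈ Icc (0 : ℝ) 1 → r ∈ Icc (0 : ℝ) 1 → E i j s = E k l t → E p q r ≠ E i j s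

/-- Unconditional invariance of `lc` under affine reparametrization. -/
theorem lc_affine (γ : ℝ → ℂ) (p : ℝ) {q : ℝ} (hq : q ≠ 0) (a b : ℝ) (z : ℂ) :
    lc (fun t => γ (p + q * t)) a b z = lc γ (p + q * a) (p + q * b) z := by
  have hmaps : ∀ (p q a b : ℝ), MapsTo (fun t => p + q * t) (uIcc a b)
      (uIcc (p + q * a) (p + q * b)) := by
    intro p q a b t ht
    simp only [mem_uIcc] at ht ⊢
    rcases le_total 0 q with h | h
    · rcases ht with ht | ht
      · left; constructor <;> nlinarith
      · right; constructor <;> nlinarith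
    · rcases ht with ht | ht
      · right; constructor <;> nlinarith
      · left; constructor <;> nlinarith
  by_cases hex : ∃ g : ℝ → ℂ, ContinuousOn g (uIcc (p + q * a) (p + q * b)) ∧
      ∀ t ∈ uIcc (p + q * a) (p + q * b), Complex.exp (g t) = γ t - z
  · obtain ⟨g, hg, he⟩ := hex
    rw [lc_eq hg he, lc_eq (g := fun t => g (p + q * t))]
    · exact hg.comp (by fun_prop) (hmaps p q a b)
    · exact fun t ht => he _ (hmaps p q a b ht)
  · rw [lc, lc, logChange, logChange, dif_neg hex, dif_neg]
    rintro ⟨g, hg, he⟩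
    apply hex
    have hm := hmaps (-p / q) (1 / q) (p + q * a) (p + q * b)
    have e : ∀ x, -p / q + 1 / q * (p + q * x) = x := fun x => by field_simp; ring
    rw [e, e] at hm
    refine ⟨fun t => g (-p / q + 1 / q * t), hg.comp (by fun_prop) hm, fun t ht => ?_⟩
    rw [he _ (hm ht)]
    congr 2
    field_simp
    ring

theorem exp_lc {γ : ℝ → ℂ} (hγ : Continuous γ) {a b : ℝ} {z : ℂ} (h : ∀ t ∈ uIcc a b, γ t ≠ z) :
    Complex.exp (lc γ a b z) = (γ b - z) / (γ a - z) := by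
  obtain ⟨g, hg, he⟩ := exists_lc hγ h
  rw [lc_eq hg.continuousOn he, Complex.exp_sub, he _ right_mem_uIcc, he _ left_mem_uIcc]

namespace PlanarDrawing

variable {n : ℕ} (D : PlanarDrawing n)

theorem one {i j : Fin n} (h : i ≠ j) : D.E i j 1 = D.v j := by
  rw [D.rev h.symm, sub_self, D.zero h.symm]

theorem v_inj : Function.Injective D.v := by
  intro i j h
  by_contra hij
  rcases D.vert hij ⟨le_rfl, zero_le_one⟩ ((D.zero hij).trans h) with h | h
  · exact hij h.2.symm
  · exact zero_ne_one h.1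

theorem ne_vert {i j k : Fin n} (hij : i ≠ j) (hki : k ≠ i) (hkj : k ≠ j) {t : ℝ}
    (ht : t ∈ Icc (0 : ℝ) 1) : D.E i j t ≠ D.v k := fun h =>
  (D.vert hij ht h).elim (fun h => hki h.2) (fun h => hkj h.2)

theorem lc_rev {i j : Fin n} (h : i ≠ j) (a b : ℝ) (z : ℂ) :
    lc (D.E j i) a b z = lc (D.E i j) (1 - a) (1 - b) z := by
  have : D.E j i = fun t => D.E i j (1 + (-1) * t) := by
    funext t; rw [D.rev h]; ring_nf
  rw [this, lc_affine _ _ (by norm_num)]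
  ring_nf

theorem rect_rev_left {i j : Fin n} (h : i ≠ j) (a b : ℝ) (δ : ℝ → ℂ) (c d : ℝ) :
    rect (D.E j i) a b δ c d = rect (D.E i j) (1 - a) (1 - b) δ c d := by
  simp only [rect, D.lc_rev h, D.rev h]

theorem rect_rev_right {i j : Fin n} (h : i ≠ j) (a b : ℝ) (δ : ℝ → ℂ) (c d : ℝ) :
    rect δ c d (D.E j i) a b = rect δ c d (D.E i j) (1 - a) (1 - b) := by
  simp only [rect, D.lc_rev h, D.rev h]

theorem rect_rev_left_one {i j : Fin n} (h : i ≠ j) (δ : ℝ → ℂ) (c d : ℝ) :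
    rect (D.E j i) 0 1 δ c d = -rect (D.E i j) 0 1 δ c d := by
  rw [D.rect_rev_left h, sub_zero, sub_self, rect_symm_left]

theorem rect_rev_right_one {i j : Fin n} (h : i ≠ j) (δ : ℝ → ℂ) (c d : ℝ) :
    rect δ c d (D.E j i) 0 1 = -rect δ c d (D.E i j) 0 1 := by
  rw [D.rect_rev_right h, sub_zero, sub_self, rect_symm_right]

theorem germs {i j k : Fin n} (hij : i ≠ j) (hik : i ≠ k) (hjk : j ≠ k) :
    Germs (D.E i j) 0 1 (D.E i k) 0 1 := by
  refine ⟨by rw [D.zero hij, D.zero hik], fun s hs t ht h => ?_⟩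
  rw [uIcc_of_le zero_le_one] at hs ht
  exact D.adj hij hik hjk hs ht h

theorem arcStar (x : Fin n) : ArcStar (fun u : {u // x ≠ u} => D.E x u) (D.v x) where
  cont u := D.cont x u
  start u := D.zero u.2
  inj u := D.inj u.2
  germs i j hij := D.germs i.2 j.2 fun h => hij (Subtype.ext h)

/-- The cyclic sum of log changes of three edges at the vertex `x`. -/
def rot (x p q y : Fin n) : ℂ :=
  lam (D.E x p) 0 1 (D.E x q) 0 1 + lam (D.E x q) 0 1 (D.E x y) 0 1 +
    lam (D.E x y) 0 1 (D.E x p) 0 1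

theorem rot_eq {x p q y : Fin n} (h : [x, p, q, y].Nodup) :
    ∃ s : ℤ, (s = 1 ∨ s = -1) ∧ D.rot x p q y = Real.pi * Complex.I * s := by
  simp only [List.nodup_cons, List.mem_cons, List.not_mem_nil, or_false, not_or,
    not_false_eq_true, List.nodup_nil, and_true] at h
  obtain ⟨⟨hp, hq, hy⟩, ⟨hpq, hpy⟩, hqy⟩ := h
  obtain ⟨l, θ, hθ, -, hl⟩ := (D.arcStar x).local_structure (ε := fun _ => 1)
    (fun _ => one_pos) (fun _ => le_rfl)
  have e1 := hl ⟨p, hp⟩ ⟨q, hq⟩ (by simpa using hpq)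
  have e2 := hl ⟨q, hq⟩ ⟨y, hy⟩ (by simpa using hqy)
  have e3 := hl ⟨y, hy⟩ ⟨p, hp⟩ (by simpa using Ne.symm hpy)
  have n1 : θ ⟨p, hp⟩ ≠ θ ⟨q, hq⟩ := hθ.ne (by simpa using hpq)
  have n2 : θ ⟨q, hq⟩ ≠ θ ⟨y, hy⟩ := hθ.ne (by simpa using hqy)
  have n3 : θ ⟨y, hy⟩ ≠ θ ⟨p, hp⟩ := hθ.ne (by simpa using Ne.symm hpy)
  simp only at e1 e2 e3
  have e : D.rot x p q y = Real.pi * Complex.I * (sg (θ ⟨p, hp⟩) (θ ⟨q, hq⟩) +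
      sg (θ ⟨q, hq⟩) (θ ⟨y, hy⟩) + sg (θ ⟨y, hy⟩) (θ ⟨p, hp⟩)) := by
    rw [rot, e1, e2, e3]; ring
  rw [e]
  generalize θ ⟨p, hp⟩ = tp at *
  generalize θ ⟨q, hq⟩ = tq at *
  generalize θ ⟨y, hy⟩ = ty at *
  unfold sg
  rcases lt_or_gt_of_ne n1 with h1 | h1 <;> rcases lt_or_gt_of_ne n2 with h2 | h2 <;>
    rcases lt_or_gt_of_ne n3 with h3 | h3 <;>
    first
    | (exfalso; linarith)
    | (refine ⟨1, Or.inl rfl, ?_⟩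
       simp only [h1, h2, h3, h1.not_gt, h2.not_gt, h3.not_gt, if_true, if_false]; norm_num; done)
    | (refine ⟨-1, Or.inr rfl, ?_⟩
       simp only [h1, h2, h3, h1.not_gt, h2.not_gt, h3.not_gt, if_true, if_false]; norm_num)

/-- The intersection number (times `2πi`) of the edges `ij` and `kl`. -/
def int (i j k l : Fin n) : ℂ := rect (D.E i j) 0 1 (D.E k l) 0 1

theorem lc_rev_one {i j : Fin n} (h : i ≠ j) (z : ℂ) :
    lc (D.E j i) 0 1 z = -lc (D.E i j) 0 1 z := by
  rw [D.lc_rev h, sub_zero, sub_self, lc_symm]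

theorem int_eq_int {i j k l : Fin n} (h : [i, j, k, l].Nodup) :
    ∃ m : ℤ, D.int i j k l = 2 * Real.pi * Complex.I * m := by
  simp only [List.nodup_cons, List.mem_cons, List.not_mem_nil, or_false, not_or,
    not_false_eq_true, List.nodup_nil, and_true] at h
  obtain ⟨⟨hij, hik, hil⟩, ⟨hjk, hjl⟩, hkl⟩ := h
  have key : ∀ {i j k : Fin n}, i ≠ j → k ≠ i → k ≠ j → Complex.exp (lc (D.E i j) 0 1 (D.v k)) =
      (D.v j - D.v k) / (D.v i - D.v k) := by
    intro i j k hij hki hkj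
    rw [exp_lc (D.cont i j), D.zero hij, D.one hij]
    intro t ht
    rw [uIcc_of_le zero_le_one] at ht
    exact D.ne_vert hij hki hkj ht
  have h1 : Complex.exp (D.int i j k l) = 1 := by
    rw [int, rect, D.zero hij, D.one hij, D.zero hkl, D.one hkl, Complex.exp_sub, Complex.exp_sub,
      Complex.exp_add, key hij (Ne.symm hik) (Ne.symm hjk), key hkl hjk hjl,
      key hij (Ne.symm hil) (Ne.symm hjl), key hkl hik hil]
    have s : ∀ {a b : Fin n}, a ≠ b → D.v a - D.v b ≠ 0 := fun h =>
      sub_ne_zero.2 (D.v_inj.ne h)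
    have s1 := s hik
    have s2 := s (Ne.symm hik)
    have s3 := s hil
    have s4 := s (Ne.symm hil)
    have s5 := s hjk
    have s6 := s (Ne.symm hjk)
    have s7 := s hjl
    have s8 := s (Ne.symm hjl)
    field_simp
    ring
  obtain ⟨m, hm⟩ := Complex.exp_eq_one_iff.1 h1
  exact ⟨m, by rw [hm]; ring⟩

theorem two_int_eq {P w a b : Fin n} (h : [P, w, a, b].Nodup) :
    2 * D.int P w a b = D.rot b P a w - D.rot P a b w - D.rot a P b w + D.rot w P a b := by
  simp only [List.nodup_cons, List.mem_cons, List.not_mem_nil, or_false, not_or,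
    not_false_eq_true, List.nodup_nil, and_true] at h
  obtain ⟨⟨hPw, hPa, hPb⟩, ⟨hwa, hwb⟩, hab⟩ := h
  simp only [int, rot, rect, lam, D.zero hPw, D.one hPw, D.zero hab, D.one hab,
    D.one hPa, D.one hPb, D.one hwa, D.one hwb, D.one (Ne.symm hPw), D.one (Ne.symm hPa),
    D.one (Ne.symm hPb), D.one (Ne.symm hwa), D.one (Ne.symm hwb), D.one (Ne.symm hab),
    D.lc_rev_one hPw, D.lc_rev_one hPa, D.lc_rev_one hPb, D.lc_rev_one hwa, D.lc_rev_one hwb,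
    D.lc_rev_one hab]
  ring

end PlanarDrawing

theorem exists_notMem_of_card_lt {n : ℕ} (s : Finset (Fin n)) (h : s.card < n) : ∃ x, x ∉ s := by
  by_contra! hc
  have := Finset.card_le_card (fun x _ => hc x : Finset.univ ⊆ s)
  simp at this
  omega

namespace PlanarDrawing

variable {n : ℕ}

theorem rot_prod (D : PlanarDrawing n) {P w a b : Fin n} (h : [P, w, a, b].Nodup) :
    D.rot b P a w * D.rot P a b w * D.rot a P b w * D.rot w P a b = (Real.pi : ℂ) ^ 4 := by
  have e := D.two_int_eq h
  obtain ⟨m, hm⟩ := D.int_eq_int h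
  obtain ⟨s1, h1, e1⟩ := D.rot_eq (x := b) (p := P) (q := a) (y := w) (by simp at h ⊢; grind)
  obtain ⟨s2, h2, e2⟩ := D.rot_eq (x := P) (p := a) (q := b) (y := w) (by simp at h ⊢; grind)
  obtain ⟨s3, h3, e3⟩ := D.rot_eq (x := a) (p := P) (q := b) (y := w) (by simp at h ⊢; grind)
  obtain ⟨s4, h4, e4⟩ := D.rot_eq (x := w) (p := P) (q := a) (y := b) (by simp at h ⊢; grind)
  rw [hm, e1, e2, e3, e4] at e
  have hpi : (Real.pi : ℂ) * Complex.I ≠ 0 := by simp [Real.pi_ne_zero]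
  have e' : (4 : ℂ) * m = s1 - s2 - s3 + s4 := by
    apply mul_left_cancel₀ hpi
    linear_combination e
  have e'' : 4 * m = s1 - s2 - s3 + s4 := by exact_mod_cast e'
  have hs : s1 * s2 * s3 * s4 = 1 := by
    rcases h1 with rfl | rfl <;> rcases h2 with rfl | rfl <;> rcases h3 with rfl | rfl <;>
      rcases h4 with rfl | rfl <;> omega
  have hs' : (s1 : ℂ) * s2 * s3 * s4 = 1 := by exact_mod_cast hs
  rw [e1, e2, e3, e4]
  linear_combination (Real.pi * Complex.I : ℂ) ^ 4 * hs' + (Real.pi : ℂ) ^ 4 * Complex.I_pow_four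

/-- If the rotations agree up to a sign at each vertex then they do so up to a global sign. -/
theorem exists_global_sign {D1 D2 : PlanarDrawing n} (hn : 5 ≤ n)
    (H : ∀ x, ∃ τ : ℂ, ∀ p q y, [x, p, q, y].Nodup → D2.rot x p q y = τ * D1.rot x p q y) :
    ∃ τ : ℂ, τ ≠ 0 ∧ ∀ x p q y, [x, p, q, y].Nodup → D2.rot x p q y = τ * D1.rot x p q y := by
  choose τ hτ using H
  have hpi : (Real.pi : ℂ) ^ 4 ≠ 0 := by simp [Real.pi_ne_zero]
  have key : ∀ P w a b, [P, w, a, b].Nodup → τ b * τ P * τ a * τ w = 1 := by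
    intro P w a b h
    have e1 := D1.rot_prod h
    have e2 := D2.rot_prod h
    rw [hτ b P a w (by simp at h ⊢; grind), hτ P a b w (by simp at h ⊢; grind),
      hτ a P b w (by simp at h ⊢; grind), hτ w P a b (by simp at h ⊢; grind)] at e2
    apply mul_right_cancel₀ hpi
    rw [one_mul]
    conv_rhs => rw [← e2]
    rw [← e1]; ring
  have all : ∀ x y, x ≠ y → τ x = τ y ∧ τ x ≠ 0 := by
    intro x y hxy
    obtain ⟨P, hP⟩ := exists_notMem_of_card_lt {x, y} (Finset.card_le_two.trans_lt (by omega))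
    obtain ⟨Q, hQ⟩ := exists_notMem_of_card_lt {x, y, P} (Finset.card_le_three.trans_lt (by omega))
    obtain ⟨R, hR⟩ := exists_notMem_of_card_lt {x, y, P, Q} (Finset.card_le_four.trans_lt (by omega))
    simp only [Finset.mem_insert, Finset.mem_singleton, not_or] at hP hQ hR
    have e1 := key P Q R x (by simp; grind)
    have e2 := key P Q R y (by simp; grind)
    have h0 : τ P * τ R * τ Q ≠ 0 := by
      intro h
      exact one_ne_zero (α := ℂ) (by rw [← e1]; linear_combination τ x * h)
    refine ⟨mul_right_cancel₀ h0 (by linear_combination e1 - e2), fun h => ?_⟩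
    rw [h] at e1; simp at e1
  have : NeZero n := ⟨by omega⟩
  obtain ⟨P, hP⟩ := exists_notMem_of_card_lt {(0 : Fin n)} (by simp; omega)
  refine ⟨τ 0, (all 0 P fun h => hP (by simp [← h])).2, fun x p q y h => ?_⟩
  rcases eq_or_ne x 0 with rfl | hx
  · exact hτ _ _ _ _ h
  · rw [← (all x 0 hx).1]; exact hτ _ _ _ _ h

theorem int_of_rot {D1 D2 : PlanarDrawing n} {τ : ℂ}
    (H : ∀ x p q y, [x, p, q, y].Nodup → D2.rot x p q y = τ * D1.rot x p q y) {i j k l : Fin n}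
    (h : [i, j, k, l].Nodup) : D2.int i j k l = τ * D1.int i j k l := by
  have e1 := D1.two_int_eq h
  have e2 := D2.two_int_eq h
  rw [H l i k j (by simp at h ⊢; grind), H i k l j (by simp at h ⊢; grind),
    H k i l j (by simp at h ⊢; grind), H j i k l (by simp at h ⊢; grind)] at e2
  linear_combination (e2 - τ * e1) / 2

end PlanarDrawing

namespace PlanarDrawing

variable {n : ℕ} (D : PlanarDrawing n)

theorem int_rev_left {i j : Fin n} (h : i ≠ j) (k l : Fin n) : D.int j i k l = -D.int i j k l :=
  D.rect_rev_left_one h ..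

theorem int_rev_right {k l : Fin n} (h : k ≠ l) (i j : Fin n) : D.int i j l k = -D.int i j k l :=
  D.rect_rev_right_one h ..

theorem rect_eq_zero (i j k l : Fin n) {a b c d : ℝ} (ha : a ∈ Icc (0 : ℝ) 1)
    (hb : b ∈ Icc (0 : ℝ) 1) (hc : c ∈ Icc (0 : ℝ) 1) (hd : d ∈ Icc (0 : ℝ) 1)
    (h : ∀ s ∈ Icc (0 : ℝ) 1, s ∈ uIcc a b → ∀ t ∈ Icc (0 : ℝ) 1, t ∈ uIcc c d →
      D.E i j s ≠ D.E k l t) : rect (D.E i j) a b (D.E k l) c d = 0 :=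
  _root_.rect_eq_zero (D.cont i j) (D.cont k l) fun s hs t ht =>
    h s (uIcc_subset_Icc ha hb hs) hs t (uIcc_subset_Icc hc hd ht) ht

theorem rect_add_right (i j : Fin n) {k l : Fin n} {c d e : ℝ}
    (hc : c ∈ Icc (0 : ℝ) 1) (hd : d ∈ Icc (0 : ℝ) 1) (he : e ∈ Icc (0 : ℝ) 1)
    (hij : [i, j, k, l].Nodup) :
    rect (D.E i j) 0 1 (D.E k l) c d + rect (D.E i j) 0 1 (D.E k l) d e =
      rect (D.E i j) 0 1 (D.E k l) c e := by
  simp at hij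
  have key : ∀ s ∈ Icc (0 : ℝ) 1, D.E k l s ≠ D.E i j 0 ∧ D.E k l s ≠ D.E i j 1 := by
    intro s hs
    rw [D.zero hij.1.1, D.one hij.1.1]
    exact ⟨D.ne_vert (by grind) (by grind) (by grind) hs,
      D.ne_vert (by grind) (by grind) (by grind) hs⟩
  exact _root_.rect_add_right (D.cont k l) (fun s hs => key s (uIcc_subset_Icc hc hd hs))
    (fun s hs => key s (uIcc_subset_Icc hd he hs))

theorem rect_eq_int {i j k l : Fin n} (hn : [i, j, k, l].Nodup) {c d : ℝ}
    (hc : c ∈ Icc (0 : ℝ) 1) (hd : d ∈ Icc (0 : ℝ) 1)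
    (hc' : ∀ s ∈ Icc (0 : ℝ) 1, D.E i j s ≠ D.E k l c)
    (hd' : ∀ s ∈ Icc (0 : ℝ) 1, D.E i j s ≠ D.E k l d)
    {s t : ℝ} (hs : s ∈ Icc (0 : ℝ) 1) (ht : t ∈ Icc c d) (h : D.E i j s = D.E k l t) :
    rect (D.E i j) 0 1 (D.E k l) c d = D.int i j k l := by
  have h0 : (0 : ℝ) ∈ Icc (0 : ℝ) 1 := ⟨le_rfl, zero_le_one⟩
  have h1 : (1 : ℝ) ∈ Icc (0 : ℝ) 1 := ⟨zero_le_one, le_rfl⟩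
  have ht' : t ∈ Icc (0 : ℝ) 1 := ⟨hc.1.trans ht.1, ht.2.trans hd.2⟩
  have htc : t ≠ c := fun e => hc' s hs (e ▸ h)
  have htd : t ≠ d := fun e => hd' s hs (e ▸ h)
  have e1 := D.rect_add_right i j h0 hc h1 hn
  have e2 := D.rect_add_right i j hc hd h1 hn
  have z1 : rect (D.E i j) 0 1 (D.E k l) 0 c = 0 := by
    refine D.rect_eq_zero i j k l h0 h1 h0 hc fun s' hs' _ t' ht'' ht''' h' => ?_
    rw [uIcc_of_le hc.1] at ht'''
    have := (D.indep hn hs ht' hs' ht'' h h').2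
    exact htc (le_antisymm (this ▸ ht'''.2) ht.1)
  have z2 : rect (D.E i j) 0 1 (D.E k l) d 1 = 0 := by
    refine D.rect_eq_zero i j k l h0 h1 hd h1 fun s' hs' _ t' ht'' ht''' h' => ?_
    rw [uIcc_of_le hd.2] at ht'''
    have := (D.indep hn hs ht' hs' ht'' h h').2
    exact htd (le_antisymm ht.2 (this ▸ ht'''.1))
  rw [int]
  linear_combination e1 + e2 - z1 - z2

theorem int_ne_zero_of_rect_ne_zero {i j k l : Fin n} (hn : [i, j, k, l].Nodup) {c d : ℝ}
    (hc : c ∈ Icc (0 : ℝ) 1) (hd : d ∈ Icc (0 : ℝ) 1)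
    (hc' : ∀ s ∈ Icc (0 : ℝ) 1, D.E i j s ≠ D.E k l c)
    (hd' : ∀ s ∈ Icc (0 : ℝ) 1, D.E i j s ≠ D.E k l d)
    (h : rect (D.E i j) 0 1 (D.E k l) c d ≠ 0) : D.int i j k l ≠ 0 := by
  have h0 : (0 : ℝ) ∈ Icc (0 : ℝ) 1 := ⟨le_rfl, zero_le_one⟩
  have h1 : (1 : ℝ) ∈ Icc (0 : ℝ) 1 := ⟨zero_le_one, le_rfl⟩
  wlog hcd : c ≤ d generalizing c d
  · exact this hd hc hd' hc' (by rw [rect_symm_right]; exact neg_ne_zero.2 h) (le_of_not_ge hcd)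
  by_cases hex : ∃ s ∈ Icc (0 : ℝ) 1, ∃ t ∈ Icc c d, D.E i j s = D.E k l t
  · obtain ⟨s, hs, t, ht, e⟩ := hex
    rwa [← D.rect_eq_int hn hc hd hc' hd' hs ht e]
  · push Not at hex
    refine absurd (D.rect_eq_zero i j k l h0 h1 hc hd fun s hs _ t _ ht => ?_) h
    exact hex s hs t (by rwa [uIcc_of_le hcd] at ht)

theorem rect_add_rect_eq_rot {a a' b b' w : Fin n} (hn : [a, a', b, b', w].Nodup) {t u : ℝ}
    (ht : t ∈ Icc (0 : ℝ) 1) (hu : u ∈ Icc (0 : ℝ) 1) (h : D.E a a' t = D.E b b' u) :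
    rect (D.E a w) 0 1 (D.E b b') u 0 + rect (D.E b w) 0 1 (D.E a a') t 0 =
      -(D.rot a a' b w + D.rot b b' a w) := by
  simp at hn
  have haa : a ≠ a' := by grind
  have hab : a ≠ b := by grind
  have haw : a ≠ w := by grind
  have hbb : b ≠ b' := by grind
  have hbw : b ≠ w := by grind
  have ha'b : a' ≠ b := by grind
  have ha'w : a' ≠ w := by grind
  have hb'a : b' ≠ a := by grind
  have hb'w : b' ≠ w := by grind
  rw [← uIcc_of_le zero_le_one] at ht hu
  have ht0 : D.E a a' t ≠ D.v a := fun e => by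
    rw [h] at e
    exact D.ne_vert hbb hab (Ne.symm hb'a) (by rwa [← uIcc_of_le zero_le_one]) e
  have hu0 : D.E b b' u ≠ D.v b := fun e => by
    rw [← h] at e
    exact D.ne_vert haa hab.symm (Ne.symm ha'b) (by rwa [← uIcc_of_le zero_le_one]) e
  have hta : t ≠ 0 := fun e => ht0 (by rw [e, D.zero haa])
  have hua : u ≠ 0 := fun e => hu0 (by rw [e, D.zero hbb])
  have l1 := lam_trunc_left (D.cont a a') (D.cont a b) (D.germs haa hab ha'b) ht hta one_ne_zero
  have l2 := lam_trunc_right (D.cont a w) (D.cont a a') (D.germs haw haa ha'w.symm) ht hta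
    one_ne_zero
  have l3 := lam_trunc_left (D.cont b b') (D.cont b a) (D.germs hbb hab.symm hb'a) hu hua
    one_ne_zero
  have l4 := lam_trunc_right (D.cont b w) (D.cont b b') (D.germs hbw hbb hb'w.symm) hu hua
    one_ne_zero
  simp only [rot, l1, l2, l3, l4, rect]
  simp only [lam, D.zero haa, D.zero hbb, D.zero haw, D.zero hbw,
    D.one haw, D.one hbw, D.one hab, D.one hab.symm, D.lc_rev_one hab, h,
    lc_symm (D.E b b') u 0, lc_symm (D.E a a') t 0]
  rw [lc_symm (D.E b b') 0 u, lc_symm (D.E a a') 0 t]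
  ring

end PlanarDrawing

theorem sg_quadruple {w a b d : ℝ} (h1 : w ≠ a) (h2 : w ≠ b) (h3 : w ≠ d) (h4 : a ≠ b) (h5 : a ≠ d)
    (h6 : b ≠ d) (h : sg w b - sg a b - sg w d + sg a d ≠ 0) :
    sg a w + sg w d - sg a b - sg b d = 0 := by
  rw [sg_swap h1]
  unfold sg at *
  rcases lt_or_gt_of_ne h1 with k1 | k1 <;> rcases lt_or_gt_of_ne h2 with k2 | k2 <;>
    rcases lt_or_gt_of_ne h3 with k3 | k3 <;> rcases lt_or_gt_of_ne h4 with k4 | k4 <;>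
    rcases lt_or_gt_of_ne h5 with k5 | k5 <;> rcases lt_or_gt_of_ne h6 with k6 | k6 <;>
    first
    | (exfalso; linarith)
    | (revert h
       simp only [k1, k2, k3, k4, k5, k6, k1.not_gt, k2.not_gt, k3.not_gt, k4.not_gt, k5.not_gt,
        k6.not_gt, if_true, if_false]
       norm_num)

/-- The two halves of each of two arcs meeting once form four germs. -/
theorem crossing_structure {γ δ : ℝ → ℂ} (hγ : Continuous γ) (hδ : Continuous δ)
    (hγi : InjOn γ (Icc 0 1)) (hδi : InjOn δ (Icc 0 1)) {s u : ℝ} (hs : s ∈ Ioo (0 : ℝ) 1)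
    (hu : u ∈ Ioo (0 : ℝ) 1) (h : γ s = δ u)
    (huniq : ∀ x ∈ Icc (0 : ℝ) 1, ∀ y ∈ Icc (0 : ℝ) 1, γ x = δ y → x = s ∧ y = u)
    (hne : rect γ 0 1 δ 0 1 ≠ 0) :
    lam γ s 1 γ s 0 + lam γ s 0 δ u 1 - lam γ s 1 δ u 0 - lam δ u 0 δ u 1 = 0 := by
  have i0 : uIcc s 0 ⊆ Icc (0 : ℝ) 1 := uIcc_subset_Icc ⟨hs.1.le, hs.2.le⟩ ⟨le_rfl, zero_le_one⟩
  have i1 : uIcc s 1 ⊆ Icc (0 : ℝ) 1 := uIcc_subset_Icc ⟨hs.1.le, hs.2.le⟩ ⟨zero_le_one, le_rfl⟩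
  have j0 : uIcc u 0 ⊆ Icc (0 : ℝ) 1 := uIcc_subset_Icc ⟨hu.1.le, hu.2.le⟩ ⟨le_rfl, zero_le_one⟩
  have j1 : uIcc u 1 ⊆ Icc (0 : ℝ) 1 := uIcc_subset_Icc ⟨hu.1.le, hu.2.le⟩ ⟨zero_le_one, le_rfl⟩
  have hs' : s ∈ Icc (0 : ℝ) 1 := ⟨hs.1.le, hs.2.le⟩
  have hu' : u ∈ Icc (0 : ℝ) 1 := ⟨hu.1.le, hu.2.le⟩
  have gself : ∀ {f : ℝ → ℂ} {p : ℝ}, InjOn f (Icc 0 1) → p ∈ Ioo (0 : ℝ) 1 →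
      Germs f p 1 f p 0 := by
    intro f p hf hp
    refine ⟨rfl, fun x hx y hy e => ?_⟩
    rw [uIcc_of_le hp.2.le] at hx
    rw [uIcc_of_ge hp.1.le] at hy
    have := hf ⟨hp.1.le.trans hx.1, hx.2⟩ ⟨hy.1, hy.2.trans hp.2.le⟩ e
    subst this
    exact ⟨le_antisymm hy.2 hx.1, le_antisymm hy.2 hx.1⟩
  have gs := gself hγi hs
  have gu := gself hδi hu
  have gx : ∀ {p q : ℝ}, uIcc s p ⊆ Icc 0 1 → uIcc u q ⊆ Icc 0 1 → Germs γ s p δ u q :=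
    fun hp hq => ⟨h, fun x hx y hy e => huniq x (hp hx) y (hq hy) e⟩
  obtain ⟨l, θ, hθ, -, hl⟩ := local_structure (γ := ![γ, γ, δ, δ]) (a := ![s, s, u, u])
    (b := ![0, 1, 0, 1]) (X := γ s)
    (by intro i; fin_cases i <;> simpa) (by intro i; fin_cases i <;> simp [h])
    (by
      intro i
      fin_cases i
      · exact fun t ht e => hγi (i0 ht) hs' e
      · exact fun t ht e => hγi (i1 ht) hs' e
      · exact fun t ht e => hδi (j0 ht) hu' (e.trans h)
      · exact fun t ht e => hδi (j1 ht) hu' (e.trans h))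
    (by
      intro i
      fin_cases i
      · exact hs.1.ne'
      · exact hs.2.ne
      · exact hu.1.ne'
      · exact hu.2.ne)
    (by
      intro i j hij
      fin_cases i <;> fin_cases j <;> first | exact absurd rfl hij | skip
      · exact gs.symm
      · exact gx i0 j0
      · exact gx i0 j1
      · exact gs
      · exact gx i1 j0
      · exact gx i1 j1
      · exact (gx i0 j0).symm
      · exact (gx i1 j0).symm
      · exact gu.symm
      · exact (gx i0 j1).symm
      · exact (gx i1 j1).symm
      · exact gu)
  have e1 : lam γ s 1 γ s 0 = l 0 - l 1 + Real.pi * Complex.I * sg (θ 1) (θ 0) := hl 1 0 (by decide)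
  have e2 : lam γ s 0 δ u 1 = l 3 - l 0 + Real.pi * Complex.I * sg (θ 0) (θ 3) := hl 0 3 (by decide)
  have e3 : lam γ s 1 δ u 0 = l 2 - l 1 + Real.pi * Complex.I * sg (θ 1) (θ 2) := hl 1 2 (by decide)
  have e4 : lam δ u 0 δ u 1 = l 3 - l 2 + Real.pi * Complex.I * sg (θ 2) (θ 3) := hl 2 3 (by decide)
  have e5 : lam γ s 0 δ u 0 = l 2 - l 0 + Real.pi * Complex.I * sg (θ 0) (θ 2) := hl 0 2 (by decide)
  have e6 : lam γ s 1 δ u 1 = l 3 - l 1 + Real.pi * Complex.I * sg (θ 1) (θ 3) := hl 1 3 (by decide)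
  have offγ : ∀ y ∈ Icc (0 : ℝ) 1, y ≠ u → ∀ x ∈ Icc (0 : ℝ) 1, γ x ≠ δ y :=
    fun y hy hyu x hx e => hyu (huniq x hx y hy e).2
  have offδ : ∀ x ∈ Icc (0 : ℝ) 1, x ≠ s → ∀ y ∈ Icc (0 : ℝ) 1, δ y ≠ γ x :=
    fun x hx hxs y hy e => hxs (huniq x hx y hy e.symm).1
  have z0 : (0 : ℝ) ∈ Icc (0 : ℝ) 1 := ⟨le_rfl, zero_le_one⟩
  have z1 : (1 : ℝ) ∈ Icc (0 : ℝ) 1 := ⟨zero_le_one, le_rfl⟩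
  have aγ : ∀ y ∈ Icc (0 : ℝ) 1, y ≠ u → lc γ 0 1 (δ y) = lc γ s 1 (δ y) - lc γ s 0 (δ y) := by
    intro y hy hyu
    rw [← lc_add hγ (a := 0) (b := s) (c := 1), lc_symm γ s 0]
    · ring
    · exact fun x hx => offγ y hy hyu x (i0 (by rwa [uIcc_comm]))
    · exact fun x hx => offγ y hy hyu x (i1 hx)
  have aδ : ∀ x ∈ Icc (0 : ℝ) 1, x ≠ s → lc δ 0 1 (γ x) = lc δ u 1 (γ x) - lc δ u 0 (γ x) := by
    intro y hy hyu
    rw [← lc_add hδ (a := 0) (b := u) (c := 1), lc_symm δ u 0]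
    · ring
    · exact fun x hx => offδ y hy hyu x (j0 (by rwa [uIcc_comm]))
    · exact fun x hx => offδ y hy hyu x (j1 hx)
  have rect_val : rect γ 0 1 δ 0 1 = Real.pi * Complex.I * (sg (θ 0) (θ 2) - sg (θ 1) (θ 2)
      - sg (θ 0) (θ 3) + sg (θ 1) (θ 3)) := by
    rw [rect, aγ 0 z0 hu.1.ne, aγ 1 z1 hu.2.ne', aδ 0 z0 hs.1.ne, aδ 1 z1 hs.2.ne']
    simp only [lam] at e2 e3 e5 e6
    linear_combination e5 - e3 - e2 + e6
  have hq := sg_quadruple (w := θ 0) (a := θ 1) (b := θ 2) (d := θ 3) (hθ.ne (by decide))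
    (hθ.ne (by decide)) (hθ.ne (by decide)) (hθ.ne (by decide)) (hθ.ne (by decide))
    (hθ.ne (by decide)) (fun h0 => hne (by rw [rect_val, h0, mul_zero]))
  rw [e1, e2, e3, e4]
  linear_combination (Real.pi * Complex.I : ℂ) * hq

namespace PlanarDrawing

variable {n : ℕ} (D : PlanarDrawing n)

theorem mem_Ioo {i j k l : Fin n} (hn : [i, j, k, l].Nodup) {s t : ℝ} (hs : s ∈ Icc (0 : ℝ) 1)
    (ht : t ∈ Icc (0 : ℝ) 1) (h : D.E i j s = D.E k l t) : s ∈ Ioo (0 : ℝ) 1 := by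
  simp at hn
  refine ⟨lt_of_le_of_ne hs.1 fun e => ?_, lt_of_le_of_ne hs.2 fun e => ?_⟩
  · rw [← e, D.zero hn.1.1] at h
    exact D.ne_vert (by grind) (by grind) (by grind) ht h.symm
  · rw [e, D.one hn.1.1] at h
    exact D.ne_vert (by grind) (by grind) (by grind) ht h.symm

theorem int_eq_zero_of_crossings {w a₁ a₂ b₁ b₂ : Fin n} (hn : [w, a₁, a₂, b₁, b₂].Nodup)
    {s₁ s₂ u₁ u₂ : ℝ} (hs₁ : s₁ ∈ Icc (0 : ℝ) 1) (hs₂ : s₂ ∈ Icc (0 : ℝ) 1)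
    (hu₁ : u₁ ∈ Icc (0 : ℝ) 1) (hu₂ : u₂ ∈ Icc (0 : ℝ) 1) (h₁ : D.E w a₁ s₁ = D.E b₁ b₂ u₁)
    (h₂ : D.E w a₂ s₂ = D.E b₁ b₂ u₂) (hu : u₁ < u₂)
    (he : ∀ t ∈ Icc (0 : ℝ) 1, ∀ u ∈ Icc 0 u₁, D.E a₁ a₂ t ≠ D.E b₁ b₂ u)
    (hne : D.int w a₁ b₁ b₂ ≠ 0) : D.int w b₁ a₁ a₂ = 0 := by
  have n1 : [w, a₁, b₁, b₂].Nodup := by simp at hn ⊢; grind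
  have n2 : [w, a₂, b₁, b₂].Nodup := by simp at hn ⊢; grind
  have n1' : [b₁, b₂, w, a₁].Nodup := by simp at hn ⊢; grind
  have s1 := D.mem_Ioo n1 hs₁ hu₁ h₁
  have s2 := D.mem_Ioo n2 hs₂ hu₂ h₂
  have u1 := D.mem_Ioo n1' hu₁ hs₁ h₁.symm
  simp only [List.nodup_cons, List.mem_cons, List.not_mem_nil, or_false, not_or,
    not_false_eq_true, List.nodup_nil, and_true] at hn
  obtain ⟨⟨wa₁, wa₂, wb₁, wb₂⟩, ⟨a₁a₂, a₁b₁, a₁b₂⟩, ⟨a₂b₁, a₂b₂⟩, b₁b₂⟩ := hn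
  have z0 : (0 : ℝ) ∈ Icc (0 : ℝ) 1 := ⟨le_rfl, zero_le_one⟩
  have z1 : (1 : ℝ) ∈ Icc (0 : ℝ) 1 := ⟨zero_le_one, le_rfl⟩
  have uniq : ∀ x ∈ Icc (0 : ℝ) 1, ∀ y ∈ Icc (0 : ℝ) 1, D.E w a₁ x = D.E b₁ b₂ y →
      x = s₁ ∧ y = u₁ := fun x hx y hy e => D.indep n1 hx hy hs₁ hu₁ e h₁
  have K := crossing_structure (D.cont w a₁) (D.cont b₁ b₂) (D.inj wa₁) (D.inj b₁b₂) s1 u1 h₁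
    uniq hne
  have u₂m : u₂ ∈ uIcc u₁ 1 := by rw [uIcc_of_le hu₁.2]; exact ⟨hu.le, hu₂.2⟩
  have g1 : Germs (D.E w a₁) s₁ 0 (D.E b₁ b₂) u₁ 1 := ⟨h₁, fun x hx y hy e =>
    uniq x (uIcc_subset_Icc hs₁ z0 hx) y (uIcc_subset_Icc hu₁ z1 hy) e⟩
  have g2 : Germs (D.E b₁ b₂) u₁ 0 (D.E b₁ b₂) u₁ 1 := by
    refine ⟨rfl, fun x hx y hy e => ?_⟩
    have := D.inj b₁b₂ (uIcc_subset_Icc hu₁ z0 hx) (uIcc_subset_Icc hu₁ z1 hy) e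
    subst this
    rw [uIcc_of_ge hu₁.1] at hx
    rw [uIcc_of_le hu₁.2] at hy
    exact ⟨le_antisymm hx.2 hy.1, le_antisymm hx.2 hy.1⟩
  have t1 := lam_trunc_right (D.cont w a₁) (D.cont b₁ b₂) g1 u₂m hu.ne' s1.1.ne
  have t2 := lam_trunc_right (D.cont b₁ b₂) (D.cont b₁ b₂) g2 u₂m hu.ne' u1.1.ne
  have r1 : rect (D.E w a₁) s₁ 0 (D.E a₁ a₂) 0 1 = 0 := by
    refine D.rect_eq_zero _ _ _ _ hs₁ z0 z0 z1 fun s hs hs' t ht _ e => ?_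
    have e' : D.E a₁ w (1 - s) = D.E a₁ a₂ t := by rw [D.rev wa₁, sub_sub_cancel, e]
    have := (D.adj (Ne.symm wa₁) a₁a₂ wa₂ ⟨by linarith [hs.2], by linarith [hs.1]⟩ ht e').1
    rw [uIcc_of_ge hs₁.1] at hs'
    linarith [hs'.2, s1.2]
  have r2 : rect (D.E w a₁) s₁ 0 (D.E w a₂) 1 s₂ = 0 := by
    refine D.rect_eq_zero _ _ _ _ hs₁ z0 z1 hs₂ fun s hs _ t ht ht' e => ?_
    have := (D.adj wa₁ wa₂ a₁a₂ hs ht e).2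
    rw [uIcc_of_ge hs₂.2] at ht'
    linarith [ht'.1, s2.1]
  have r3 : rect (D.E b₁ b₂) u₁ 0 (D.E a₁ a₂) 0 1 = 0 := by
    refine D.rect_eq_zero _ _ _ _ hu₁ z0 z0 z1 fun s hs hs' t ht _ e => ?_
    rw [uIcc_of_ge hu₁.1] at hs'
    exact he t ht s hs' e.symm
  have r4 : rect (D.E b₁ b₂) u₁ 0 (D.E w a₂) 1 s₂ = 0 := by
    refine D.rect_eq_zero _ _ _ _ hu₁ z0 z1 hs₂ fun s hs hs' t ht _ e => ?_
    have := (D.indep n2 ht hs hs₂ hu₂ e.symm h₂).2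
    rw [uIcc_of_ge hu₁.1] at hs'
    linarith [hs'.2]
  have k1 : rect (D.E w b₁) 0 1 (D.E w a₁) s₁ 1 = 0 := by
    refine D.rect_eq_zero _ _ _ _ z0 z1 hs₁ z1 fun s hs _ t ht ht' e => ?_
    have := (D.adj wb₁ wa₁ (Ne.symm a₁b₁) hs ht e).2
    rw [uIcc_of_le hs₁.2] at ht'
    linarith [ht'.1, s1.1]
  have k2 : rect (D.E w b₁) 0 1 (D.E w a₂) 1 s₂ = 0 := by
    refine D.rect_eq_zero _ _ _ _ z0 z1 z1 hs₂ fun s hs _ t ht ht' e => ?_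
    have := (D.adj wb₁ wa₂ (Ne.symm a₂b₁) hs ht e).2
    rw [uIcc_of_ge hs₂.2] at ht'
    linarith [ht'.1, s2.1]
  have k3 : rect (D.E w b₁) 0 1 (D.E b₁ b₂) u₁ u₂ = 0 := by
    refine D.rect_eq_zero _ _ _ _ z0 z1 hu₁ hu₂ fun s hs _ t ht ht' e => ?_
    have e' : D.E b₁ w (1 - s) = D.E b₁ b₂ t := by rw [D.rev wb₁, sub_sub_cancel, e]
    have := (D.adj (Ne.symm wb₁) b₁b₂ wb₂ ⟨by linarith [hs.2], by linarith [hs.1]⟩ ht e').2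
    rw [uIcc_of_le hu.le] at ht'
    linarith [ht'.1, u1.1]
  rw [t1, t2] at K
  simp only [rect, lam, int, D.zero wa₁, D.one wa₁, D.one wa₂, D.zero wb₁, D.one wb₁,
    D.zero a₁a₂, D.one a₁a₂, D.zero b₁b₂, h₁, h₂] at K r1 r2 r3 r4 k1 k2 k3 ⊢
  linear_combination K + r3 + r4 - r1 - r2 - k1 - k2 + k3

theorem exists_of_int_ne_zero {i j k l : Fin n} (h : D.int i j k l ≠ 0) :
    ∃ s ∈ Icc (0 : ℝ) 1, ∃ t ∈ Icc (0 : ℝ) 1, D.E i j s = D.E k l t := by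
  by_contra! hc
  exact h (D.rect_eq_zero i j k l ⟨le_rfl, zero_le_one⟩ ⟨zero_le_one, le_rfl⟩
    ⟨le_rfl, zero_le_one⟩ ⟨zero_le_one, le_rfl⟩ fun s hs _ t ht _ => hc s hs t ht)

theorem one_sub_mem {t : ℝ} (h : t ∈ Icc (0 : ℝ) 1) : 1 - t ∈ Icc (0 : ℝ) 1 :=
  ⟨by linarith [h.2], by linarith [h.1]⟩

/-- If `a₁a₂` and `b₁b₂` cross, the four edges from `w` to their ends cannot all cross the other
edge. -/
theorem not_all_int_ne_zero {w a₁ a₂ b₁ b₂ : Fin n} (hn : [w, a₁, a₂, b₁, b₂].Nodup) {p q : ℝ}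
    (hp : p ∈ Icc (0 : ℝ) 1) (hq : q ∈ Icc (0 : ℝ) 1) (h : D.E a₁ a₂ p = D.E b₁ b₂ q)
    (h₁ : D.int w a₁ b₁ b₂ ≠ 0) (h₂ : D.int w a₂ b₁ b₂ ≠ 0) (h₃ : D.int w b₁ a₁ a₂ ≠ 0)
    (h₄ : D.int w b₂ a₁ a₂ ≠ 0) : False := by
  obtain ⟨s₁, hs₁, u₁, hu₁, e₁⟩ := D.exists_of_int_ne_zero h₁
  obtain ⟨s₂, hs₂, u₂, hu₂, e₂⟩ := D.exists_of_int_ne_zero h₂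
  have hn' := hn
  simp only [List.nodup_cons, List.mem_cons, List.not_mem_nil, or_false, not_or,
    not_false_eq_true, List.nodup_nil, and_true] at hn'
  obtain ⟨⟨wa₁, wa₂, wb₁, wb₂⟩, ⟨a₁a₂, a₁b₁, a₁b₂⟩, ⟨a₂b₁, a₂b₂⟩, b₁b₂⟩ := hn'
  wlog hu : u₁ < u₂ generalizing a₁ a₂ p s₁ s₂ u₁ u₂
  · refine this (by simp; grind) (p := 1 - p) (one_sub_mem hp) ?_ h₂ h₁ ?_ ?_ s₂ hs₂ u₂ hu₂ e₂ s₁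
      hs₁ u₁ hu₁ e₁ wa₂ wa₁ (Ne.symm a₁a₂) a₂b₁ a₂b₂ a₁b₁ a₁b₂
      (lt_of_le_of_ne (not_lt.1 hu) ?_)
    · rw [D.rev a₁a₂, sub_sub_cancel, h]
    · rw [D.int_rev_right a₁a₂]; exact neg_ne_zero.2 h₃
    · rw [D.int_rev_right a₁a₂]; exact neg_ne_zero.2 h₄
    · rintro rfl
      have := (D.adj wa₁ wa₂ a₁a₂ hs₁ hs₂ (e₁.trans e₂.symm)).1
      exact (D.mem_Ioo (by simp; grind) hs₁ hu₁ e₁).1.ne' this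
  have hn1 : [a₁, a₂, b₁, b₂].Nodup := by simp; grind
  rcases lt_or_ge u₁ q with hq₁ | hq₁
  · refine h₃ (D.int_eq_zero_of_crossings hn hs₁ hs₂ hu₁ hu₂ e₁ e₂ hu (fun t ht u hu' e => ?_) h₁)
    have := (D.indep hn1 ht ⟨hu'.1, hu'.2.trans hu₁.2⟩ hp hq e h).2
    linarith [hu'.2]
  · have e₁' : D.E w a₁ s₁ = D.E b₂ b₁ (1 - u₁) := by rw [D.rev b₁b₂, sub_sub_cancel, e₁]
    have e₂' : D.E w a₂ s₂ = D.E b₂ b₁ (1 - u₂) := by rw [D.rev b₁b₂, sub_sub_cancel, e₂]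
    have := D.int_eq_zero_of_crossings (by simp; grind) hs₂ hs₁ (one_sub_mem hu₂)
      (one_sub_mem hu₁) e₂' e₁' (by linarith) (fun t ht u hu' e => ?_)
      (by rw [D.int_rev_right b₁b₂]; exact neg_ne_zero.2 h₂)
    · rw [D.int_rev_right a₁a₂] at this
      exact h₄ (neg_eq_zero.1 this)
    · rw [D.rev a₁a₂, D.rev b₁b₂] at e
      have := (D.indep hn1 (one_sub_mem ht) (one_sub_mem
        ⟨hu'.1, hu'.2.trans (one_sub_mem hu₂).2⟩) hp hq e h).2
      linarith [hu'.2]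

end PlanarDrawing

namespace PlanarDrawing

variable {n : ℕ}

theorem ne_of_crossing (D : PlanarDrawing n) {a a' b b' w : Fin n} (hn : [a, a', b, b', w].Nodup)
    {t u : ℝ} (ht : t ∈ Icc (0 : ℝ) 1) (hu : u ∈ Icc (0 : ℝ) 1) (h : D.E a a' t = D.E b b' u) :
    ∀ s ∈ Icc (0 : ℝ) 1, D.E b w s ≠ D.E a a' t := by
  intro s hs e
  simp at hn
  have := (D.adj (by grind) (by grind) (by grind) hs hu (e.trans h)).2
  rw [this, D.zero (by grind)] at h
  exact D.ne_vert (k := b) (by grind) (by grind) (by grind) ht h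

theorem ne_vert_of_edge (D : PlanarDrawing n) {i j k l : Fin n} (hn : [i, j, k, l].Nodup) :
    ∀ s ∈ Icc (0 : ℝ) 1, D.E i j s ≠ D.E k l 0 := by
  intro s hs
  simp at hn
  rw [D.zero (by grind)]
  exact D.ne_vert (by grind) (by grind) (by grind) hs

variable {D1 D2 : PlanarDrawing n} {τ : ℂ}

theorem int_ne_zero_of_rect_sub_ne_zero
    (H : ∀ x p q y, [x, p, q, y].Nodup → D2.rot x p q y = τ * D1.rot x p q y) {i j k l : Fin n}
    (hn : [i, j, k, l].Nodup) {c₁ c₂ : ℝ} (hc₁ : c₁ ∈ Icc (0 : ℝ) 1) (hc₂ : c₂ ∈ Icc (0 : ℝ) 1)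
    (h₁ : ∀ s ∈ Icc (0 : ℝ) 1, D1.E i j s ≠ D1.E k l c₁)
    (h₂ : ∀ s ∈ Icc (0 : ℝ) 1, D2.E i j s ≠ D2.E k l c₂)
    (h : rect (D2.E i j) 0 1 (D2.E k l) c₂ 0 - τ * rect (D1.E i j) 0 1 (D1.E k l) c₁ 0 ≠ 0) :
    D1.int i j k l ≠ 0 := by
  have z0 : (0 : ℝ) ∈ Icc (0 : ℝ) 1 := ⟨le_rfl, zero_le_one⟩
  by_cases h0 : rect (D1.E i j) 0 1 (D1.E k l) c₁ 0 = 0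
  · rw [h0, mul_zero, sub_zero] at h
    have := D2.int_ne_zero_of_rect_ne_zero hn hc₂ z0 h₂ (D2.ne_vert_of_edge hn) h
    rw [int_of_rot H hn] at this
    exact right_ne_zero_of_mul this
  · exact D1.int_ne_zero_of_rect_ne_zero hn hc₁ z0 h₁ (D1.ne_vert_of_edge hn) h0

theorem rect_rev_eq_add_int (D : PlanarDrawing n) {i j k l : Fin n} (hn : [i, j, k, l].Nodup)
    {c : ℝ} (hc : c ∈ Icc (0 : ℝ) 1) :
    rect (D.E i j) 0 1 (D.E l k) (1 - c) 0 =
      rect (D.E i j) 0 1 (D.E k l) c 0 + D.int i j k l := by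
  have z0 : (0 : ℝ) ∈ Icc (0 : ℝ) 1 := ⟨le_rfl, zero_le_one⟩
  have z1 : (1 : ℝ) ∈ Icc (0 : ℝ) 1 := ⟨zero_le_one, le_rfl⟩
  have := D.rect_add_right i j hc z0 z1 hn
  simp at hn
  rw [D.rect_rev_right (by grind), sub_sub_cancel, sub_zero, int, this]

/-- Pieces of an edge cut off by a crossing have the same intersection numbers in both drawings,
up to the global sign. -/
theorem rect_eq_of_rot
    (H : ∀ x p q y, [x, p, q, y].Nodup → D2.rot x p q y = τ * D1.rot x p q y)
    {a a' b b' w : Fin n} (hn : [a, a', b, b', w].Nodup) {t₁ u₁ t₂ u₂ : ℝ}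
    (ht₁ : t₁ ∈ Icc (0 : ℝ) 1) (hu₁ : u₁ ∈ Icc (0 : ℝ) 1) (ht₂ : t₂ ∈ Icc (0 : ℝ) 1)
    (hu₂ : u₂ ∈ Icc (0 : ℝ) 1) (h₁ : D1.E a a' t₁ = D1.E b b' u₁)
    (h₂ : D2.E a a' t₂ = D2.E b b' u₂) :
    rect (D2.E b w) 0 1 (D2.E a a') t₂ 0 = τ * rect (D1.E b w) 0 1 (D1.E a a') t₁ 0 := by
  by_contra hne
  replace hne := sub_ne_zero.2 hne
  have sum_zero : ∀ {a a' b b' : Fin n}, [a, a', b, b', w].Nodup → ∀ {t₁ u₁ t₂ u₂ : ℝ},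
      t₁ ∈ Icc (0 : ℝ) 1 → u₁ ∈ Icc (0 : ℝ) 1 → t₂ ∈ Icc (0 : ℝ) 1 → u₂ ∈ Icc (0 : ℝ) 1 →
      D1.E a a' t₁ = D1.E b b' u₁ → D2.E a a' t₂ = D2.E b b' u₂ →
      rect (D2.E b w) 0 1 (D2.E a a') t₂ 0 - τ * rect (D1.E b w) 0 1 (D1.E a a') t₁ 0 =
      -(rect (D2.E a w) 0 1 (D2.E b b') u₂ 0 - τ * rect (D1.E a w) 0 1 (D1.E b b') u₁ 0) := by
    intro a a' b b' hn t₁ u₁ t₂ u₂ ht₁ hu₁ ht₂ hu₂ h₁ h₂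
    have e1 := D1.rect_add_rect_eq_rot hn ht₁ hu₁ h₁
    have e2 := D2.rect_add_rect_eq_rot hn ht₂ hu₂ h₂
    rw [H a a' b w (by simp at hn ⊢; grind), H b b' a w (by simp at hn ⊢; grind)] at e2
    linear_combination e2 - τ * e1
  have rev_eq : ∀ {i j k l : Fin n}, [i, j, k, l].Nodup → ∀ {c₁ c₂ : ℝ}, c₁ ∈ Icc (0 : ℝ) 1 →
      c₂ ∈ Icc (0 : ℝ) 1 → rect (D2.E i j) 0 1 (D2.E l k) (1 - c₂) 0 -
        τ * rect (D1.E i j) 0 1 (D1.E l k) (1 - c₁) 0 =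
      rect (D2.E i j) 0 1 (D2.E k l) c₂ 0 - τ * rect (D1.E i j) 0 1 (D1.E k l) c₁ 0 := by
    intro i j k l hn c₁ c₂ hc₁ hc₂
    rw [D1.rect_rev_eq_add_int hn hc₁, D2.rect_rev_eq_add_int hn hc₂, int_of_rot H hn]
    ring
  have hn' := hn
  simp only [List.nodup_cons, List.mem_cons, List.not_mem_nil, or_false, not_or,
    not_false_eq_true, List.nodup_nil, and_true] at hn'
  obtain ⟨⟨aa', ab, ab', aw⟩, ⟨a'b, a'b', a'w⟩, ⟨bb', bw⟩, b'w⟩ := hn'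
  have nb : [a, a', b', b, w].Nodup := by simp; grind
  have na : [a', a, b, b', w].Nodup := by simp; grind
  have ns : [b, b', a, a', w].Nodup := by simp; grind
  have ns' : [b, b', a', a, w].Nodup := by simp; grind
  have nba : [b, w, a, a'].Nodup := by simp; grind
  have nb'a : [b', w, a, a'].Nodup := by simp; grind
  have nab : [a, w, b, b'].Nodup := by simp; grind
  have na'b : [a', w, b, b'].Nodup := by simp; grind
  have nw : [w, a, a', b, b'].Nodup := by simp; grind
  have hb₁ : D1.E a a' t₁ = D1.E b' b (1 - u₁) := by rw [D1.rev bb', sub_sub_cancel, h₁]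
  have hb₂ : D2.E a a' t₂ = D2.E b' b (1 - u₂) := by rw [D2.rev bb', sub_sub_cancel, h₂]
  have ha₁ : D1.E b b' u₁ = D1.E a' a (1 - t₁) := by rw [D1.rev aa', sub_sub_cancel, h₁]
  have ha₂ : D2.E b b' u₂ = D2.E a' a (1 - t₂) := by rw [D2.rev aa', sub_sub_cancel, h₂]
  have s1 := sum_zero hn ht₁ hu₁ ht₂ hu₂ h₁ h₂
  have s2 := sum_zero nb ht₁ (one_sub_mem hu₁) ht₂ (one_sub_mem hu₂) hb₁ hb₂
  have s3 := sum_zero na (one_sub_mem ht₁) hu₁ (one_sub_mem ht₂) hu₂ ha₁.symm ha₂.symm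
  rw [rev_eq nab hu₁ hu₂] at s2
  rw [rev_eq nba ht₁ ht₂] at s3
  have i1 := int_ne_zero_of_rect_sub_ne_zero H nba ht₁ ht₂
    (D1.ne_of_crossing hn ht₁ hu₁ h₁) (D2.ne_of_crossing hn ht₂ hu₂ h₂) hne
  have i2 := int_ne_zero_of_rect_sub_ne_zero H nb'a ht₁ ht₂
    (D1.ne_of_crossing nb ht₁ (one_sub_mem hu₁) hb₁)
    (D2.ne_of_crossing nb ht₂ (one_sub_mem hu₂) hb₂) (by rw [s2, ← s1]; exact hne)
  have i3 := int_ne_zero_of_rect_sub_ne_zero H nab hu₁ hu₂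
    (D1.ne_of_crossing ns hu₁ ht₁ h₁.symm) (D2.ne_of_crossing ns hu₂ ht₂ h₂.symm)
    (fun h => hne (by rw [s1, h, neg_zero]))
  have i4 := int_ne_zero_of_rect_sub_ne_zero H na'b hu₁ hu₂
    (D1.ne_of_crossing ns' hu₁ (one_sub_mem ht₁) ha₁)
    (D2.ne_of_crossing ns' hu₂ (one_sub_mem ht₂) ha₂) (fun h => hne (by rw [s3, h, neg_zero]))
  refine D1.not_all_int_ne_zero nw ht₁ hu₁ h₁ ?_ ?_ ?_ ?_
  · rw [D1.int_rev_left aw]; exact neg_ne_zero.2 i3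
  · rw [D1.int_rev_left a'w]; exact neg_ne_zero.2 i4
  · rw [D1.int_rev_left bw]; exact neg_ne_zero.2 i1
  · rw [D1.int_rev_left b'w]; exact neg_ne_zero.2 i2

theorem rect_add_rect_add_int (D : PlanarDrawing n) {a a' c c' w b : Fin n}
    (hn : [a, a', c, c', w, b].Nodup) {t v : ℝ} (ht : t ∈ Icc (0 : ℝ) 1) (hv : v ∈ Icc (0 : ℝ) 1)
    (h : D.E a a' t = D.E c c' v) :
    rect (D.E w b) 0 1 (D.E a a') 0 t + rect (D.E w b) 0 1 (D.E c c') v 0 + D.int w b c a =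
      D.rot a a' c b + rect (D.E a b) 0 1 (D.E c c') v 0 -
        (D.rot a a' c w + rect (D.E a w) 0 1 (D.E c c') v 0) := by
  have key : ∀ z, [a, a', c, c', z].Nodup →
      D.rot a a' c z + rect (D.E a z) 0 1 (D.E c c') v 0 =
        lc (D.E a a') 0 t (D.v z) + lc (D.E c c') v 0 (D.v z) + lc (D.E c a) 0 1 (D.v z) +
        (lc (D.E a c) 0 1 (D.E a a' t) - lc (D.E a a') 0 t (D.v c) -
          lc (D.E c c') v 0 (D.v a)) := by
    intro z hn
    simp at hn
    have haa : a ≠ a' := by grind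
    have hac : a ≠ c := by grind
    have haz : a ≠ z := by grind
    have hcc : c ≠ c' := by grind
    have ha'c : a' ≠ c := by grind
    have ha'z : a' ≠ z := by grind
    have hta : t ≠ 0 := fun e => by
      rw [e, D.zero haa] at h
      exact D.ne_vert hcc hac (by grind) hv h.symm
    rw [← uIcc_of_le zero_le_one] at ht
    have l1 := lam_trunc_left (D.cont a a') (D.cont a c) (D.germs haa hac ha'c) ht hta one_ne_zero
    have l2 := lam_trunc_right (D.cont a z) (D.cont a a') (D.germs haz haa ha'z.symm) ht hta
      one_ne_zero
    simp only [rot, l1, l2, rect]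
    simp only [lam, D.zero haa, D.zero haz, D.zero hcc, D.one haz, D.one hac,
      D.lc_rev_one hac, h]
    ring
  rw [key b (by simp at hn ⊢; grind), key w (by simp at hn ⊢; grind)]
  simp at hn
  have hwb : w ≠ b := by grind
  have hca : c ≠ a := by grind
  have haa : a ≠ a' := by grind
  have hcc : c ≠ c' := by grind
  simp only [rect, int, D.zero hwb, D.one hwb, D.zero hca, D.one hca, D.zero haa, D.zero hcc, h]
  ring

theorem rect_add_rect_eq_of_rot
    (H : ∀ x p q y, [x, p, q, y].Nodup → D2.rot x p q y = τ * D1.rot x p q y)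
    {a a' c c' w b : Fin n} (hn : [a, a', c, c', w, b].Nodup) {t₁ v₁ t₂ v₂ : ℝ}
    (ht₁ : t₁ ∈ Icc (0 : ℝ) 1) (hv₁ : v₁ ∈ Icc (0 : ℝ) 1) (ht₂ : t₂ ∈ Icc (0 : ℝ) 1)
    (hv₂ : v₂ ∈ Icc (0 : ℝ) 1) (h₁ : D1.E a a' t₁ = D1.E c c' v₁)
    (h₂ : D2.E a a' t₂ = D2.E c c' v₂) :
    rect (D2.E w b) 0 1 (D2.E a a') 0 t₂ + rect (D2.E w b) 0 1 (D2.E c c') v₂ 0 =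
      τ * (rect (D1.E w b) 0 1 (D1.E a a') 0 t₁ + rect (D1.E w b) 0 1 (D1.E c c') v₁ 0) := by
  have e1 := D1.rect_add_rect_add_int hn ht₁ hv₁ h₁
  have e2 := D2.rect_add_rect_add_int hn ht₂ hv₂ h₂
  have nb : [c, c', a, a', b].Nodup := by simp at hn ⊢; grind
  have nw : [c, c', a, a', w].Nodup := by simp at hn ⊢; grind
  rw [H a a' c b (by simp at hn ⊢; grind), H a a' c w (by simp at hn ⊢; grind),
    int_of_rot H (by simp at hn ⊢; grind),
    rect_eq_of_rot H nb hv₁ ht₁ hv₂ ht₂ h₁.symm h₂.symm,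
    rect_eq_of_rot H nw hv₁ ht₁ hv₂ ht₂ h₁.symm h₂.symm] at e2
  linear_combination e2 - τ * e1

end PlanarDrawing

namespace PlanarDrawing

variable {n : ℕ}

/-- Parameters of the three crossings of the edges `aa'`, `bb'`, `cc'`. -/
structure Crossings (D : PlanarDrawing n) (a a' b b' c c' : Fin n) (tb tc ua uc va vb : ℝ) :
    Prop where
  tb_mem : tb ∈ Icc (0 : ℝ) 1
  tc_mem : tc ∈ Icc (0 : ℝ) 1
  ua_mem : ua ∈ Icc (0 : ℝ) 1
  uc_mem : uc ∈ Icc (0 : ℝ) 1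
  va_mem : va ∈ Icc (0 : ℝ) 1
  vb_mem : vb ∈ Icc (0 : ℝ) 1
  ab : D.E a a' tb = D.E b b' ua
  ac : D.E a a' tc = D.E c c' va
  bc : D.E b b' uc = D.E c c' vb

section

variable {D : PlanarDrawing n} {a a' b b' c c' : Fin n} {tb tc ua uc va vb : ℝ}

/-- The winding number (times `2πi`) of the triangle formed by three crossing edges. -/
def wind (D : PlanarDrawing n) (a a' b b' c c' : Fin n) (tb tc ua uc va vb : ℝ) (z : ℂ) : ℂ :=
  lc (D.E a a') tb tc z + lc (D.E c c') va vb z + lc (D.E b b') uc ua z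

theorem Crossings.rev (h : Crossings D a a' b b' c c' tb tc ua uc va vb) (hb : b ≠ b') :
    Crossings D a a' b' b c c' tb tc (1 - ua) (1 - uc) va vb where
  __ := h
  ua_mem := one_sub_mem h.ua_mem
  uc_mem := one_sub_mem h.uc_mem
  ab := by rw [D.rev hb, sub_sub_cancel, h.ab]
  bc := by rw [D.rev hb, sub_sub_cancel, h.bc]

theorem Crossings.swap (h : Crossings D a a' b b' c c' tb tc ua uc va vb) :
    Crossings D a a' c c' b b' tc tb va vb ua uc :=
  ⟨h.tc_mem, h.tb_mem, h.va_mem, h.vb_mem, h.ua_mem, h.uc_mem, h.ac, h.ab, h.bc.symm⟩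

theorem wind_rev (hb : b ≠ b') (z : ℂ) :
    wind D a a' b' b c c' tb tc (1 - ua) (1 - uc) va vb z =
      wind D a a' b b' c c' tb tc ua uc va vb z := by
  rw [wind, wind, D.lc_rev hb, sub_sub_cancel, sub_sub_cancel]

theorem wind_swap (z : ℂ) : wind D a a' c c' b b' tc tb va vb ua uc z =
      -wind D a a' b b' c c' tb tc ua uc va vb z := by
  rw [wind, wind, lc_symm _ tb tc, lc_symm _ uc ua, lc_symm _ va vb]
  ring

theorem Crossings.wind_sub (h : Crossings D a a' b b' c c' tb tc ua uc va vb) {w x : Fin n}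
    (hwx : w ≠ x) : wind D a a' b b' c c' tb tc ua uc va vb (D.v x) -
      wind D a a' b b' c c' tb tc ua uc va vb (D.v w) =
    rect (D.E w x) 0 1 (D.E a a') tb tc + rect (D.E w x) 0 1 (D.E c c') va vb +
      rect (D.E w x) 0 1 (D.E b b') uc ua := by
  simp only [wind, rect, D.zero hwx, D.one hwx, h.ab, h.ac, h.bc]
  ring

end

variable {D1 D2 : PlanarDrawing n} {τ : ℂ}

theorem ne_of_order_flip (hτ : τ ≠ 0) {i j k l : Fin n} (hn : [i, j, k, l].Nodup)
    {p₁ q₁ p₂ q₂ : ℝ} (hp₁ : p₁ ∈ Icc (0 : ℝ) 1) (hq₁ : q₁ ∈ Icc (0 : ℝ) 1)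
    (hp₂ : p₂ ∈ Icc (0 : ℝ) 1) (hq₂ : q₂ ∈ Icc (0 : ℝ) 1) (h₁ : p₁ < q₁) (h₂ : q₂ < p₂)
    (hp₁' : ∀ s ∈ Icc (0 : ℝ) 1, D1.E i j s ≠ D1.E k l p₁)
    (hp₂' : ∀ s ∈ Icc (0 : ℝ) 1, D2.E i j s ≠ D2.E k l p₂)
    (hq₂' : ∀ s ∈ Icc (0 : ℝ) 1, D2.E i j s ≠ D2.E k l q₂)
    (hne : rect (D1.E i j) 0 1 (D1.E k l) p₁ q₁ ≠ 0)
    (hp : rect (D2.E i j) 0 1 (D2.E k l) p₂ 0 = τ * rect (D1.E i j) 0 1 (D1.E k l) p₁ 0) :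
    rect (D2.E i j) 0 1 (D2.E k l) q₂ 0 ≠ τ * rect (D1.E i j) 0 1 (D1.E k l) q₁ 0 := by
  intro hq
  have z0 : (0 : ℝ) ∈ Icc (0 : ℝ) 1 := ⟨le_rfl, zero_le_one⟩
  have z1 : (1 : ℝ) ∈ Icc (0 : ℝ) 1 := ⟨zero_le_one, le_rfl⟩
  have a1 := D1.rect_add_right i j hp₁ hq₁ z0 hn
  have a2 := D2.rect_add_right i j hq₂ hp₂ z0 hn
  have hne₂ : rect (D2.E i j) 0 1 (D2.E k l) q₂ p₂ ≠ 0 := by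
    have : rect (D2.E i j) 0 1 (D2.E k l) q₂ p₂ =
        -(τ * rect (D1.E i j) 0 1 (D1.E k l) p₁ q₁) := by
      linear_combination a2 + τ * a1 + hq - hp
    rw [this]
    exact neg_ne_zero.2 (mul_ne_zero hτ hne)
  have meets : ∀ {D : PlanarDrawing n} {c d : ℝ}, c ∈ Icc (0 : ℝ) 1 → d ∈ Icc (0 : ℝ) 1 →
      c ≤ d → rect (D.E i j) 0 1 (D.E k l) c d ≠ 0 →
      ∃ s ∈ Icc (0 : ℝ) 1, ∃ t ∈ Icc c d, D.E i j s = D.E k l t := by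
    intro D c d hc hd hcd h
    by_contra! hx
    exact h (D.rect_eq_zero _ _ _ _ z0 z1 hc hd fun s hs _ t _ ht =>
      hx s hs t (by rwa [uIcc_of_le hcd] at ht))
  obtain ⟨s₁, hs₁, m₁, hm₁, e₁⟩ := meets hp₁ hq₁ h₁.le hne
  obtain ⟨s₂, hs₂, m₂, hm₂, e₂⟩ := meets hq₂ hp₂ h₂.le hne₂
  have hm₁' : m₁ ∈ Icc (0 : ℝ) 1 := ⟨hp₁.1.trans hm₁.1, hm₁.2.trans hq₁.2⟩
  have hm₂' : m₂ ∈ Icc (0 : ℝ) 1 := ⟨hq₂.1.trans hm₂.1, hm₂.2.trans hp₂.2⟩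
  have r1 : rect (D1.E i j) 0 1 (D1.E k l) p₁ 0 = 0 := by
    refine D1.rect_eq_zero _ _ _ _ z0 z1 hp₁ z0 fun s hs _ t ht ht' e => ?_
    have := (D1.indep hn hs ht hs₁ hm₁' e e₁).2
    rw [uIcc_of_ge hp₁.1] at ht'
    exact hp₁' s₁ hs₁ (by rw [e₁, le_antisymm (this ▸ ht'.2) hm₁.1])
  rw [r1, mul_zero, rect_symm_right, neg_eq_zero, D2.rect_eq_int hn z0 hp₂
    (D2.ne_vert_of_edge hn) hp₂' hs₂ ⟨hm₂'.1, hm₂.2⟩ e₂] at hp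
  exact D2.int_ne_zero_of_rect_ne_zero hn hp₂ hq₂ hp₂' hq₂'
    (by rw [rect_symm_right]; exact neg_ne_zero.2 hne₂) hp

theorem int_ne_zero_of_wind_ne (hτ : τ ≠ 0)
    (H : ∀ x p q y, [x, p, q, y].Nodup → D2.rot x p q y = τ * D1.rot x p q y)
    {a a' b b' c c' w : Fin n} (hn : [a, a', b, b', c, c', w].Nodup)
    {tb₁ tc₁ ua₁ uc₁ va₁ vb₁ tb₂ tc₂ ua₂ uc₂ va₂ vb₂ : ℝ}
    (h₁ : Crossings D1 a a' b b' c c' tb₁ tc₁ ua₁ uc₁ va₁ vb₁)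
    (h₂ : Crossings D2 a a' b b' c c' tb₂ tc₂ ua₂ uc₂ va₂ vb₂)
    (hflip : (tb₁ < tc₁ ∧ tc₂ < tb₂) ∨ (tc₁ < tb₁ ∧ tb₂ < tc₂))
    (hw : wind D1 a a' b b' c c' tb₁ tc₁ ua₁ uc₁ va₁ vb₁ (D1.v b) ≠
      wind D1 a a' b b' c c' tb₁ tc₁ ua₁ uc₁ va₁ vb₁ (D1.v w)) : D1.int w b c c' ≠ 0 := by
  have z0 : (0 : ℝ) ∈ Icc (0 : ℝ) 1 := ⟨le_rfl, zero_le_one⟩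
  have z1 : (1 : ℝ) ∈ Icc (0 : ℝ) 1 := ⟨zero_le_one, le_rfl⟩
  have hn' := hn
  simp only [List.nodup_cons, List.mem_cons, List.not_mem_nil, or_false, not_or,
    not_false_eq_true, List.nodup_nil, and_true] at hn'
  obtain ⟨⟨aa', ab, ab', ac, ac', aw⟩, ⟨a'b, a'b', a'c, a'c', a'w⟩, ⟨bb', bc, bc', bw⟩,
    ⟨b'c, b'c', b'w⟩, ⟨cc', cw⟩, c'w⟩ := hn'
  have nabw : [a, a', b, b', w].Nodup := by simp; grind
  have ncbw : [c, c', b, b', w].Nodup := by simp; grind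
  have nba : [b, b', a, a'].Nodup := by simp; grind
  have nwba : [w, b, a, a'].Nodup := by simp; grind
  have nwbc : [w, b, c, c'].Nodup := by simp; grind
  have nacwb : [a, a', c, c', w, b].Nodup := by simp; grind
  have ncb : [b, b', c, c'].Nodup := by simp; grind
  have revw : ∀ {D : PlanarDrawing n} {x : ℂ}, (∀ s ∈ Icc (0 : ℝ) 1, D.E b w s ≠ x) →
      ∀ s ∈ Icc (0 : ℝ) 1, D.E w b s ≠ x := by
    intro D x h s hs
    rw [D.rev bw]
    exact h _ (one_sub_mem hs)
  have off_ab : ∀ {D : PlanarDrawing n} {tb tc ua uc va vb : ℝ},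
      Crossings D a a' b b' c c' tb tc ua uc va vb →
      ∀ s ∈ Icc (0 : ℝ) 1, D.E w b s ≠ D.E a a' tb := fun h =>
    revw (ne_of_crossing _ nabw h.tb_mem h.ua_mem h.ab)
  have off_cb : ∀ {D : PlanarDrawing n} {tb tc ua uc va vb : ℝ},
      Crossings D a a' b b' c c' tb tc ua uc va vb →
      ∀ s ∈ Icc (0 : ℝ) 1, D.E w b s ≠ D.E c c' vb := fun h =>
    revw (ne_of_crossing _ ncbw h.vb_mem h.uc_mem h.bc.symm)
  have off_ac : ∀ {D : PlanarDrawing n} {tb tc ua uc va vb : ℝ},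
      Crossings D a a' b b' c c' tb tc ua uc va vb →
      ∀ s ∈ Icc (0 : ℝ) 1, D.E w b s ≠ D.E a a' tc := fun h s hs =>
    PlanarDrawing.triple _ nacwb h.tc_mem h.va_mem hs h.ac
  have off_ca : ∀ {D : PlanarDrawing n} {tb tc ua uc va vb : ℝ},
      Crossings D a a' b b' c c' tb tc ua uc va vb →
      ∀ s ∈ Icc (0 : ℝ) 1, D.E w b s ≠ D.E c c' va := fun h s hs => by
    rw [← h.ac]; exact off_ac h s hs
  have third : rect (D1.E w b) 0 1 (D1.E b b') uc₁ ua₁ = 0 := by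
    refine D1.rect_eq_zero _ _ _ _ z0 z1 h₁.uc_mem h₁.ua_mem fun s hs _ t ht ht' e => ?_
    rw [D1.rev bw] at e
    have h0 := (D1.adj bw bb' (Ne.symm b'w) (one_sub_mem hs) ht e).2
    have p1 := (D1.mem_Ioo ncb h₁.uc_mem h₁.vb_mem h₁.bc).1
    have p2 := (D1.mem_Ioo nba h₁.ua_mem h₁.tb_mem h₁.ab.symm).1
    rcases mem_uIcc.1 ht' with h | h <;> linarith [h.1]
  have hsub := h₁.wind_sub (Ne.symm bw)
  rw [third, add_zero] at hsub
  by_cases hg : rect (D1.E w b) 0 1 (D1.E c c') va₁ vb₁ = 0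
  swap
  · exact D1.int_ne_zero_of_rect_ne_zero nwbc h₁.va_mem h₁.vb_mem (off_ca h₁) (off_cb h₁) hg
  have he : rect (D1.E w b) 0 1 (D1.E a a') tb₁ tc₁ ≠ 0 := fun h =>
    hw (sub_eq_zero.1 (by rw [hsub, h, hg, add_zero]))
  have hb : rect (D2.E w b) 0 1 (D2.E a a') tb₂ 0 = τ * rect (D1.E w b) 0 1 (D1.E a a') tb₁ 0 := by
    have := rect_eq_of_rot H nabw h₁.tb_mem h₁.ua_mem h₂.tb_mem h₂.ua_mem h₁.ab h₂.ab
    rw [D1.rect_rev_left_one bw, D2.rect_rev_left_one bw, this]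
    ring
  have hc : rect (D2.E w b) 0 1 (D2.E a a') tc₂ 0 ≠
      τ * rect (D1.E w b) 0 1 (D1.E a a') tc₁ 0 := by
    rcases hflip with hf | hf
    · exact ne_of_order_flip hτ nwba h₁.tb_mem h₁.tc_mem h₂.tb_mem h₂.tc_mem hf.1 hf.2 (off_ab h₁)
        (off_ab h₂) (off_ac h₂) he hb
    · exact fun h => ne_of_order_flip hτ nwba h₁.tc_mem h₁.tb_mem h₂.tc_mem h₂.tb_mem hf.1 hf.2
        (off_ac h₁) (off_ac h₂) (off_ab h₂)
        (by rw [rect_symm_right]; exact neg_ne_zero.2 he) h hb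
  refine int_ne_zero_of_rect_sub_ne_zero H nwbc h₁.va_mem h₂.va_mem (off_ca h₁) (off_ca h₂)
    fun h0 => hc ?_
  have := rect_add_rect_eq_of_rot H nacwb h₁.tc_mem h₁.va_mem h₂.tc_mem h₂.va_mem h₁.ac h₂.ac
  rw [rect_symm_right _ _ _ _ tc₁ 0, rect_symm_right _ _ _ _ tc₂ 0] at this
  linear_combination h0 - this

theorem false_of_wind_ne (hn5 : 5 ≤ n)
    (H : ∀ x, ∃ τ : ℂ, ∀ p q y, [x, p, q, y].Nodup → D2.rot x p q y = τ * D1.rot x p q y)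
    {a a' b b' c c' w : Fin n} (hn : [a, a', b, b', c, c', w].Nodup)
    {tb₁ tc₁ ua₁ uc₁ va₁ vb₁ tb₂ tc₂ ua₂ uc₂ va₂ vb₂ : ℝ}
    (h₁ : Crossings D1 a a' b b' c c' tb₁ tc₁ ua₁ uc₁ va₁ vb₁)
    (h₂ : Crossings D2 a a' b b' c c' tb₂ tc₂ ua₂ uc₂ va₂ vb₂)
    (hflip : (tb₁ < tc₁ ∧ tc₂ < tb₂) ∨ (tc₁ < tb₁ ∧ tb₂ < tc₂))
    (hw : ∀ x ∈ ({b, b', c, c'} : Set (Fin n)),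
      wind D1 a a' b b' c c' tb₁ tc₁ ua₁ uc₁ va₁ vb₁ (D1.v x) ≠
        wind D1 a a' b b' c c' tb₁ tc₁ ua₁ uc₁ va₁ vb₁ (D1.v w)) : False := by
  obtain ⟨τ, hτ, H⟩ := exists_global_sign hn5 H
  have hn' := hn
  simp only [List.nodup_cons, List.mem_cons, List.not_mem_nil, or_false, not_or,
    not_false_eq_true, List.nodup_nil, and_true] at hn'
  have bb' : b ≠ b' := by grind
  have cc' : c ≠ c' := by grind
  have nb : [a, a', b', b, c, c', w].Nodup := by simp; grind
  have nc : [a, a', c, c', b, b', w].Nodup := by simp; grind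
  have nc' : [a, a', c', c, b, b', w].Nodup := by simp; grind
  have nw : [w, b, b', c, c'].Nodup := by simp; grind
  have flip' := hflip.symm
  refine D1.not_all_int_ne_zero nw h₁.uc_mem h₁.vb_mem h₁.bc ?_ ?_ ?_ ?_
  · exact int_ne_zero_of_wind_ne hτ H hn h₁ h₂ hflip (hw b (by simp))
  · exact int_ne_zero_of_wind_ne hτ H nb (h₁.rev bb') (h₂.rev bb') hflip
      (by simpa only [wind_rev bb'] using hw b' (by simp))
  · exact int_ne_zero_of_wind_ne hτ H nc h₁.swap h₂.swap flip'
      (by rw [wind_swap (z := D1.v c), wind_swap (z := D1.v w)]; exact neg_injective.ne (hw c (by simp)))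
  · exact int_ne_zero_of_wind_ne hτ H nc' (h₁.swap.rev cc') (h₂.swap.rev cc') flip'
      (by
        rw [wind_rev cc', wind_rev cc', wind_swap (z := D1.v c'), wind_swap (z := D1.v w)]
        exact neg_injective.ne (hw c' (by simp)))

end PlanarDrawing

theorem exists_chart (N : Sph) :
    ∃ φ : OpenPartialHomeomorph Sph ℂ, φ.source = {N}ᶜ ∧ φ.target = univ := by
  have : Fact (Module.finrank ℝ (EuclideanSpace ℝ (Fin 3)) = 2 + 1) := ⟨by simp⟩
  refine ⟨(stereographic' 2 N).transHomeomorph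
    Complex.orthonormalBasisOneI.repr.symm.toHomeomorph, ?_, ?_⟩
  · simp
  · simp

/-- An injective path in the sphere has empty interior. -/
theorem interior_range_eq_empty {x y : Sph} (f : Path x y) (hf : Function.Injective f) :
    interior (range f) = ∅ := by
  by_contra hne
  obtain ⟨p, hp⟩ := nonempty_iff_ne_empty.2 hne
  obtain ⟨φ, hs, ht⟩ := exists_chart (-p)
  have hps : p ∈ φ.source := by
    rw [hs]
    intro h
    exact ne_neg_of_mem_unit_sphere ℝ p h
  have hφ : Continuous φ.symm := by
    rw [← continuousOn_univ, ← ht]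
    exact φ.continuousOn_symm
  obtain ⟨r, hr, hball⟩ := Metric.mem_nhds_iff.1
    (hφ.continuousAt.preimage_mem_nhds (x := φ p) (t := interior (range f))
      (by rw [φ.left_inv hps]; exact isOpen_interior.mem_nhds hp))
  let β := OpenPartialHomeomorph.univBall (φ p) r
  have hβ : ∀ z, β z ∈ Metric.ball (φ p) r := fun z => by
    have := β.map_source (x := z) (by simp [β])
    rwa [OpenPartialHomeomorph.univBall_target _ hr] at this
  let ψ : ℂ → Sph := fun z => φ.symm (β z)
  have hψ : Continuous ψ := hφ.comp (OpenPartialHomeomorph.continuous_univBall _ _)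
  have hψi : Function.Injective ψ := fun z w h => by
    have h1 : β z = β w := φ.symm.injOn (by simp [ht]) (by simp [ht]) h
    exact β.injOn (by simp [β]) (by simp [β]) h1
  have hψr : ∀ z, ψ z ∈ range f := fun z => interior_subset (hball (hβ z))
  have hemb : Topology.IsClosedEmbedding f := f.continuous.isClosedEmbedding hf
  have key : ∀ t ∈ f ⁻¹' range ψ, IsPreconnected (f ⁻¹' range ψ \ {t}) := by
    rintro t ⟨z, hz⟩
    rw [← hemb.isInducing.isPreconnected_image]
    have : f '' (f ⁻¹' range ψ \ {t}) = ψ '' {z}ᶜ := by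
      ext q
      constructor
      · rintro ⟨s, ⟨⟨w, hw⟩, hst⟩, rfl⟩
        refine ⟨w, fun h => hst ?_, hw⟩
        rw [mem_singleton_iff.1 h, hz] at hw
        exact hf hw.symm
      · rintro ⟨w, hw, rfl⟩
        obtain ⟨s, hs⟩ := hψr w
        refine ⟨s, ⟨⟨w, hs.symm⟩, fun h => hw ?_⟩, hs⟩
        rw [mem_singleton_iff.1 h, ← hz] at hs
        exact hψi hs.symm
    rw [this]
    exact (isConnected_compl_singleton_of_one_lt_rank (by simp) z).isPreconnected.image _
      hψ.continuousOn
  have hinf : (f ⁻¹' range ψ).Infinite := by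
    refine Infinite.of_image f ?_
    rw [image_preimage_eq_of_subset (range_subset_iff.2 hψr)]
    exact infinite_range_of_injective hψi
  obtain ⟨S, hS, hcard⟩ := hinf.exists_subset_card_eq 3
  let e := S.orderEmbOfFin hcard
  have he : ∀ i, e i ∈ f ⁻¹' range ψ := fun i => hS (S.orderEmbOfFin_mem hcard i)
  have h01 : e 0 < e 1 := e.strictMono (by decide)
  have h12 : e 1 < e 2 := e.strictMono (by decide)
  have := (key _ (he 1)).ordConnected.out ⟨he 0, h01.ne⟩ ⟨he 2, h12.ne'⟩ ⟨h01.le, h12.le⟩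
  exact this.2 rfl

theorem frontier_connectedComponentIn_subset {X : Type*} [TopologicalSpace X]
    [LocallyConnectedSpace X] {F : Set X} (hF : IsOpen F) (x : X) :
    frontier (connectedComponentIn F x) ⊆ Fᶜ := by
  intro z hz hzF
  rw [hF.connectedComponentIn.frontier_eq] at hz
  obtain ⟨y, hy, hy'⟩ := mem_closure_iff.1 hz.1 _ hF.connectedComponentIn
    (mem_connectedComponentIn hzF)
  apply hz.2
  rw [connectedComponentIn_eq hy', ← connectedComponentIn_eq hy]
  exact mem_connectedComponentIn hzF

namespace SphereDrawing

variable {n : ℕ} {D : SphereDrawing n}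

theorem exists_notMem_edges (D : SphereDrawing n) :
    ∃ N : Sph, ∀ i j (h : i ≠ j) t, D.edge i j h t ≠ N := by
  have : Dense (⋂ s : {s : Fin n × Fin n // s.1 ≠ s.2}, (range (D.edge s.1.1 s.1.2 s.2))ᶜ) := by
    refine dense_iInter_of_isOpen (fun s => ?_) fun s => ?_
    · exact (isCompact_range (D.edge _ _ s.2).continuous).isClosed.isOpen_compl
    · exact interior_eq_empty_iff_dense_compl.1 (interior_range_eq_empty _ (D.edge_inj _ _ _))
  have hne : Nonempty Sph := (NormedSpace.sphere_nonempty.2 zero_le_one).to_subtype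
  obtain ⟨N, hN⟩ := Dense.nonempty this
  exact ⟨N, fun i j h t e => mem_iInter.1 hN ⟨(i, j), h⟩ ⟨t, e⟩⟩

theorem eq_of_edge_eq_vert {i j k : Fin n} (h : i ≠ j) {t : I} (e : D.edge i j h t = D.vert k) :
    (t = 0 ∧ k = i) ∨ (t = 1 ∧ k = j) := by
  have : D.edge i j h t ∈ range (D.edge i j h) ∩ range D.vert := ⟨⟨t, rfl⟩, ⟨k, e.symm⟩⟩
  rw [D.edge_vert] at this
  rcases this with h' | h'
  · refine Or.inl ⟨D.edge_inj _ _ h ?_, D.vert_inj ?_⟩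
    · rw [h', Path.source]
    · rw [← e, h']
  · refine Or.inr ⟨D.edge_inj _ _ h ?_, D.vert_inj ?_⟩
    · rw [h', Path.target]
    · rw [← e, h']

theorem edge_mem_arc {i j : Fin n} (h : i ≠ j) (t : I) : D.edge i j h t ∈ D.arc i j :=
  mem_iUnion.2 ⟨h, t, rfl⟩

theorem arc_comm (D : SphereDrawing n) (i j : Fin n) : D.arc i j = D.arc j i := by
  have : ∀ i j, D.arc i j ⊆ D.arc j i := by
    intro i j p hp
    obtain ⟨h, t, rfl⟩ := mem_iUnion.1 hp
    refine mem_iUnion.2 ⟨h.symm, σ t, ?_⟩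
    rw [D.edge_symm i j h, Path.symm_apply, Function.comp_apply, unitInterval.symm_symm]
  exact (this i j).antisymm (this j i)

theorem IsGood.eq_zero_of_edge_eq (hD : D.IsGood) {i j k : Fin n} (hij : i ≠ j) (hik : i ≠ k)
    (hjk : j ≠ k) {s t : I} (e : D.edge i j hij s = D.edge i k hik t) : s = 0 ∧ t = 0 := by
  by_cases hv : D.edge i j hij s ∈ range D.vert
  · obtain ⟨m, hm⟩ := hv
    have h1 := eq_of_edge_eq_vert hij hm.symm
    have h2 := eq_of_edge_eq_vert hik (e ▸ hm.symm)
    grind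
  · have : D.edge i j hij s ∈ D.inner i j ∩ D.inner i k :=
      ⟨⟨edge_mem_arc _ _, hv⟩, ⟨e ▸ edge_mem_arc _ _, hv⟩⟩
    rw [hD.adj i j k hjk] at this
    exact this.elim

theorem notMem_vert_of_edge_eq {i j k l : Fin n} (hn : [i, j, k, l].Nodup) (hij : i ≠ j)
    (hkl : k ≠ l) {s t : I} (e : D.edge i j hij s = D.edge k l hkl t) :
    D.edge i j hij s ∉ range D.vert := by
  rintro ⟨m, hm⟩
  have h1 := eq_of_edge_eq_vert hij hm.symm
  have h2 := eq_of_edge_eq_vert hkl (e ▸ hm.symm)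
  simp at hn
  grind

theorem IsGood.eq_of_edge_eq (hD : D.IsGood) {i j k l : Fin n} (hn : [i, j, k, l].Nodup)
    (hij : i ≠ j) (hkl : k ≠ l) {s t s' t' : I} (e : D.edge i j hij s = D.edge k l hkl t)
    (e' : D.edge i j hij s' = D.edge k l hkl t') : s = s' ∧ t = t' := by
  have hv := notMem_vert_of_edge_eq hn hij hkl e
  have hv' := notMem_vert_of_edge_eq hn hij hkl e'
  have h : D.edge i j hij s = D.edge i j hij s' := hD.indep i j k l hn
    ⟨⟨edge_mem_arc _ _, hv⟩, ⟨e ▸ edge_mem_arc _ _, hv⟩⟩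
    ⟨⟨edge_mem_arc _ _, hv'⟩, ⟨e' ▸ edge_mem_arc _ _, hv'⟩⟩
  exact ⟨D.edge_inj _ _ _ h, D.edge_inj _ _ _ (by rw [← e, ← e', h])⟩

theorem IsGood.edge_ne_of_edge_eq (hD : D.IsGood) {i j k l p q : Fin n}
    (hn : [i, j, k, l, p, q].Nodup) (hij : i ≠ j) (hkl : k ≠ l) (hpq : p ≠ q) {s t r : I}
    (e : D.edge i j hij s = D.edge k l hkl t) : D.edge p q hpq r ≠ D.edge i j hij s := by
  intro e'
  have hv := notMem_vert_of_edge_eq (by simp at hn ⊢; grind) hij hkl e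
  have hc := hD.no_triple _ hv
  let o : Fin n → Fin n → Fin n × Fin n := fun i j => (min i j, max i j)
  have hmem : ∀ i j (h : i ≠ j) x y, D.edge i j h x = y →
      o i j ∈ {s : Fin n × Fin n | s.1 < s.2 ∧ y ∈ D.arc s.1 s.2} := by
    rintro i j h x y rfl
    rcases lt_or_gt_of_ne h with h' | h'
    · simp only [o, min_eq_left h'.le, max_eq_right h'.le]
      exact ⟨h', edge_mem_arc _ _⟩
    · simp only [o, min_eq_right h'.le, max_eq_left h'.le]
      exact ⟨h', D.arc_comm i j ▸ edge_mem_arc _ _⟩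
  have h3 : ({o i j, o k l, o p q} : Set (Fin n × Fin n)).encard = 3 := by
    rw [Set.encard_eq_three]
    refine ⟨_, _, _, ?_, ?_, ?_, rfl⟩ <;> simp only [o, ne_eq, Prod.mk.injEq] <;>
      simp at hn <;> grind
  have hsub : ({o i j, o k l, o p q} : Set (Fin n × Fin n)) ⊆
      {x : Fin n × Fin n | x.1 < x.2 ∧ D.edge i j hij s ∈ D.arc x.1 x.2} := by
    rintro x (rfl | rfl | rfl)
    · exact hmem _ _ hij _ _ rfl
    · exact hmem _ _ hkl _ _ e.symm
    · exact hmem _ _ hpq _ _ e'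
  have := (h3 ▸ encard_le_encard hsub).trans hc
  exact absurd this (by decide)

/-- The image of a good drawing under a planar chart whose domain contains all the edges. -/
def toPlanar (D : SphereDrawing n) (hD : D.IsGood) (φ : OpenPartialHomeomorph Sph ℂ)
    (hφ : ∀ i j h t, D.edge i j h t ∈ φ.source) : PlanarDrawing n where
  v i := φ (D.vert i)
  E i j t := if h : i ≠ j then φ (D.edge i j h (projIcc 0 1 zero_le_one t)) else φ (D.vert i)
  cont i j := by
    by_cases h : i ≠ j
    · simp only [dif_pos h]
      exact φ.continuousOn.comp_continuous ((D.edge i j h).continuous.comp continuous_projIcc)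
        fun t => hφ _ _ _ _
    · simp only [dif_neg h]
      exact continuous_const
  zero h := by simp [h]
  rev {i j} h t := by
    simp only [dif_pos h, dif_pos h.symm, D.edge_symm i j h, Path.symm_apply]
    have : σ (projIcc 0 1 zero_le_one t) = projIcc 0 1 zero_le_one (1 - t) := by
      ext
      simp [coe_projIcc]
    rw [Function.comp_apply, this]
  inj {i j} h := by
    intro s hs t ht e
    simp only [dif_pos h, projIcc_of_mem zero_le_one hs, projIcc_of_mem zero_le_one ht] at e
    simpa using D.edge_inj _ _ h (φ.injOn (hφ _ _ _ _) (hφ _ _ _ _) e)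
  vert {i j k} h t ht e := by
    simp only [dif_pos h, projIcc_of_mem zero_le_one ht] at e
    have hk : D.vert k ∈ φ.source := by
      by_cases hki : k = i
      · subst hki; simpa using hφ k j h 0
      · simpa using hφ k i hki 0
    have := eq_of_edge_eq_vert h (φ.injOn (hφ _ _ _ _) hk e)
    simpa [Subtype.ext_iff] using this
  adj {i j k} hij hik hjk s t hs ht e := by
    simp only [dif_pos hij, dif_pos hik, projIcc_of_mem zero_le_one hs,
      projIcc_of_mem zero_le_one ht] at e
    have := hD.eq_zero_of_edge_eq hij hik hjk (φ.injOn (hφ _ _ _ _) (hφ _ _ _ _) e)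
    simpa [Subtype.ext_iff] using this
  indep {i j k l} hn s t s' t' hs ht hs' ht' e e' := by
    have hij : i ≠ j := by simp at hn; grind
    have hkl : k ≠ l := by simp at hn; grind
    simp only [dif_pos hij, dif_pos hkl, projIcc_of_mem zero_le_one hs,
      projIcc_of_mem zero_le_one ht, projIcc_of_mem zero_le_one hs',
      projIcc_of_mem zero_le_one ht'] at e e'
    have := hD.eq_of_edge_eq hn hij hkl (φ.injOn (hφ _ _ _ _) (hφ _ _ _ _) e)
      (φ.injOn (hφ _ _ _ _) (hφ _ _ _ _) e')
    simpa [Subtype.ext_iff] using this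
  triple {i j k l p q} hn s t r hs ht hr e e' := by
    have hij : i ≠ j := by simp at hn; grind
    have hkl : k ≠ l := by simp at hn; grind
    have hpq : p ≠ q := by simp at hn; grind
    simp only [dif_pos hij, dif_pos hkl, dif_pos hpq, projIcc_of_mem zero_le_one hs,
      projIcc_of_mem zero_le_one ht, projIcc_of_mem zero_le_one hr] at e e'
    exact hD.edge_ne_of_edge_eq hn hij hkl hpq (φ.injOn (hφ _ _ _ _) (hφ _ _ _ _) e)
      (φ.injOn (hφ _ _ _ _) (hφ _ _ _ _) e')

theorem toPlanar_E (hD : D.IsGood) {φ : OpenPartialHomeomorph Sph ℂ}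
    (hφ : ∀ i j h t, D.edge i j h t ∈ φ.source) {i j : Fin n} (h : i ≠ j) (t : I) :
    (D.toPlanar hD φ hφ).E i j t = φ (D.edge i j h t) := by
  simp [toPlanar, h]

end SphereDrawing

theorem exists_affine_of_mem_uIcc {p q x : ℝ} (hx : x ∈ uIcc p q) :
    ∃ s ∈ Icc (0 : ℝ) 1, p + (q - p) * s = x := by
  rw [← segment_eq_uIcc, segment_eq_image'] at hx
  obtain ⟨s, hs, rfl⟩ := hx
  exact ⟨s, hs, by simp [mul_comm]⟩

theorem affine_mem_of_ordConnected {J : Set ℝ} (hJ : J.OrdConnected) {p q s : ℝ} (hp : p ∈ J)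
    (hq : q ∈ J) (hs : s ∈ Icc (0 : ℝ) 1) : p + (q - p) * s ∈ J := by
  refine hJ.uIcc_subset hp hq ?_
  rw [← segment_eq_uIcc, segment_eq_image']
  exact ⟨s, hs, by simp [mul_comm]⟩

namespace PlanarDrawing

variable {n : ℕ} {D : PlanarDrawing n} {a a' b b' c c' : Fin n} {tb tc ua uc va vb : ℝ}

theorem ne_vert_of_mem_Ioo {i j : Fin n} (h : i ≠ j) {t : ℝ} (ht : t ∈ Ioo (0 : ℝ) 1)
    (k : Fin n) : D.E i j t ≠ D.v k := fun e =>
  (D.vert h (Ioo_subset_Icc_self ht) e).elim (fun h => ht.1.ne' h.1) (fun h => ht.2.ne h.1)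

theorem Crossings.ne (h : Crossings D a a' b b' c c' tb tc ua uc va vb)
    (hn : [a, a', b, b', c, c'].Nodup) : tb ≠ tc ∧ ua ≠ uc ∧ va ≠ vb := by
  refine ⟨?_, ?_, ?_⟩
  · rintro rfl
    exact D.triple hn h.tb_mem h.ua_mem h.va_mem h.ab h.ac.symm
  · rintro rfl
    exact D.triple hn h.tb_mem h.ua_mem h.vb_mem h.ab (h.bc.symm.trans h.ab.symm)
  · rintro rfl
    exact D.triple (i := a) (j := a') (k := c) (l := c') (p := b) (q := b')
      (by simp at hn ⊢; grind) h.tc_mem h.va_mem h.uc_mem h.ac (h.bc.trans h.ac.symm)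

/-- The boundary of the triangle formed by three crossing edges, side by side. -/
def side (D : PlanarDrawing n) (a a' b b' c c' : Fin n) (tb tc ua uc va vb : ℝ) :
    Fin 3 → ℝ → ℂ :=
  ![fun s => D.E a a' (tb + (tc - tb) * s), fun s => D.E c c' (va + (vb - va) * s),
    fun s => D.E b b' (uc + (ua - uc) * s)]

theorem Crossings.closedTriangle (h : Crossings D a a' b b' c c' tb tc ua uc va vb)
    (hn : [a, a', b, b', c, c'].Nodup) :
    ClosedTriangle (side D a a' b b' c c' tb tc ua uc va vb) := by
  obtain ⟨nt, nu, nv⟩ := h.ne hn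
  have hm : ∀ {p q s : ℝ}, p ∈ Icc (0 : ℝ) 1 → q ∈ Icc (0 : ℝ) 1 → s ∈ Icc (0 : ℝ) 1 →
      p + (q - p) * s ∈ Icc (0 : ℝ) 1 := affine_mem_of_ordConnected ordConnected_Icc
  have cancel : ∀ {p q s t : ℝ}, p ≠ q → p + (q - p) * s = p + (q - p) * t → s = t := by
    intro p q s t hpq e
    exact mul_left_cancel₀ (sub_ne_zero.2 hpq.symm) (add_left_cancel e)
  have one : ∀ {p q s : ℝ}, p ≠ q → p + (q - p) * s = q → s = 1 := fun hpq e =>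
    cancel hpq (by rw [e]; ring)
  have zero : ∀ {p q s : ℝ}, p ≠ q → p + (q - p) * s = p → s = 0 := fun hpq e =>
    cancel hpq (by rw [e]; ring)
  have haa : a ≠ a' := by simp at hn; grind
  have hbb : b ≠ b' := by simp at hn; grind
  have hcc : c ≠ c' := by simp at hn; grind
  have nab : [a, a', b, b'].Nodup := by simp at hn ⊢; grind
  have nac : [a, a', c, c'].Nodup := by simp at hn ⊢; grind
  have nbc : [b, b', c, c'].Nodup := by simp at hn ⊢; grind
  have h01 : ∀ s ∈ Icc (0 : ℝ) 1, ∀ t ∈ Icc (0 : ℝ) 1,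
      D.E a a' (tb + (tc - tb) * s) = D.E c c' (va + (vb - va) * t) → s = 1 ∧ t = 0 := by
    intro s hs t ht e
    obtain ⟨e1, e2⟩ := D.indep nac (hm h.tb_mem h.tc_mem hs) (hm h.va_mem h.vb_mem ht)
      h.tc_mem h.va_mem e h.ac
    exact ⟨one nt e1, zero nv e2⟩
  have h12 : ∀ s ∈ Icc (0 : ℝ) 1, ∀ t ∈ Icc (0 : ℝ) 1,
      D.E c c' (va + (vb - va) * s) = D.E b b' (uc + (ua - uc) * t) → s = 1 ∧ t = 0 := by
    intro s hs t ht e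
    obtain ⟨e1, e2⟩ := D.indep nbc (hm h.uc_mem h.ua_mem ht) (hm h.va_mem h.vb_mem hs)
      h.uc_mem h.vb_mem e.symm h.bc
    exact ⟨one nv e2, zero nu.symm e1⟩
  have h20 : ∀ s ∈ Icc (0 : ℝ) 1, ∀ t ∈ Icc (0 : ℝ) 1,
      D.E b b' (uc + (ua - uc) * s) = D.E a a' (tb + (tc - tb) * t) → s = 1 ∧ t = 0 := by
    intro s hs t ht e
    obtain ⟨e1, e2⟩ := D.indep nab (hm h.tb_mem h.tc_mem ht) (hm h.uc_mem h.ua_mem hs)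
      h.tb_mem h.ua_mem e.symm h.ab
    exact ⟨one nu.symm e2, zero nt e1⟩
  refine ⟨?_, ?_, ?_⟩
  · intro k
    fin_cases k <;> exact (D.cont _ _).comp (by fun_prop)
  · intro k
    fin_cases k
    · simpa [side] using h.ac
    · simpa [side] using h.bc.symm
    · simpa [side] using h.ab.symm
  · intro j k s hs t ht e
    fin_cases j <;> fin_cases k
    · exact Or.inl ⟨rfl, cancel nt
        (D.inj haa (hm h.tb_mem h.tc_mem hs) (hm h.tb_mem h.tc_mem ht) e)⟩
    · exact Or.inr (Or.inl ⟨rfl, h01 s hs t ht e⟩)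
    · exact Or.inr (Or.inr ⟨rfl, (h20 t ht s hs e.symm).symm⟩)
    · exact Or.inr (Or.inr ⟨rfl, (h01 t ht s hs e.symm).symm⟩)
    · exact Or.inl ⟨rfl, cancel nv
        (D.inj hcc (hm h.va_mem h.vb_mem hs) (hm h.va_mem h.vb_mem ht) e)⟩
    · exact Or.inr (Or.inl ⟨rfl, h12 s hs t ht e⟩)
    · exact Or.inr (Or.inl ⟨rfl, h20 s hs t ht e⟩)
    · exact Or.inr (Or.inr ⟨rfl, (h12 t ht s hs e.symm).symm⟩)
    · exact Or.inl ⟨rfl, cancel nu.symm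
        (D.inj hbb (hm h.uc_mem h.ua_mem hs) (hm h.uc_mem h.ua_mem ht) e)⟩

/-- Two vertices separated by the triangle of three crossing edges have different winding. -/
theorem Crossings.wind_ne (h : Crossings D a a' b b' c c' tb tc ua uc va vb)
    (hn : [a, a', b, b', c, c'].Nodup) {U : Set ℂ} (hUo : IsOpen U)
    (hU : frontier U ⊆ D.E a a' '' uIcc tb tc ∪ D.E b b' '' uIcc ua uc ∪ D.E c c' '' uIcc va vb)
    (hb : Bornology.IsBounded U ∨ Bornology.IsBounded Uᶜ) {w x : Fin n} (hw : D.v w ∈ U)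
    (hx : D.v x ∉ closure U) :
    wind D a a' b b' c c' tb tc ua uc va vb (D.v w) ≠
      wind D a a' b b' c c' tb tc ua uc va vb (D.v x) := by
  obtain ⟨nt, nu, nv⟩ := h.ne hn
  have haa : a ≠ a' := by simp at hn; grind
  have hbb : b ≠ b' := by simp at hn; grind
  have hcc : c ≠ c' := by simp at hn; grind
  have nab : [a, a', b, b'].Nodup := by simp at hn ⊢; grind
  have nac : [a, a', c, c'].Nodup := by simp at hn ⊢; grind
  have nbc : [b, b', c, c'].Nodup := by simp at hn ⊢; grind
  have nba : [b, b', a, a'].Nodup := by simp at hn ⊢; grind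
  have nca : [c, c', a, a'].Nodup := by simp at hn ⊢; grind
  have ncb : [c, c', b, b'].Nodup := by simp at hn ⊢; grind
  have hv : ∀ y k, ∀ t ∈ Icc (0 : ℝ) 1,
      side D a a' b b' c c' tb tc ua uc va vb k t ≠ D.v y := by
    intro y k t ht
    have hI : ∀ {p q : ℝ}, p ∈ Ioo (0 : ℝ) 1 → q ∈ Ioo (0 : ℝ) 1 →
      p + (q - p) * t ∈ Ioo (0 : ℝ) 1 := fun hp hq =>
        affine_mem_of_ordConnected ordConnected_Ioo hp hq ht
    fin_cases k
    · exact ne_vert_of_mem_Ioo haa (hI (D.mem_Ioo nab h.tb_mem h.ua_mem h.ab)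
        (D.mem_Ioo nac h.tc_mem h.va_mem h.ac)) y
    · exact ne_vert_of_mem_Ioo hcc (hI (D.mem_Ioo nca h.va_mem h.tc_mem h.ac.symm)
        (D.mem_Ioo ncb h.vb_mem h.uc_mem h.bc.symm)) y
    · exact ne_vert_of_mem_Ioo hbb (hI (D.mem_Ioo nbc h.uc_mem h.vb_mem h.bc)
        (D.mem_Ioo nba h.ua_mem h.tb_mem h.ab.symm)) y
  have hsum : ∀ z, ∑ k, _root_.lc (side D a a' b b' c c' tb tc ua uc va vb k) 0 1 z =
      wind D a a' b b' c c' tb tc ua uc va vb z := by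
    intro z
    simp only [Fin.sum_univ_three, side, wind, Matrix.cons_val_zero, Matrix.cons_val_one,
      Matrix.cons_val]
    rw [lc_affine _ _ (sub_ne_zero.2 nt.symm), lc_affine _ _ (sub_ne_zero.2 nv.symm),
      lc_affine _ _ (sub_ne_zero.2 nu)]
    simp
  rw [← hsum, ← hsum]
  refine (h.closedTriangle hn).winding_ne (hv w) (hv x) hUo (hU.trans ?_) hb hw hx
  rintro z ((⟨t, ht, rfl⟩ | ⟨t, ht, rfl⟩) | ⟨t, ht, rfl⟩)
  · obtain ⟨s, hs, rfl⟩ := exists_affine_of_mem_uIcc ht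
    exact mem_iUnion.2 ⟨0, s, hs, rfl⟩
  · obtain ⟨s, hs, rfl⟩ := exists_affine_of_mem_uIcc (uIcc_comm ua uc ▸ ht)
    exact mem_iUnion.2 ⟨2, s, hs, rfl⟩
  · obtain ⟨s, hs, rfl⟩ := exists_affine_of_mem_uIcc ht
    exact mem_iUnion.2 ⟨1, s, hs, rfl⟩

end PlanarDrawing

/-- Under a planar chart, a set of the sphere whose boundary misses the removed point becomes
bounded or co-bounded. -/
theorem isBounded_chart_preimage {N : Sph} {φ : OpenPartialHomeomorph Sph ℂ}
    (hs : φ.source = {N}ᶜ) (ht : φ.target = univ) {U : Set Sph} (hU : IsOpen U)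
    (hN : N ∉ frontier U) :
    Bornology.IsBounded (φ.symm ⁻¹' U) ∨ Bornology.IsBounded (φ.symm ⁻¹' U)ᶜ := by
  have key : ∀ K : Set Sph, IsClosed K → N ∉ K → Bornology.IsBounded (φ.symm ⁻¹' K) := by
    intro K hK hNK
    have hsub : K ⊆ φ.source := by
      rw [hs]; exact subset_compl_singleton_iff.2 hNK
    refine ((hK.isCompact.image_of_continuousOn (φ.continuousOn.mono hsub)).isBounded).subset ?_
    intro z hz
    exact ⟨φ.symm z, hz, φ.right_inv (by simp [ht])⟩
  by_cases h : N ∈ U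
  · exact Or.inr (key _ hU.isClosed_compl (not_not.2 h))
  · refine Or.inl ((key _ isClosed_closure fun hc => hN ?_).subset (preimage_mono subset_closure))
    rw [hU.frontier_eq]
    exact ⟨hc, h⟩

namespace SphereDrawing

variable {n : ℕ} {D1 D2 : SphereDrawing n}

theorem exists_rot_eq (h1 : D1.IsGood) (h2 : D2.IsGood) {x : Fin n}
    (h : SameRotationAt D1 D2 x) {φ₁ φ₂ : OpenPartialHomeomorph Sph ℂ}
    (ht₁ : φ₁.target = univ)
    (hφ₁ : ∀ i j h t, D1.edge i j h t ∈ φ₁.source) (hφ₂ : ∀ i j h t, D2.edge i j h t ∈ φ₂.source) :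
    ∃ τ : ℂ, ∀ p q y, [x, p, q, y].Nodup →
      (D2.toPlanar h2 φ₂ hφ₂).rot x p q y = τ * (D1.toPlanar h1 φ₁ hφ₁).rot x p q y := by
  by_cases hx : ∃ u, x ≠ u
  swap
  · refine ⟨0, fun p q y hn => (hx ⟨p, ?_⟩).elim⟩
    simp at hn; grind
  obtain ⟨u₀, hu₀⟩ := hx
  obtain ⟨H, -, hHx, U, hU, hsub⟩ := h
  have hx₁ : D1.vert x ∈ φ₁.source := by simpa using hφ₁ x u₀ hu₀ 0
  have hx₂ : D2.vert x ∈ φ₂.source := by simpa using hφ₂ x u₀ hu₀ 0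
  have hc : Continuous φ₁.symm := by
    rw [← continuousOn_univ, ← ht₁]
    exact φ₁.continuousOn_symm
  have hnhds : φ₁.symm ⁻¹' (U ∩ H ⁻¹' φ₂.source) ∈ nhds (φ₁ (D1.vert x)) := by
    refine hc.continuousAt.preimage_mem_nhds ?_
    rw [φ₁.left_inv hx₁]
    exact Filter.inter_mem hU (H.continuous.continuousAt.preimage_mem_nhds
      (φ₂.open_source.mem_nhds (by rwa [hHx])))
  obtain ⟨r, hr, hball⟩ := Metric.mem_nhds_iff.1 hnhds
  obtain ⟨τ, hτ⟩ := ((D1.toPlanar h1 φ₁ hφ₁).arcStar x).rotation_invariance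
    ((D2.toPlanar h2 φ₂ hφ₂).arcStar x) (H := fun z => φ₂ (H (φ₁.symm z))) hr
    (φ₂.continuousOn.comp (H.continuous.comp hc).continuousOn fun z hz => (hball hz).2)
    (fun z hz w hw e => φ₁.symm.injOn (by simp [ht₁]) (by simp [ht₁])
      (H.injective (φ₂.injOn (hball hz).2 (hball hw).2 e)))
    (by
      change φ₂ (H (φ₁.symm (φ₁ (D1.vert x)))) = φ₂ (D2.vert x)
      rw [φ₁.left_inv hx₁, hHx])
    (by
      rintro ⟨u, hu⟩ t ht hb
      have hE := toPlanar_E h1 hφ₁ hu ⟨t, ht⟩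
      simp only at hE hb ⊢
      rw [hE] at hb ⊢
      have hmem := (hball hb).1
      rw [φ₁.left_inv (hφ₁ _ _ _ _)] at hmem ⊢
      obtain ⟨_, s, hs⟩ := mem_iUnion.1 (hsub u hu.symm ⟨_, ⟨edge_mem_arc hu _, hmem⟩, rfl⟩)
      exact ⟨s, s.2, (toPlanar_E h2 hφ₂ hu s).trans (by rw [hs])⟩)
  refine ⟨τ, fun p q y hn => ?_⟩
  simp only [List.nodup_cons, List.mem_cons, List.not_mem_nil, or_false, not_or,
    not_false_eq_true, List.nodup_nil, and_true] at hn
  obtain ⟨⟨hp, hq, hy⟩, ⟨hpq, hpy⟩, hqy⟩ := hn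
  exact hτ ⟨p, hp⟩ ⟨q, hq⟩ ⟨y, hy⟩ (by simpa using hpq) (by simpa using hqy)
    (by simpa using Ne.symm hpy)

theorem crossings_toPlanar {D : SphereDrawing n} (hD : D.IsGood)
    {φ : OpenPartialHomeomorph Sph ℂ} (hφ : ∀ i j h t, D.edge i j h t ∈ φ.source)
    {a a' b b' c c' : Fin n} {ha : a ≠ a'} {hb : b ≠ b'} {hc : c ≠ c'} {tb tc ua uc va vb : I}
    (hab : D.edge a a' ha tb = D.edge b b' hb ua) (hac : D.edge a a' ha tc = D.edge c c' hc va)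
    (hbc : D.edge b b' hb uc = D.edge c c' hc vb) :
    (D.toPlanar hD φ hφ).Crossings a a' b b' c c' tb tc ua uc va vb := by
  refine ⟨tb.2, tc.2, ua.2, uc.2, va.2, vb.2, ?_, ?_, ?_⟩ <;>
    simp only [toPlanar_E hD hφ ha, toPlanar_E hD hφ hb, toPlanar_E hD hφ hc, hab, hac, hbc]

end SphereDrawing

/-- Let `D1`, `D2` be good drawings of `K_n` with the same rotation
scheme, and let `e = a₁a₂`, `f = b₁b₂`, `g = c₁c₂` be three pairwise independent,
pairwise crossing edges forming a Reidemeister triangle for `D1` and `D2`: in each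
drawing the three segments between the pairwise crossing points bound a closed disc
whose closure avoids the six endpoints (a pre-Reidemeister triangle), and the two
crossings along `e` occur in opposite orders in the two drawings.  Then the triangular
disc of `D1` contains no vertex of `K_n`. -/
theorem reidemeister_triangle_empty {n : ℕ}
    (D1 D2 : SphereDrawing n) (h1 : D1.IsGood) (h2 : D2.IsGood)
    (hrot : SameRotation D1 D2)
    (a₁ a₂ b₁ b₂ c₁ c₂ : Fin n)
    (hnd : ([a₁, a₂, b₁, b₂, c₁, c₂] : List (Fin n)).Nodup)
    (ha : a₁ ≠ a₂) (hb : b₁ ≠ b₂) (hc : c₁ ≠ c₂)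
    -- crossing parameters in D1
    (t₁ef t₁eg u₁fe u₁fg v₁ge v₁gf : unitInterval)
    (h₁ef : (D1.edge a₁ a₂ ha) t₁ef = (D1.edge b₁ b₂ hb) u₁fe)
    (h₁eg : (D1.edge a₁ a₂ ha) t₁eg = (D1.edge c₁ c₂ hc) v₁ge)
    (h₁fg : (D1.edge b₁ b₂ hb) u₁fg = (D1.edge c₁ c₂ hc) v₁gf)
    (h₁ef' : (D1.edge a₁ a₂ ha) t₁ef ∈ D1.inner a₁ a₂ ∩ D1.inner b₁ b₂)
    (h₁eg' : (D1.edge a₁ a₂ ha) t₁eg ∈ D1.inner a₁ a₂ ∩ D1.inner c₁ c₂)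
    (h₁fg' : (D1.edge b₁ b₂ hb) u₁fg ∈ D1.inner b₁ b₂ ∩ D1.inner c₁ c₂)
    -- crossing parameters in D2
    (t₂ef t₂eg u₂fe u₂fg v₂ge v₂gf : unitInterval)
    (h₂ef : (D2.edge a₁ a₂ ha) t₂ef = (D2.edge b₁ b₂ hb) u₂fe)
    (h₂eg : (D2.edge a₁ a₂ ha) t₂eg = (D2.edge c₁ c₂ hc) v₂ge)
    (h₂fg : (D2.edge b₁ b₂ hb) u₂fg = (D2.edge c₁ c₂ hc) v₂gf)
    (h₂ef' : (D2.edge a₁ a₂ ha) t₂ef ∈ D2.inner a₁ a₂ ∩ D2.inner b₁ b₂)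
    (h₂eg' : (D2.edge a₁ a₂ ha) t₂eg ∈ D2.inner a₁ a₂ ∩ D2.inner c₁ c₂)
    (h₂fg' : (D2.edge b₁ b₂ hb) u₂fg ∈ D2.inner b₁ b₂ ∩ D2.inner c₁ c₂)
    -- the triangle curves: unions of the three segments between the crossings
    (C1 C2 : Set Sph)
    (hC1 : C1 = ⇑(D1.edge a₁ a₂ ha) '' Set.uIcc t₁ef t₁eg ∪
        ⇑(D1.edge b₁ b₂ hb) '' Set.uIcc u₁fe u₁fg ∪
        ⇑(D1.edge c₁ c₂ hc) '' Set.uIcc v₁ge v₁gf)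
    (hC2 : C2 = ⇑(D2.edge a₁ a₂ ha) '' Set.uIcc t₂ef t₂eg ∪
        ⇑(D2.edge b₁ b₂ hb) '' Set.uIcc u₂fe u₂fg ∪
        ⇑(D2.edge c₁ c₂ hc) '' Set.uIcc v₂ge v₂gf)
    -- pre-Reidemeister triangles: a side whose closure avoids the six endpoints
    (z₁ : Sph) (hz₁ : z₁ ∉ C1)
    (hpre1 : closure (connectedComponentIn C1ᶜ z₁) ∩
        ({D1.vert a₁, D1.vert a₂, D1.vert b₁, D1.vert b₂, D1.vert c₁, D1.vert c₂} :
          Set Sph) = ∅)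
    (hpre2 : ∃ z₂ : Sph, z₂ ∉ C2 ∧ closure (connectedComponentIn C2ᶜ z₂) ∩
        ({D2.vert a₁, D2.vert a₂, D2.vert b₁, D2.vert b₂, D2.vert c₁, D2.vert c₂} :
          Set Sph) = ∅)
    -- the two crossings along `e` occur in opposite orders in `D1` and `D2`
    (hopp : t₁ef < t₁eg ↔ t₂eg < t₂ef) :
    ∀ w : Fin n, D1.vert w ∉ connectedComponentIn C1ᶜ z₁ := by
  obtain ⟨N₁, hN₁⟩ := D1.exists_notMem_edges
  obtain ⟨N₂, hN₂⟩ := D2.exists_notMem_edges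
  obtain ⟨φ₁, hs₁, ht₁⟩ := exists_chart N₁
  obtain ⟨φ₂, hs₂, ht₂⟩ := exists_chart N₂
  have hφ₁ : ∀ i j h t, D1.edge i j h t ∈ φ₁.source := fun i j h t => by
    rw [hs₁]; exact hN₁ i j h t
  have hφ₂ : ∀ i j h t, D2.edge i j h t ∈ φ₂.source := fun i j h t => by
    rw [hs₂]; exact hN₂ i j h t
  intro w hw
  set U := connectedComponentIn C1ᶜ z₁ with hUdef
  have hsix : ∀ x ∈ ({a₁, a₂, b₁, b₂, c₁, c₂} : Set (Fin n)), D1.vert x ∉ closure U := by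
    intro x hx hc
    have : D1.vert x ∈ closure U ∩ ({D1.vert a₁, D1.vert a₂, D1.vert b₁, D1.vert b₂, D1.vert c₁,
        D1.vert c₂} : Set Sph) := by
      refine ⟨hc, ?_⟩
      rcases hx with rfl | rfl | rfl | rfl | rfl | rfl <;> simp
    rw [hpre1] at this
    exact this
  have hwx : ∀ x ∈ ({a₁, a₂, b₁, b₂, c₁, c₂} : Set (Fin n)), x ≠ w := by
    rintro x hx rfl
    exact hsix x hx (subset_closure hw)
  have hn7 : [a₁, a₂, b₁, b₂, c₁, c₂, w].Nodup := by
    have := hwx a₁ (by simp)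
    have := hwx a₂ (by simp)
    have := hwx b₁ (by simp)
    have := hwx b₂ (by simp)
    have := hwx c₁ (by simp)
    have := hwx c₂ (by simp)
    simp at hnd ⊢
    grind
  have hn5 : 5 ≤ n := by
    have := hn7.length_le_card
    simp at this
    omega
  have X₁ := SphereDrawing.crossings_toPlanar h1 hφ₁ h₁ef h₁eg h₁fg
  have X₂ := SphereDrawing.crossings_toPlanar h2 hφ₂ h₂ef h₂eg h₂fg
  have hclosed : IsClosed C1 := by
    have hK : ∀ {x y : Sph} (f : Path x y) (s t : I), IsClosed (f '' uIcc s t) := fun f s t =>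
      (isCompact_uIcc.image f.continuous).isClosed
    rw [hC1]
    exact ((hK _ _ _).union (hK _ _ _)).union (hK _ _ _)
  have : Fact (Module.finrank ℝ (EuclideanSpace ℝ (Fin 3)) = 2 + 1) := ⟨by simp⟩
  have : LocallyConnectedSpace Sph :=
    ChartedSpace.locallyConnectedSpace (EuclideanSpace ℝ (Fin 2)) Sph
  have hUo : IsOpen U := hclosed.isOpen_compl.connectedComponentIn
  have hfr : frontier U ⊆ C1 := by
    simpa using frontier_connectedComponentIn_subset hclosed.isOpen_compl z₁
  have hNC : N₁ ∉ C1 := by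
    rw [hC1]
    rintro ((⟨t, -, h⟩ | ⟨t, -, h⟩) | ⟨t, -, h⟩) <;> exact hN₁ _ _ _ _ h
  have hcont : Continuous φ₁.symm := by
    rw [← continuousOn_univ, ← ht₁]
    exact φ₁.continuousOn_symm
  have hvs : ∀ x y (h : x ≠ y), D1.vert x ∈ φ₁.source := fun x y h => by
    simpa using hφ₁ x y h 0
  refine PlanarDrawing.false_of_wind_ne hn5 (fun x =>
    SphereDrawing.exists_rot_eq h1 h2 (hrot x) ht₁ hφ₁ hφ₂) hn7 X₁ X₂ ?_ fun x hx => ?_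
  · have e1 := (X₁.ne hnd).1
    have e2 := (X₂.ne hnd).1
    simp only [ne_eq, Subtype.ext_iff.symm] at e1 e2
    simp only [Subtype.coe_lt_coe]
    rcases lt_or_gt_of_ne e1 with h | h
    · exact Or.inl ⟨h, hopp.1 h⟩
    · exact Or.inr ⟨h, (lt_or_gt_of_ne e2).resolve_right fun h' => h.not_gt (hopp.2 h')⟩
  · have hx6 : x ∈ ({a₁, a₂, b₁, b₂, c₁, c₂} : Set (Fin n)) := by
      rcases hx with rfl | rfl | rfl | rfl <;> simp
    have hxw := hwx x hx6
    have hmem : ∀ {i j : Fin n} (h : i ≠ j) {s t r : I} {z : ℂ}, r ∈ uIcc s t →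
        D1.edge i j h r = φ₁.symm z →
        z ∈ (D1.toPlanar h1 φ₁ hφ₁).E i j '' uIcc (s : ℝ) (t : ℝ) := by
      intro i j h s t r z hr e
      refine ⟨r, ?_, ?_⟩
      · simpa only [mem_uIcc, Subtype.coe_le_coe] using hr
      · rw [SphereDrawing.toPlanar_E h1 hφ₁ h, e, φ₁.right_inv (by simp [ht₁])]
    refine (X₁.wind_ne hnd (U := φ₁.symm ⁻¹' U) (hUo.preimage hcont) ?_
      (isBounded_chart_preimage hs₁ ht₁ hUo fun h => hNC (hfr h)) ?_ ?_).symm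
    · intro z hz
      have hz' := hfr (hcont.frontier_preimage_subset U hz)
      rw [hC1] at hz'
      rcases hz' with (⟨r, hr, e⟩ | ⟨r, hr, e⟩) | ⟨r, hr, e⟩
      · exact Or.inl (Or.inl (hmem ha hr e))
      · exact Or.inl (Or.inr (hmem hb hr e))
      · exact Or.inr (hmem hc hr e)
    · change φ₁.symm (φ₁ (D1.vert w)) ∈ U
      rwa [φ₁.left_inv (hvs _ _ hxw.symm)]
    · intro h
      have h' : φ₁.symm (φ₁ (D1.vert x)) ∈ closure U := hcont.closure_preimage_subset U h
      rw [φ₁.left_inv (hvs _ _ hxw)] at h'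
      exact hsix x hx6 h'
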